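/- Let q be an even prime power with q ≥ 2048, and let K be a complete k-cap in PG(4, q) with k ≥ q³ − 2q² + 3q√q + 8q − 9√q − 6. Then every point N of PG(4, q) not in K lies on at most q² tangent lines of K. -/

import Mathlib

open Module

/-- Points of the projective space `PG(n, q)` over the field `F` (with `q = |F|`). -/
abbrev PGPoint (F : Type*) [Field F] (n : ℕ) := Projectivization F (Fin (n + 1) → F)

/-- The set of projective points lying in the projective subspace determined by
a linear subspace `W`. -/
def ptsIn {F : Type*} [Field F] {n : ℕ} (W : Submodule F (Fin (n + 1) → F)) :
    Set (PGPoint F n) := {P | P.submodule ≤ W}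

/-- Three points of `PG(n, q)` are collinear if they lie on a common line. -/
def Coll3 {F : Type*} [Field F] {n : ℕ} (P₁ P₂ P₃ : PGPoint F n) : Prop :=
  Module.finrank F ↥(P₁.submodule ⊔ P₂.submodule ⊔ P₃.submodule) ≤ 2

/-- A cap (a plane arc when `n = 2`): a set of points no three of which are collinear. -/
def IsCap {F : Type*} [Field F] {n : ℕ} (K : Set (PGPoint F n)) : Prop :=
  ∀ P₁ ∈ K, ∀ P₂ ∈ K, ∀ P₃ ∈ K, P₁ ≠ P₂ → P₁ ≠ P₃ → P₂ ≠ P₃ → ¬ Coll3 P₁ P₂ P₃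

/-- A complete cap: a cap that is not contained in a cap with one more point. -/
def IsCompleteCap {F : Type*} [Field F] {n : ℕ} (K : Set (PGPoint F n)) : Prop :=
  IsCap K ∧ ∀ P ∉ K, ¬ IsCap (insert P K)

/-- A tangent line of `K`: a line (2-dimensional linear subspace) meeting `K`
in exactly one point. -/
def IsTangent {F : Type*} [Field F] {n : ℕ} (K : Set (PGPoint F n))
    (W : Submodule F (Fin (n + 1) → F)) : Prop :=
  Module.finrank F W = 2 ∧ (ptsIn W ∩ K).ncard = 1

open Module

namespace CapAux
open Classical Polynomial

section AL
variable {F : Type*} [Field F] [Fintype F]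

lemma sum_eval_monic (f : F[X]) (hf : f.Monic) (hd : f.natDegree = Fintype.card F - 1) :
    ∑ y : F, f.eval y = -1 := by
  have hq : 1 < Fintype.card F := Fintype.one_lt_card
  have h1 : ∀ y : F, f.eval y = ∑ i ∈ Finset.range (Fintype.card F), f.coeff i * y ^ i := by
    intro y
    rw [eval_eq_sum_range, hd, Nat.sub_add_cancel hq.le]
  simp_rw [h1]
  rw [Finset.sum_comm]
  simp_rw [← Finset.mul_sum]
  have : Fintype.card F = (Fintype.card F - 1) + 1 := by omega
  rw [this, Finset.sum_range_succ, Finset.sum_eq_zero]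
  · rw [← hd, hf.coeff_natDegree, hd, zero_add, one_mul]
    have h0 : (0:F) ∈ (Finset.univ : Finset F) := Finset.mem_univ _
    rw [← Finset.add_sum_erase _ _ h0, zero_pow (by omega), zero_add]
    rw [Finset.sum_congr rfl (g := fun _ => (1:F))]
    · rw [Finset.sum_const, Finset.card_erase_of_mem h0, Finset.card_univ, nsmul_eq_mul, mul_one,
        Nat.cast_sub hq.le]
      simp
    · intro x hx
      exact FiniteField.pow_card_sub_one_eq_one x (Finset.ne_of_mem_erase hx)
  · intro i hi
    rw [FiniteField.sum_pow_lt_card_sub_one, mul_zero]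
    simpa using hi

lemma poly_eq_zero_of_eval (f : F[X]) (hd : f.natDegree < Fintype.card F)
    (h : ∀ y, f.eval y = 0) : f = 0 := by
  by_contra hne
  have h1 := Polynomial.card_roots' f
  have h2 : (Finset.univ : Finset F).val ≤ f.roots := by
    rw [Multiset.le_iff_subset (Finset.univ : Finset F).nodup]
    intro y _
    rw [mem_roots hne]; exact h y
  have h3 := Multiset.card_le_card h2
  have h4 : (Finset.univ : Finset F).val.card = Fintype.card F := rfl
  omega

lemma prod_ne_zero_eq : ∏ m ∈ (Finset.univ : Finset F).erase 0, m = -1 := by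
  have h := congrArg (Units.val) (FiniteField.prod_univ_units_id_eq_neg_one (K := F))
  rw [Units.coe_prod, Units.val_neg, Units.val_one] at h
  have h' := Finset.prod_map Finset.univ ⟨fun u : Fˣ => (u : F), Units.val_injective⟩ (fun m => m)
  rw [← h]
  refine Eq.trans ?_ h'
  apply Finset.prod_congr _ (fun _ _ => rfl)
  ext m
  simp only [Finset.mem_erase, Finset.mem_univ, and_true, Finset.mem_map, true_and,
    Function.Embedding.coeFn_mk]
  constructor
  · intro h; exact ⟨Units.mk0 m h, rfl⟩
  · rintro ⟨u, rfl⟩; exact u.ne_zero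

theorem AL [CharP F 2] (I : Finset (F × F))
    (ha : ∀ i ∈ I, ∀ j ∈ I, i ≠ j → i.1 ≠ j.1) (hb : ∀ i ∈ I, ∀ j ∈ I, i ≠ j → i.2 ≠ j.2)
    (hc : ∀ i ∈ I, ∀ j ∈ I, ∀ l ∈ I, i ≠ j → i ≠ l → j ≠ l →
      (i.1 + j.1) * (i.2 + l.2) ≠ (i.1 + l.1) * (i.2 + j.2)) :
    2 * (I.image (fun p => p.1 + p.2)).card ≤ Fintype.card F := by
  by_contra hcon
  push Not at hcon
  set q := Fintype.card F with hq
  have hq1 : 1 < q := Fintype.one_lt_card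
  have h2 : (2 : F) = 0 := CharTwo.two_eq_zero
  have hs0 : ∀ x y : F, x ≠ y → x + y ≠ 0 := by
    intro x y hxy h; exact hxy (CharTwo.add_eq_zero.1 h)
  set n := I.card with hn
  have hnq : n ≤ q := by
    rw [hn, ← Finset.card_image_of_injOn (f := Prod.fst) (s := I)]
    · exact Finset.card_le_univ _
    · intro i hi j hj h; by_contra hne; exact ha i hi j hj hne h
  -- slopes
  set sl : F × F → F × F → F := fun i j => (i.2 + j.2) * (i.1 + j.1)⁻¹ with hsl
  have hsl0 : ∀ i ∈ I, ∀ j ∈ I, i ≠ j → sl i j ≠ 0 := by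
    intro i hi j hj hij
    exact mul_ne_zero (hs0 _ _ (hb i hi j hj hij)) (inv_ne_zero (hs0 _ _ (ha i hi j hj hij)))
  have hslinj : ∀ i ∈ I, ∀ j ∈ I, ∀ l ∈ I, i ≠ j → i ≠ l → j ≠ l → sl i j ≠ sl i l := by
    intro i hi j hj l hl hij hil hjl h
    have e1 := hs0 _ _ (ha i hi j hj hij)
    have e2 := hs0 _ _ (ha i hi l hl hil)
    apply hc i hi j hj l hl hij hil hjl
    simp only [hsl] at h
    field_simp at h
    linear_combination -h
  set M : F × F → Finset F := fun i => (Finset.univ.erase 0) \ ((I.erase i).image (sl i)) with hM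
  set G : F × F → F[X] := fun i => C (∏ j ∈ I.erase i, (i.1 + j.1))⁻¹ * ∏ m ∈ M i, (X - C m) with hG
  set c : F × F → F[X] := fun i => C i.2 + C i.1 * X with hcdef
  set Z : F[X] := ∏ m ∈ Finset.univ.erase (0:F), (X - C m) with hZ
  have hcc : ∀ i ∈ I, ∀ j ∈ I.erase i, c i + c j = C (i.1 + j.1) * (X - C (sl i j)) := by
    intro i hi j hj
    have e1 := hs0 _ _ (ha i hi j (Finset.mem_of_mem_erase hj) (Finset.ne_of_mem_erase hj).symm)
    have : i.2 + j.2 = (i.1 + j.1) * sl i j := by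
      simp only [hsl]; field_simp
    simp only [hcdef]
    rw [mul_sub, ← C_mul, ← this]
    have h22 : (2 : F[X]) = 0 := by
      have h := congrArg (C : F → F[X]) h2
      rwa [C_0, map_ofNat] at h
    simp only [C_add]
    linear_combination (C i.2 + C j.2) * h22
  have hinjsl : ∀ i ∈ I, Set.InjOn (sl i) (I.erase i : Finset (F × F)) := by
    intro i hi j hj l hl h
    by_contra hne
    have hj' := Finset.mem_coe.1 hj
    have hl' := Finset.mem_coe.1 hl
    exact hslinj i hi j (Finset.mem_of_mem_erase hj') l (Finset.mem_of_mem_erase hl')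
      (Finset.ne_of_mem_erase hj').symm (Finset.ne_of_mem_erase hl').symm hne h
  have hsub : ∀ i ∈ I, (I.erase i).image (sl i) ⊆ Finset.univ.erase 0 := by
    intro i hi m hm
    obtain ⟨j, hj, rfl⟩ := Finset.mem_image.1 hm
    rw [Finset.mem_erase]
    exact ⟨hsl0 i hi j (Finset.mem_of_mem_erase hj) (Finset.ne_of_mem_erase hj).symm, Finset.mem_univ _⟩
  have hGP : ∀ i ∈ I, G i * ∏ j ∈ I.erase i, (c i + c j) = Z := by
    intro i hi
    rw [Finset.prod_congr rfl (hcc i hi), Finset.prod_mul_distrib]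
    rw [← Finset.prod_image (f := fun m => X - C m) (hinjsl i hi)]
    rw [hZ, ← Finset.prod_sdiff (hsub i hi)]
    have e0 : ∏ j ∈ I.erase i, (i.1 + j.1) ≠ 0 := by
      rw [Finset.prod_ne_zero_iff]
      intro j hj
      exact hs0 _ _ (ha i hi j (Finset.mem_of_mem_erase hj) (Finset.ne_of_mem_erase hj).symm)
    simp only [hG, hM]
    rw [← map_prod C]
    have : C (∏ j ∈ I.erase i, (i.1 + j.1))⁻¹ * C (∏ j ∈ I.erase i, (i.1 + j.1)) = (1 : F[X]) := by
      rw [← C_mul, inv_mul_cancel₀ e0, C_1]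
    linear_combination (∏ m ∈ (Finset.univ.erase 0) \ ((I.erase i).image (sl i)), (X - C m)) *
      (∏ m ∈ ((I.erase i).image (sl i)), (X - C m)) * this
  have hGdeg : ∀ i ∈ I, (G i).natDegree ≤ q - n := by
    intro i hi
    simp only [hG]
    refine (natDegree_C_mul_le _ _).trans ?_
    rw [natDegree_prod_of_monic _ _ (fun m _ => monic_X_sub_C m)]
    simp only [natDegree_X_sub_C, Finset.sum_const, smul_eq_mul, mul_one]
    simp only [hM]
    rw [Finset.card_sdiff_of_subset (hsub i hi), Finset.card_image_of_injOn (hinjsl i hi),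
      Finset.card_erase_of_mem hi, Finset.card_erase_of_mem (Finset.mem_univ _), Finset.card_univ]
    have : 0 < I.card := Finset.card_pos.2 ⟨i, hi⟩
    omega
  have hceval : ∀ i ∈ I, ∀ j ∈ I, i ≠ j → ∀ m, (c i).eval m = (c j).eval m → m = sl i j := by
    intro i hi j hj hij m h
    have := congrArg (eval m) (hcc i hi j (Finset.mem_erase.2 ⟨hij.symm, hj⟩))
    rw [eval_add, h, CharTwo.add_self_eq_zero] at this
    simp only [eval_mul, eval_C, eval_sub, eval_X] at this
    rcases mul_eq_zero.1 this.symm with h' | h'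
    · exact absurd h' (hs0 _ _ (ha i hi j hj hij))
    · exact sub_eq_zero.1 h'
  have hceval' : ∀ i ∈ I, ∀ j ∈ I, i ≠ j →  (c i).eval (sl i j) = (c j).eval (sl i j) := by
    intro i hi j hj hij
    have := congrArg (eval (sl i j)) (hcc i hi j (Finset.mem_erase.2 ⟨hij.symm, hj⟩))
    simp only [eval_add, eval_mul, eval_C, eval_sub, eval_X, sub_self, mul_zero] at this
    exact CharTwo.add_eq_zero.1 this
  have hG0 : ∀ i ∈ I, ∀ m, m ≠ 0 → (∀ j ∈ I, i ≠ j → (c i).eval m ≠ (c j).eval m) → (G i).eval m = 0 := by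
    intro i hi m hm h
    have : m ∈ M i := by
      simp only [hM, Finset.mem_sdiff, Finset.mem_erase, Finset.mem_univ, and_true, Finset.mem_image,
        not_exists, not_and]
      refine ⟨hm, ?_⟩
      rintro j ⟨hj1, hj2⟩ rfl
      exact h j hj2 hj1.symm (hceval' i hi j hj2 hj1.symm)
    simp only [hG, eval_mul, eval_prod]
    rw [Finset.prod_eq_zero this (by simp), mul_zero]
  have hGe : ∀ i ∈ I, ∀ j ∈ I, i ≠ j → ∀ m, (c i).eval m = (c j).eval m → (G i).eval m = (G j).eval m := by
    intro i hi j hj hij m hm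
    have hjI : j ∈ I.erase i := Finset.mem_erase.2 ⟨hij.symm, hj⟩
    have hiI : i ∈ I.erase j := Finset.mem_erase.2 ⟨hij, hi⟩
    have e1 := hGP i hi
    have e2 := hGP j hj
    rw [← Finset.mul_prod_erase _ _ hjI] at e1
    rw [← Finset.mul_prod_erase _ _ hiI, Finset.erase_right_comm] at e2
    have hne : c i + c j ≠ 0 := by
      rw [hcc i hi j hjI]
      refine mul_ne_zero ?_ (X_sub_C_ne_zero _)
      rw [Ne, C_eq_zero]
      exact hs0 _ _ (ha i hi j hj hij)
    have e3 : (c i + c j) * (G i * ∏ l ∈ (I.erase i).erase j, (c i + c l)) =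
        (c i + c j) * (G j * ∏ l ∈ (I.erase i).erase j, (c j + c l)) := by
      linear_combination e1 - e2
    have e4 := congrArg (eval m) (mul_left_cancel₀ hne e3)
    simp only [eval_mul, eval_prod, eval_add] at e4
    rw [hm] at e4
    refine mul_right_cancel₀ ?_ e4
    rw [Finset.prod_ne_zero_iff]
    intro l hl h
    rw [CharTwo.add_eq_zero] at h
    simp only [Finset.mem_erase] at hl
    have s1 := hceval i hi j hj hij m hm
    have s2 := hceval i hi l hl.2.2 (Ne.symm hl.2.1) m (hm.trans h)
    exact hslinj i hi j hj l hl.2.2 hij (Ne.symm hl.2.1) (Ne.symm hl.1) (s1.symm.trans s2)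
  -- values
  set vals := I.image (fun p => p.1 + p.2) with hvals
  set dbl := vals.filter (fun y => 2 ≤ (I.filter (fun p => p.1 + p.2 = y)).card) with hdbl
  have hcount : vals.card + dbl.card ≤ n := by
    have e1 : n = ∑ y ∈ vals, (I.filter (fun p => p.1 + p.2 = y)).card :=
      Finset.card_eq_sum_card_fiberwise (fun p hp => Finset.mem_image_of_mem _ hp)
    have e2 : dbl.card = ∑ y ∈ vals, if 2 ≤ (I.filter (fun p => p.1 + p.2 = y)).card then 1 else 0 := by
      rw [hdbl, Finset.card_filter]
    rw [e2, Finset.card_eq_sum_ones, ← Finset.sum_add_distrib, e1]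
    apply Finset.sum_le_sum
    intro y hy
    split_ifs with h
    · exact h
    · obtain ⟨p, hp, hpy⟩ := Finset.mem_image.1 hy
      exact Finset.card_pos.2 ⟨p, Finset.mem_filter.2 ⟨hp, hpy⟩⟩
  obtain ⟨r, hr⟩ : ∃ r, 2 * n = q + 1 + 2 * dbl.card + r := Nat.exists_eq_add_of_le (by omega)
  set D : F[X] := ∏ y ∈ dbl, (X - C y) with hD
  have hDm : D.Monic := monic_prod_of_monic _ _ (fun y _ => monic_X_sub_C y)
  have hDd : D.natDegree = dbl.card := by
    rw [hD, natDegree_prod_of_monic _ _ (fun m _ => monic_X_sub_C m)]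
    simp
  set H : F[X] := X ^ r * D ^ 2 with hH
  have hHm : H.Monic := (monic_X_pow r).mul (hDm.pow 2)
  have hHd : H.natDegree = r + 2 * dbl.card := by
    rw [hH, (monic_X_pow r).natDegree_mul (hDm.pow 2), natDegree_X_pow, hDm.natDegree_pow, hDd]
  set B : F[X] := ∑ i ∈ I, G i ^ 2 * H.comp (c i) with hB
  have hBd : B.natDegree ≤ q - 1 := by
    apply natDegree_sum_le_of_forall_le
    intro i hi
    refine natDegree_mul_le.trans ?_
    have d1 : (G i ^ 2).natDegree ≤ 2 * (q - n) := 
      natDegree_pow_le.trans (Nat.mul_le_mul_left 2 (hGdeg i hi))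
    have d2 : (H.comp (c i)).natDegree ≤ H.natDegree * 1 := by
      refine natDegree_comp_le.trans (Nat.mul_le_mul_left _ ?_)
      simp only [hcdef]
      compute_degree
    rw [hHd] at d2
    omega
  have hB0 : ∀ m, m ≠ 0 → B.eval m = 0 := by
    intro m hm
    rw [hB, eval_finsetSum]
    set par : F × F → Prop := fun i => ∃ j ∈ I, i ≠ j ∧ (c i).eval m = (c j).eval m with hpar
    refine Finset.sum_involution (fun i _ => if h : par i then h.choose else i) ?_ ?_ ?_ ?_
    · intro i hi
      split_ifs with h
      · obtain ⟨h1, h2, h3⟩ := h.choose_spec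
        simp only [eval_mul, eval_pow, eval_comp]
        have h4 := hGe i hi _ h1 h2 m h3
        generalize h.choose = j at *
        rw [h4, h3, CharTwo.add_self_eq_zero]
      · rw [CharTwo.add_self_eq_zero]
    · intro i hi hne
      split_ifs with h
      · exact h.choose_spec.2.1.symm
      · exfalso; apply hne
        rw [eval_mul, eval_pow, hG0 i hi m hm, zero_pow two_ne_zero, zero_mul]
        intro j hj hij h'
        exact h ⟨j, hj, hij, h'⟩
    · intro i hi
      split_ifs with h
      · exact h.choose_spec.1
      · exact hi
    · intro i hi
      by_cases h : par i
      · obtain ⟨h1, h2, h3⟩ := h.choose_spec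
        have hp : par h.choose := ⟨i, hi, h2.symm, h3.symm⟩
        obtain ⟨k1, k2, k3⟩ := hp.choose_spec
        simp only [h, dif_pos, hp]
        by_contra hne
        have s1 := hceval _ h1 _ k1 k2 m k3
        have s2 := hceval _ h1 _ hi h2.symm m h3.symm
        exact hslinj _ h1 _ k1 _ hi k2 h2.symm hne (s1.symm.trans s2)
      · simp only [h, dif_neg, not_false_iff]
  have hneg : (-1 : F) = 1 := CharTwo.neg_eq 1
  have hZ0 : Z.eval 0 = 1 := by
    rw [hZ, eval_prod]
    simp only [eval_sub, eval_X, eval_C, zero_sub, CharTwo.neg_eq]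
    rw [prod_ne_zero_eq, hneg]
  have hBat0 : B.eval 0 = 1 := by
    set g : F[X] := ∏ y ∈ Finset.univ \ I.image Prod.snd, (X - C y) with hg
    have hgm : g.Monic := monic_prod_of_monic _ _ (fun y _ => monic_X_sub_C y)
    have hsinj : Set.InjOn Prod.snd (I : Set (F × F)) := by
      intro i hi j hj h; by_contra hne; exact hb i hi j hj hne h
    have hgd : g.natDegree = q - n := by
      rw [hg, natDegree_prod_of_monic _ _ (fun m _ => monic_X_sub_C m)]
      simp only [natDegree_X_sub_C, Finset.sum_const, smul_eq_mul, mul_one]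
      rw [Finset.card_sdiff_of_subset (Finset.subset_univ _), Finset.card_image_of_injOn hsinj,
        Finset.card_univ]
    have key := sum_eval_monic (g ^ 2 * H) ((hgm.pow 2).mul hHm) (by
      rw [(hgm.pow 2).natDegree_mul hHm, hgm.natDegree_pow, hgd, hHd]; omega)
    rw [hneg] at key
    rw [← key, hB, eval_finsetSum]
    rw [← Finset.sum_subset (Finset.subset_univ (I.image Prod.snd))]
    · rw [Finset.sum_image hsinj]
      apply Finset.sum_congr rfl
      intro i hi
      have hci : (c i).eval 0 = i.2 := by simp [hcdef]
      simp only [eval_mul, eval_pow, eval_comp, hci]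
      congr 2
      have e1 := congrArg (eval 0) (hGP i hi)
      rw [eval_mul, hZ0, eval_prod] at e1
      have e2 : ∀ j ∈ I.erase i, (c i + c j).eval 0 = i.2 + j.2 := by
        intro j _; simp [hcdef]
      rw [Finset.prod_congr rfl e2] at e1
      have e3 : g.eval i.2 * ∏ j ∈ I.erase i, (i.2 + j.2) = 1 := by
        rw [hg, eval_prod]
        simp only [eval_sub, eval_X, eval_C]
        have : ∏ j ∈ I.erase i, (i.2 + j.2) = ∏ y ∈ (I.image Prod.snd).erase i.2, (i.2 - y) := by
          have : (I.image Prod.snd).erase i.2 = (I.erase i).image Prod.snd := by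
            ext y
            simp only [Finset.mem_erase, Finset.mem_image]
            constructor
            · rintro ⟨h1, j, hj, rfl⟩
              exact ⟨j, ⟨fun h => h1 (by rw [h]), hj⟩, rfl⟩
            · rintro ⟨j, ⟨hj1, hj2⟩, rfl⟩
              exact ⟨hb j hj2 i hi hj1, j, hj2, rfl⟩
          rw [this, Finset.prod_image]
          · apply Finset.prod_congr rfl
            intro j _; rw [CharTwo.sub_eq_add]
          · intro x hx y hy h
            exact hsinj (Finset.mem_of_mem_erase hx) (Finset.mem_of_mem_erase hy) h
        rw [this]
        have hs : Finset.univ \ I.image Prod.snd = (Finset.univ.erase i.2) \ ((I.image Prod.snd).erase i.2) := by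
          ext y
          simp only [Finset.mem_sdiff, Finset.mem_univ, true_and, Finset.mem_erase, and_true, not_and]
          constructor
          · intro h
            exact ⟨fun h' => h (h' ▸ Finset.mem_image_of_mem _ hi), fun _ => h⟩
          · rintro ⟨h1, h2⟩; exact h2 h1
        rw [hs, Finset.prod_sdiff (Finset.erase_subset_erase _ (Finset.subset_univ _))]
        rw [← hneg, ← prod_ne_zero_eq]
        refine Finset.prod_bij (fun y _ => i.2 - y) ?_ ?_ ?_ ?_
        · intro y hy
          simp only [Finset.mem_erase, Finset.mem_univ, and_true] at hy ⊢
          exact sub_ne_zero.2 (Ne.symm hy)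
        · intro y _ y' _ h; exact sub_right_injective h
        · intro z hz
          refine ⟨i.2 - z, ?_, by ring⟩
          simp only [Finset.mem_erase, Finset.mem_univ, and_true] at hz ⊢
          intro h; apply hz; linear_combination -h
        · intro _ _; rfl
      have e4 : ∏ j ∈ I.erase i, (i.2 + j.2) ≠ 0 := by
        intro h; rw [h, mul_zero] at e3; exact zero_ne_one e3
      exact mul_right_cancel₀ e4 (e1.trans e3.symm)
    · intro y _ hy
      have : g.eval y = 0 := by
        rw [hg, eval_prod]
        apply Finset.prod_eq_zero (i := y)
        · simp only [Finset.mem_sdiff, Finset.mem_univ, true_and]; exact hy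
        · simp
      rw [eval_mul, eval_pow, this, zero_pow two_ne_zero, zero_mul]
  have hBeq : B = 1 - X ^ (q - 1) := by
    rw [← sub_eq_zero]
    apply poly_eq_zero_of_eval
    · have : (B - (1 - X ^ (q - 1))).natDegree ≤ q - 1 := by
        refine (natDegree_sub_le_of_le hBd (n := q - 1) ?_).trans (by simp)
        refine (natDegree_sub_le _ _).trans ?_
        simp
      omega
    · intro y
      by_cases hy : y = 0
      · subst hy
        rw [eval_sub, hBat0]
        simp [zero_pow (show q - 1 ≠ 0 by omega)]
      · rw [eval_sub, hB0 y hy]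
        simp only [eval_sub, eval_one, eval_pow, eval_X]
        rw [FiniteField.pow_card_sub_one_eq_one y hy]; ring
  have hd1 : (derivative B).eval 1 = 1 := by
    rw [hBeq]
    simp only [derivative_sub, derivative_one, derivative_X_pow, eval_sub, eval_zero, eval_mul, eval_C,
      eval_pow, eval_X, one_pow, mul_one, zero_sub]
    rw [Nat.cast_sub hq1.le]
    simp [hq]
  have hd2 : (derivative B).eval 1 = 0 := by
    rw [hB, derivative_sum, eval_finsetSum]
    apply Finset.sum_eq_zero
    intro i hi
    have hci : (c i).eval 1 = i.1 + i.2 := by simp [hcdef, add_comm]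
    rw [derivative_mul, derivative_pow, derivative_comp]
    simp only [eval_add, eval_mul, eval_pow, eval_comp, hci]
    have h20 : (C ((2:ℕ):F)) = (0 : F[X]) := by simp [h2]
    rw [h20]
    by_cases hs : i.1 + i.2 ∈ dbl
    · have hD0 : D.eval (i.1 + i.2) = 0 := by
        rw [hD, eval_prod]
        exact Finset.prod_eq_zero hs (by simp)
      have : (derivative H).eval (i.1 + i.2) = 0 := by
        rw [hH, derivative_mul, derivative_pow D]
        simp [hD0]
      rw [this]; simp
    · have : (G i).eval 1 = 0 := by
        apply hG0 i hi 1 one_ne_zero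
        intro j hj hij h
        apply hs
        rw [hdbl, Finset.mem_filter]
        refine ⟨Finset.mem_image_of_mem (fun p : F × F => p.1 + p.2) hi, ?_⟩
        have hcj : (c j).eval 1 = j.1 + j.2 := by simp [hcdef, add_comm]
        have : ({i, j} : Finset (F × F)) ⊆ I.filter (fun p => p.1 + p.2 = i.1 + i.2) := by
          intro x hx
          rw [Finset.mem_insert, Finset.mem_singleton] at hx
          rw [Finset.mem_filter]
          rcases hx with rfl | rfl
          · exact ⟨hi, rfl⟩
          · exact ⟨hj, by rw [← hci, ← hcj, h]⟩
        have h5 := Finset.card_le_card this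
        rwa [Finset.card_pair hij] at h5
      rw [this]; simp
  rw [hd1] at hd2
  exact one_ne_zero hd2
end AL
end CapAux

open Module

namespace CapAux
open Classical

section Geo
variable {F V : Type*} [Field F] [Fintype F] [AddCommGroup V] [Module F V] [Fintype V]
  [Fintype (Submodule F V)]

/-- immediate successors of U inside W -/
noncomputable def ext (U W : Submodule F V) : Finset (Submodule F V) :=
  Finset.univ.filter (fun X => U ≤ X ∧ X ≤ W ∧ finrank F X = finrank F U + 1)

lemma mem_ext {U W X : Submodule F V} :
    X ∈ ext U W ↔ U ≤ X ∧ X ≤ W ∧ finrank F X = finrank F U + 1 := by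
  simp [ext]

/-- number of members of S contained in W -/
noncomputable def cnt {ι : Type*} (φ : ι → Submodule F V) (S : Finset ι) (W : Submodule F V) : ℕ :=
  (S.filter (fun s => φ s ≤ W)).card

lemma dim_add (U W : Submodule F V) :
    finrank F ↥(U ⊔ W) + finrank F ↥(U ⊓ W) = finrank F U + finrank F W :=
  Submodule.finrank_sup_add_finrank_inf_eq U W

lemma dim_mono {U W : Submodule F V} (h : U ≤ W) : finrank F U ≤ finrank F W :=
  Submodule.finrank_mono h

lemma eq_of_le_dim {U W : Submodule F V} (h : U ≤ W) (hd : finrank F W ≤ finrank F U) : U = W :=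
  Submodule.eq_of_le_of_finrank_le h hd

lemma dim_lt {U W : Submodule F V} (h : U ≤ W) (h' : ¬ W ≤ U) : finrank F U < finrank F W := by
  by_contra hc
  exact h' (eq_of_le_dim h (by omega)).ge

lemma cnt_split {ι : Type*} (φ : ι → Submodule F V) (S : Finset ι) {U W : Submodule F V} (h : U ≤ W) :
    cnt φ S W = cnt φ S U + (S.filter (fun s => φ s ≤ W ∧ ¬ φ s ≤ U)).card := by
  unfold cnt
  rw [← Finset.card_union_of_disjoint]
  · congr 1
    ext s
    simp only [Finset.mem_filter, Finset.mem_union]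
    constructor
    · rintro ⟨h1, h2⟩
      by_cases h3 : φ s ≤ U
      · exact Or.inl ⟨h1, h3⟩
      · exact Or.inr ⟨h1, h2, h3⟩
    · rintro (⟨h1, h2⟩ | ⟨h1, h2, h3⟩)
      · exact ⟨h1, h2.trans h⟩
      · exact ⟨h1, h2⟩
  · rw [Finset.disjoint_left]
    intro s h1 h2
    simp only [Finset.mem_filter] at h1 h2
    exact h2.2.2 h1.2

lemma cnt_mono {ι : Type*} (φ : ι → Submodule F V) (S : Finset ι) {U W : Submodule F V} (h : U ≤ W) :
    cnt φ S U ≤ cnt φ S W := by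
  rw [cnt_split φ S h]; omega

lemma part {ι : Type*} (φ : ι → Submodule F V) (S : Finset ι) {U W : Submodule F V} (h : U ≤ W)
    (hS : ∀ s ∈ S, ¬ φ s ≤ U → finrank F ↥(U ⊔ φ s) = finrank F U + 1) :
    ∑ X ∈ ext U W, ((cnt φ S X : ℤ) - cnt φ S U) = (cnt φ S W : ℤ) - cnt φ S U := by
  have e1 : ∀ X ∈ ext U W, ((cnt φ S X : ℤ) - cnt φ S U) =
      (((S.filter (fun s => φ s ≤ X ∧ ¬ φ s ≤ U)).card : ℕ) : ℤ) := by
    intro X hX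
    rw [cnt_split φ S (mem_ext.1 hX).1]; push_cast; ring
  rw [Finset.sum_congr rfl e1, cnt_split φ S h, ← Nat.cast_sum]
  push_cast
  rw [add_sub_cancel_left, ← Nat.cast_sum, Nat.cast_inj]
  symm
  rw [Finset.card_eq_sum_card_fiberwise (f := fun s => U ⊔ φ s) (t := ext U W)]
  · apply Finset.sum_congr rfl
    intro X hX
    rw [mem_ext] at hX
    congr 1
    ext s
    simp only [Finset.mem_filter]
    constructor
    · rintro ⟨⟨h1, h2, h3⟩, h4⟩
      exact ⟨h1, h4 ▸ le_sup_right, h3⟩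
    · rintro ⟨h1, h2, h3⟩
      refine ⟨⟨h1, h2.trans hX.2.1, h3⟩, eq_of_le_dim (sup_le hX.1 h2) ?_⟩
      rw [hS s h1 h3, hX.2.2]
  · intro s hs
    have hs := Finset.mem_coe.1 hs
    rw [Finset.mem_filter] at hs
    exact Finset.mem_coe.2 (mem_ext.2 ⟨le_sup_left, sup_le h hs.2.1, hS s hs.1 hs.2.2⟩)

lemma dim_sup_pt {U p : Submodule F V} (hp : finrank F p = 1) (h : ¬ p ≤ U) :
    finrank F ↥(U ⊔ p) = finrank F U + 1 := by
  have h1 := dim_add U p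
  have h2 : finrank F ↥(U ⊓ p) < finrank F p := dim_lt inf_le_right (fun h' => h (h'.trans inf_le_left))
  omega

lemma dim_sup_line {U l N : Submodule F V} (hl : finrank F l = 2) (hN : finrank F N = 1)
    (hNU : N ≤ U) (hNl : N ≤ l) (h : ¬ l ≤ U) :
    finrank F ↥(U ⊔ l) = finrank F U + 1 := by
  have h1 := dim_add U l
  have h2 : finrank F ↥(U ⊓ l) < finrank F l := dim_lt inf_le_right (fun h' => h (h'.trans inf_le_left))
  have h3 := dim_mono (le_inf hNU hNl)
  omega

lemma cnt_vec (W : Submodule F V) :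
    cnt (fun v : V => Submodule.span F {v}) Finset.univ W = Fintype.card F ^ finrank F W := by
  have := Module.card_eq_pow_finrank (K := F) (V := W)
  rw [← this]
  unfold cnt
  rw [Fintype.card_subtype]
  congr 1
  ext v
  simp [Submodule.span_singleton_le_iff_mem]

lemma card_ext {U W : Submodule F V} (h : U ≤ W) {m : ℕ} (hm : finrank F W = finrank F U + m) :
    ((ext U W).card : ℤ) * ((Fintype.card F : ℤ) - 1) = (Fintype.card F : ℤ) ^ m - 1 := by
  have hq : (Fintype.card F : ℤ) ≠ 0 := by
    have := Fintype.card_pos (α := F)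
    positivity
  have := part (fun v : V => Submodule.span F {v}) Finset.univ h (by
    intro v _ hv
    apply dim_sup_pt _ hv
    apply finrank_span_singleton
    rintro rfl
    simp at hv)
  rw [Finset.sum_congr rfl (g := fun _ => (Fintype.card F : ℤ) ^ finrank F U * ((Fintype.card F : ℤ) - 1))] at this
  · rw [Finset.sum_const, cnt_vec, cnt_vec, hm, nsmul_eq_mul] at this
    push_cast at this
    have h2 := pow_ne_zero (finrank F U) hq
    apply mul_left_cancel₀ h2
    rw [pow_add] at this
    linear_combination this
  · intro X hX
    rw [cnt_vec, cnt_vec, (mem_ext.1 hX).2.2]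
    push_cast; ring

lemma card_ext1 {U W : Submodule F V} (h : U ≤ W) (hm : finrank F W = finrank F U + 1) :
    ext U W = {W} := by
  ext X
  rw [mem_ext, Finset.mem_singleton]
  constructor
  · rintro ⟨h1, h2, h3⟩
    exact eq_of_le_dim h2 (by omega)
  · rintro rfl
    exact ⟨h, le_rfl, hm⟩

lemma q_sub_ne : ((Fintype.card F : ℤ) - 1) ≠ 0 := by
  have := Fintype.one_lt_card (α := F)
  omega

lemma card_ext2 {U W : Submodule F V} (h : U ≤ W) (hm : finrank F W = finrank F U + 2) :
    ((ext U W).card : ℤ) = Fintype.card F + 1 := by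
  have := card_ext h hm
  apply mul_right_cancel₀ (q_sub_ne (F := F))
  linear_combination this

lemma card_ext3 {U W : Submodule F V} (h : U ≤ W) (hm : finrank F W = finrank F U + 3) :
    ((ext U W).card : ℤ) = (Fintype.card F : ℤ) ^ 2 + Fintype.card F + 1 := by
  have := card_ext h hm
  apply mul_right_cancel₀ (q_sub_ne (F := F))
  linear_combination this

lemma card_ext4 {U W : Submodule F V} (h : U ≤ W) (hm : finrank F W = finrank F U + 4) :
    ((ext U W).card : ℤ) = (Fintype.card F : ℤ) ^ 3 + (Fintype.card F : ℤ) ^ 2 + Fintype.card F + 1 := by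
  have := card_ext h hm
  apply mul_right_cancel₀ (q_sub_ne (F := F))
  linear_combination this

/-- number of points of K in W -/
noncomputable def kap (K : Finset (Submodule F V)) (W : Submodule F V) : ℕ := cnt id K W

/-- tangents through N -/
noncomputable def tanS (K : Finset (Submodule F V)) (N : Submodule F V) : Finset (Submodule F V) :=
  Finset.univ.filter (fun l => N ≤ l ∧ finrank F l = 2 ∧ kap K l = 1)

/-- secants through N -/
noncomputable def secS (K : Finset (Submodule F V)) (N : Submodule F V) : Finset (Submodule F V) :=
  Finset.univ.filter (fun l => N ≤ l ∧ finrank F l = 2 ∧ kap K l = 2)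

noncomputable def tanN (K : Finset (Submodule F V)) (N W : Submodule F V) : ℕ := cnt id (tanS K N) W
noncomputable def secN (K : Finset (Submodule F V)) (N W : Submodule F V) : ℕ := cnt id (secS K N) W

lemma mem_tanS {K : Finset (Submodule F V)} {N l : Submodule F V} :
    l ∈ tanS K N ↔ N ≤ l ∧ finrank F l = 2 ∧ kap K l = 1 := by simp [tanS]

lemma mem_secS {K : Finset (Submodule F V)} {N l : Submodule F V} :
    l ∈ secS K N ↔ N ≤ l ∧ finrank F l = 2 ∧ kap K l = 2 := by simp [secS]

structure Cap (K : Finset (Submodule F V)) : Prop where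
  pt : ∀ p ∈ K, finrank F p = 1
  line : ∀ l : Submodule F V, finrank F l = 2 → kap K l ≤ 2

variable {K : Finset (Submodule F V)}

lemma kap_part (hK : Cap K) {U W : Submodule F V} (h : U ≤ W) :
    ∑ X ∈ ext U W, ((kap K X : ℤ) - kap K U) = (kap K W : ℤ) - kap K U :=
  part id K h (fun s hs h' => dim_sup_pt (hK.pt s hs) h')

lemma tan_part {N U W : Submodule F V} (hN : finrank F N = 1) (hNU : N ≤ U) (h : U ≤ W) :
    ∑ X ∈ ext U W, ((tanN K N X : ℤ) - tanN K N U) = (tanN K N W : ℤ) - tanN K N U :=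
  part id (tanS K N) h (fun _ hs h' => dim_sup_line (mem_tanS.1 hs).2.1 hN hNU (mem_tanS.1 hs).1 h')

lemma kap_mono {U W : Submodule F V} (h : U ≤ W) : kap K U ≤ kap K W := cnt_mono _ _ h
lemma tan_mono {N U W : Submodule F V} (h : U ≤ W) : tanN K N U ≤ tanN K N W := cnt_mono _ _ h
lemma sec_mono {N U W : Submodule F V} (h : U ≤ W) : secN K N U ≤ secN K N W := cnt_mono _ _ h

lemma tanN_eq {N W : Submodule F V} (hN : finrank F N = 1) :
    tanN K N W = ((ext N W).filter (fun l => kap K l = 1)).card := by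
  unfold tanN cnt
  congr 1
  ext l
  simp only [Finset.mem_filter, mem_tanS, mem_ext, id, hN]
  tauto

lemma secN_eq {N W : Submodule F V} (hN : finrank F N = 1) :
    secN K N W = ((ext N W).filter (fun l => kap K l = 2)).card := by
  unfold secN cnt
  congr 1
  ext l
  simp only [Finset.mem_filter, mem_secS, mem_ext, id, hN]
  tauto

lemma kap_pt {p N : Submodule F V} (hK : Cap K) (hN : finrank F N = 1) :
    kap K N = if N ∈ K then 1 else 0 := by
  unfold kap cnt
  split_ifs with h
  · rw [Finset.card_eq_one]
    refine ⟨N, ?_⟩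
    ext p
    simp only [Finset.mem_filter, Finset.mem_singleton, id]
    constructor
    · rintro ⟨h1, h2⟩
      exact eq_of_le_dim h2 (by rw [hN, hK.pt p h1])
    · rintro rfl; exact ⟨h, le_rfl⟩
  · rw [Finset.card_eq_zero]
    ext p
    simp only [Finset.mem_filter, Finset.notMem_empty, id, iff_false]
    rintro ⟨h1, h2⟩
    have := eq_of_le_dim h2 (by rw [hN, hK.pt p h1])
    exact h (this ▸ h1)

/-- tangents at a point of K -/
lemma tan_at (hK : Cap K) {P W : Submodule F V} (hP : P ∈ K) (h : P ≤ W) :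
    (tanN K P W : ℤ) + kap K W = (ext P W).card + 1 := by
  have hd := hK.pt P hP
  have h1 := kap_part hK h
  have hP1 : kap K P = 1 := by rw [kap_pt (p := P) hK hd, if_pos hP]
  rw [hP1] at h1
  have h2 : ∀ l ∈ ext P W, ((kap K l : ℤ) - (1:ℕ)) = 1 - if kap K l = 1 then 1 else 0 := by
    intro l hl
    rw [mem_ext] at hl
    have a1 := hK.line l (by omega)
    have a2 : kap K P ≤ kap K l := kap_mono hl.1
    split_ifs with h'
    · rw [h']; norm_num
    · have : kap K l = 2 := by omega
      rw [this]; norm_num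
  rw [Finset.sum_congr rfl h2, Finset.sum_sub_distrib, ← Finset.sum_filter] at h1
  simp only [Finset.sum_const, nsmul_eq_mul, mul_one] at h1
  rw [tanN_eq hd]
  push_cast at h1 ⊢
  linarith

/-- decomposition through a point off K -/
lemma kap_eq (hK : Cap K) {N W : Submodule F V} (hd : finrank F N = 1) (hN : N ∉ K) (h : N ≤ W) :
    kap K W = tanN K N W + 2 * secN K N W := by
  have h1 := kap_part hK h
  have hP1 : kap K N = 0 := by rw [kap_pt (p := N) hK hd, if_neg hN]
  rw [hP1] at h1
  have h2 : ∀ l ∈ ext N W, ((kap K l : ℤ) - (0:ℕ)) =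
      (if kap K l = 1 then 1 else 0) + 2 * if kap K l = 2 then 1 else 0 := by
    intro l hl
    rw [mem_ext] at hl
    have a1 := hK.line l (by omega)
    have : kap K l = 0 ∨ kap K l = 1 ∨ kap K l = 2 := by omega
    rcases this with h | h | h <;> rw [h] <;> norm_num
  rw [Finset.sum_congr rfl h2, Finset.sum_add_distrib, ← Finset.mul_sum, ← Finset.sum_filter,
    ← Finset.sum_filter] at h1
  simp only [Finset.sum_const, nsmul_eq_mul, mul_one] at h1
  rw [tanN_eq hd, secN_eq hd]
  push_cast at h1
  omega

end Geo
end CapAux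

open Module

namespace CapAux
open Classical

section Geo
variable {F V : Type*} [Field F] [Fintype F] [AddCommGroup V] [Module F V] [Fintype V]
  [Fintype (Submodule F V)]
variable {K : Finset (Submodule F V)}

lemma pt_sup_dim {p p' : Submodule F V} (hp : finrank F p = 1) (hp' : finrank F p' = 1) (h : p ≠ p') :
    finrank F ↥(p ⊔ p') = 2 := by
  rw [dim_sup_pt hp' (fun h' => h (eq_of_le_dim h' (by omega)).symm), hp]

lemma no_three (hK : Cap K) {a b c : Submodule F V} (ha : a ∈ K) (hb : b ∈ K) (hc : c ∈ K)
    (hab : a ≠ b) (hac : a ≠ c) (hbc : b ≠ c) (h : c ≤ a ⊔ b) : False := by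
  have h1 := hK.line _ (pt_sup_dim (hK.pt a ha) (hK.pt b hb) hab)
  have h2 : ({a, b, c} : Finset (Submodule F V)) ⊆ K.filter (fun s => id s ≤ a ⊔ b) := by
    intro x hx
    simp only [Finset.mem_insert, Finset.mem_singleton] at hx
    rw [Finset.mem_filter]
    rcases hx with rfl | rfl | rfl
    · exact ⟨ha, le_sup_left⟩
    · exact ⟨hb, le_sup_right⟩
    · exact ⟨hc, h⟩
  have h3 := Finset.card_le_card h2
  rw [Finset.card_eq_three.2 ⟨a, b, c, hab, hac, hbc, rfl⟩] at h3
  unfold kap cnt at h1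
  omega

lemma pt_span {p : Submodule F V} (hp : finrank F p = 1) : ∃ v : V, v ≠ 0 ∧ p = Submodule.span F {v} := by
  obtain ⟨v, hv, hv'⟩ := finrank_eq_one_iff_of_nonzero' (K := F) (V := p) |> fun _ =>
    finrank_eq_one_iff'.1 hp
  refine ⟨v, fun h => hv (Subtype.ext h), le_antisymm ?_ ?_⟩
  · intro w hw
    obtain ⟨c, hc⟩ := hv' ⟨w, hw⟩
    rw [Submodule.mem_span_singleton]
    exact ⟨c, congrArg Subtype.val hc⟩
  · rw [Submodule.span_singleton_le_iff_mem]; exact v.2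

lemma span_smul {c : F} (hc : c ≠ 0) (v : V) : Submodule.span F {c • v} = Submodule.span F {v} :=
  Submodule.span_singleton_smul_eq (IsUnit.mk0 c hc) v

set_option maxHeartbeats 2000000 in
theorem C1 [CharP F 2] (hK : Cap K) {N W : Submodule F V} (hd : finrank F N = 1) (hN : N ∉ K)
    (h : N ≤ W) (hW : finrank F W = 3) (hs : secN K N W ≠ 0) :
    kap K W + tanN K N W ≤ Fintype.card F + 2 := by
  obtain ⟨u, hu⟩ := Finset.card_ne_zero.1 hs
  rw [Finset.mem_filter, mem_secS] at hu
  obtain ⟨⟨hNu, hu2, hku⟩, huW⟩ := hu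
  obtain ⟨P, P', hPP, hku'⟩ := Finset.card_eq_two.1 hku
  have hP : P ∈ K.filter (fun s => id s ≤ u) := by rw [hku']; simp
  have hP' : P' ∈ K.filter (fun s => id s ≤ u) := by rw [hku']; simp
  rw [Finset.mem_filter] at hP hP'
  simp only [id] at hP hP' huW
  obtain ⟨hP, hPu⟩ := hP
  obtain ⟨hP', hPu'⟩ := hP'
  have huniq : ∀ R ∈ K, R ≤ u → R = P ∨ R = P' := by
    intro R hR hRu
    have : R ∈ K.filter (fun s => id s ≤ u) := Finset.mem_filter.2 ⟨hR, hRu⟩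
    rw [hku'] at this; simpa using this
  have hPPu : P ⊔ P' = u := by
    apply eq_of_le_dim (sup_le hPu hPu')
    rw [pt_sup_dim (hK.pt P hP) (hK.pt P' hP') hPP, hu2]
  obtain ⟨p0, hp0, rfl⟩ := pt_span (hK.pt P hP)
  obtain ⟨p0', hp0', rfl⟩ := pt_span (hK.pt P' hP')
  obtain ⟨n0, hn0, rfl⟩ := pt_span hd
  have hn : n0 ∈ Submodule.span F {p0} ⊔ Submodule.span F {p0'} := by
    rw [hPPu]; exact hNu (Submodule.mem_span_singleton_self _)
  obtain ⟨x, hx, y, hy, hxy⟩ := Submodule.mem_sup.1 hn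
  obtain ⟨α, rfl⟩ := Submodule.mem_span_singleton.1 hx
  obtain ⟨β, rfl⟩ := Submodule.mem_span_singleton.1 hy
  have hα : α ≠ 0 := by
    rintro rfl
    apply hN
    rw [zero_smul, zero_add] at hxy
    have hβ : β ≠ 0 := by rintro rfl; rw [zero_smul] at hxy; exact hn0 hxy.symm
    rw [← hxy, span_smul hβ]; exact hP'
  have hβ : β ≠ 0 := by
    rintro rfl
    apply hN
    rw [zero_smul, add_zero] at hxy
    rw [← hxy, span_smul hα]; exact hP
  rw [← span_smul hα p0] at hP hPu hPP hPPu huniq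
  rw [← span_smul hβ p0'] at hP' hPu' hPP hPPu huniq
  have hp := smul_ne_zero hα hp0
  have hp' := smul_ne_zero hβ hp0'
  generalize α • p0 = p at *
  generalize β • p0' = p' at *
  obtain ⟨r, hrW, hru⟩ : ∃ r ∈ W, r ∉ u := by
    by_contra hcon
    push Not at hcon
    have := dim_mono (F := F) (U := W) (W := u) hcon
    omega
  have hr0 : r ≠ 0 := by rintro rfl; exact hru u.zero_mem
  have hpu : p ∈ u := hPu (Submodule.mem_span_singleton_self _)
  have hpu' : p' ∈ u := hPu' (Submodule.mem_span_singleton_self _)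
  have hind : ∀ a b c : F, a • p + b • p' + c • r = 0 → a = 0 ∧ b = 0 ∧ c = 0 := by
    intro a b c habc
    have hc : c = 0 := by
      by_contra hc
      apply hru
      have : r = c⁻¹ • (- (a • p + b • p')) := by
        rw [eq_inv_smul_iff₀ hc]; exact eq_neg_of_add_eq_zero_right habc
      rw [this]
      exact u.smul_mem _ (u.neg_mem (u.add_mem (u.smul_mem _ hpu) (u.smul_mem _ hpu')))
    subst hc
    rw [zero_smul, add_zero] at habc
    have ha : a = 0 := by
      by_contra ha
      apply hPP
      apply eq_of_le_dim
      · rw [Submodule.span_singleton_le_iff_mem, Submodule.mem_span_singleton]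
        refine ⟨-(a⁻¹ * b), ?_⟩
        rw [neg_smul, mul_smul, neg_eq_iff_eq_neg, inv_smul_eq_iff₀ ha, smul_neg]
        exact eq_neg_of_add_eq_zero_right habc
      · rw [finrank_span_singleton hp, finrank_span_singleton hp']
    subst ha
    rw [zero_smul, zero_add] at habc
    exact ⟨rfl, (smul_eq_zero.1 habc).resolve_right hp', rfl⟩
  have hspan : ∀ w ∈ W, ∃ a b c : F, w = a • p + b • p' + c • r := by
    intro w hw
    have : u ⊔ Submodule.span F {r} = W := by
      apply eq_of_le_dim (sup_le huW ((Submodule.span_singleton_le_iff_mem _ _).2 hrW))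
      rw [dim_sup_pt (finrank_span_singleton hr0)]
      · omega
      · rw [Submodule.span_singleton_le_iff_mem]; exact hru
    rw [← this, ← hPPu] at hw
    obtain ⟨x, hx, y, hy, rfl⟩ := Submodule.mem_sup.1 hw
    obtain ⟨c, rfl⟩ := Submodule.mem_span_singleton.1 hy
    obtain ⟨x', hx', y', hy', rfl⟩ := Submodule.mem_sup.1 hx
    obtain ⟨a, rfl⟩ := Submodule.mem_span_singleton.1 hx'
    obtain ⟨b, rfl⟩ := Submodule.mem_span_singleton.1 hy'
    exact ⟨a, b, c, rfl⟩
  set w : F × F → V := fun i => i.1 • p + i.2 • p' + r with hw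
  set I : Finset (F × F) := Finset.univ.filter (fun i => Submodule.span F {w i} ∈ K) with hI
  have memI : ∀ i, i ∈ I ↔ Submodule.span F {w i} ∈ K := by intro i; simp [hI]
  have hne : ∀ i j, i ≠ j → Submodule.span F {w i} ≠ Submodule.span F {w j} := by
    intro i j hij h
    have : w i ∈ Submodule.span F {w j} := h ▸ Submodule.mem_span_singleton_self _
    obtain ⟨c, hc⟩ := Submodule.mem_span_singleton.1 this
    have h2 := hind (c * j.1 - i.1) (c * j.2 - i.2) (c - 1) (by
      simp only [hw] at hc
      linear_combination (norm := module) hc)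
    have hc1 : c = 1 := by linear_combination h2.2.2
    subst hc1
    apply hij
    ext
    · linear_combination -h2.1
    · linear_combination -h2.2.1
  have hneP : ∀ i, Submodule.span F {w i} ≠ Submodule.span F {p} := by
    intro i h
    have : w i ∈ Submodule.span F {p} := h ▸ Submodule.mem_span_singleton_self _
    obtain ⟨c, hc⟩ := Submodule.mem_span_singleton.1 this
    have h2 := hind (c - i.1) (- i.2) (- 1) (by
      simp only [hw] at hc
      linear_combination (norm := module) hc)
    simpa using h2.2.2
  have hneP' : ∀ i, Submodule.span F {w i} ≠ Submodule.span F {p'} := by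
    intro i h
    have : w i ∈ Submodule.span F {p'} := h ▸ Submodule.mem_span_singleton_self _
    obtain ⟨c, hc⟩ := Submodule.mem_span_singleton.1 this
    have h2 := hind (- i.1) (c - i.2) (- 1) (by
      simp only [hw] at hc
      linear_combination (norm := module) hc)
    simpa using h2.2.2
  have hin : ∀ (x y z : V) (a b : F), z = a • x + b • y →
      Submodule.span F {z} ≤ Submodule.span F {x} ⊔ Submodule.span F {y} := by
    rintro x y z a b rfl
    rw [Submodule.span_singleton_le_iff_mem]
    exact Submodule.add_mem _
      (Submodule.mem_sup_left (Submodule.smul_mem _ _ (Submodule.mem_span_singleton_self _)))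
      (Submodule.mem_sup_right (Submodule.smul_mem _ _ (Submodule.mem_span_singleton_self _)))
  have hal := AL I ?_ ?_ ?_
  · -- conclusion
    have hk := kap_eq hK hd hN h
    suffices hX : tanN K (Submodule.span F {n0}) W + secN K (Submodule.span F {n0}) W ≤
        1 + (I.image (fun p => p.1 + p.2)).card by omega
    have h1 : tanN K (Submodule.span F {n0}) W + secN K (Submodule.span F {n0}) W =
        ((ext (Submodule.span F {n0}) W).filter (fun l => kap K l = 1 ∨ kap K l = 2)).card := by
      rw [tanN_eq hd, secN_eq hd, Finset.filter_or, Finset.card_union_of_disjoint]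
      rw [Finset.disjoint_left]
      intro s h1 h2
      simp only [Finset.mem_filter] at h1 h2
      omega
    rw [h1]
    have h2 : (ext (Submodule.span F {n0}) W).filter (fun l => kap K l = 1 ∨ kap K l = 2) ⊆
        insert u ((I.image (fun p => p.1 + p.2)).image
          (fun y => Submodule.span F {n0} ⊔ Submodule.span F {y • p' + r})) := by
      intro l hl
      rw [Finset.mem_filter, mem_ext] at hl
      obtain ⟨⟨hNl, hlW, hl2⟩, hkl⟩ := hl
      rw [Finset.mem_insert, or_iff_not_imp_left]
      intro hlu
      have : kap K l ≠ 0 := by omega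
      obtain ⟨R, hR⟩ := Finset.card_ne_zero.1 this
      rw [Finset.mem_filter] at hR
      obtain ⟨hR, hRl⟩ := hR
      simp only [id] at hRl
      have hlR : Submodule.span F {n0} ⊔ R = l := by
        apply eq_of_le_dim (sup_le hNl hRl)
        rw [pt_sup_dim hd (hK.pt R hR) (fun h => hN (h ▸ hR))]; omega
      have hRu : ¬ R ≤ u := by
        intro hRu
        apply hlu
        rw [← hlR]
        apply eq_of_le_dim (sup_le hNu hRu)
        rw [hlR]; omega
      obtain ⟨v, hv, rfl⟩ := pt_span (hK.pt R hR)
      obtain ⟨a, b, c, hvabc⟩ := hspan v (hlW (hRl (Submodule.mem_span_singleton_self _)))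
      have hc : c ≠ 0 := by
        rintro rfl
        apply hRu
        rw [Submodule.span_singleton_le_iff_mem, hvabc, zero_smul, add_zero]
        exact u.add_mem (u.smul_mem _ hpu) (u.smul_mem _ hpu')
      have hvw : v = c • w (c⁻¹ * a, c⁻¹ * b) := by
        rw [hvabc]; simp only [hw, smul_add, smul_smul]
        rw [mul_inv_cancel_left₀ hc, mul_inv_cancel_left₀ hc]
      generalize (c⁻¹ * a, c⁻¹ * b) = i at hvw
      rw [hvw, span_smul hc] at hR hlR hRl
      refine Finset.mem_image.2 ⟨i.1 + i.2, Finset.mem_image.2 ⟨i, (memI i).2 hR, rfl⟩, ?_⟩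
      rw [← hlR]
      have h22 : (2 : F) = 0 := CharTwo.two_eq_zero
      apply le_antisymm
      · refine sup_le le_sup_left ?_
        apply hin _ _ _ (-i.1) 1
        simp only [hw, ← hxy]
        linear_combination (norm := module) (i.1 * h22) • p'
      · refine sup_le le_sup_left ?_
        apply hin _ _ _ (i.1) 1
        simp only [hw, ← hxy]
        linear_combination (norm := module) (-i.1 * h22) • p'
    refine (Finset.card_le_card h2).trans ((Finset.card_insert_le _ _).trans ?_)
    have := Finset.card_image_le (s := I.image (fun p => p.1 + p.2))
      (f := fun y => Submodule.span F {n0} ⊔ Submodule.span F {y • p' + r})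
    omega
  · intro i hi j hj hij h1
    rw [memI] at hi hj
    refine no_three hK hP' hi hj (hneP' i).symm (hneP' j).symm (hne i j hij) ?_
    apply hin _ _ _ (j.2 - i.2) 1
    simp only [hw, h1]; module
  · intro i hi j hj hij h1
    rw [memI] at hi hj
    refine no_three hK hP hi hj (hneP i).symm (hneP j).symm (hne i j hij) ?_
    apply hin _ _ _ (j.1 - i.1) 1
    simp only [hw, h1]; module
  · intro i hi j hj l hl hij hil hjl heq
    rw [memI] at hi hj hl
    have hne1 : i.1 + j.1 ≠ 0 := by
      intro h0
      have h1 : i.1 = j.1 := CharTwo.add_eq_zero.1 h0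
      refine no_three hK hP' hi hj (hneP' i).symm (hneP' j).symm (hne i j hij) ?_
      apply hin _ _ _ (j.2 - i.2) 1
      simp only [hw, h1]; module
    refine no_three hK hi hj hl (hne i j hij) (hne i l hil) (hne j l hjl) ?_
    set lam := (i.1 + l.1) * (i.1 + j.1)⁻¹ with hlam
    have e1 : lam * (i.1 + j.1) = i.1 + l.1 := by rw [hlam]; field_simp
    have e2 : lam * (i.2 + j.2) = i.2 + l.2 := by
      apply mul_left_cancel₀ hne1
      linear_combination (i.2 + j.2) * e1 - heq
    have h22 : (2 : F) = 0 := CharTwo.two_eq_zero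
    have e3 : l.1 = (1 + lam) * i.1 + lam * j.1 := by linear_combination -e1 - i.1 * h22 
    have e4 : l.2 = (1 + lam) * i.2 + lam * j.2 := by linear_combination -e2 - i.2 * h22
    apply hin _ _ _ (1 + lam) lam
    simp only [hw]
    rw [e3, e4]
    have : ((1 + lam) + lam) = 1 := by linear_combination lam * h22
    linear_combination (norm := module) (-this) • r
end Geo
end CapAux

open Module

namespace CapAux
open Classical

section Geo
variable {F V : Type*} [Field F] [Fintype F] [AddCommGroup V] [Module F V] [Fintype V]
  [Fintype (Submodule F V)]
variable {K : Finset (Submodule F V)}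

/-- The standing situation. -/
structure Setup (K : Finset (Submodule F V)) (q t : ℤ) : Prop where
  cap : Cap K
  char : CharP F 2
  q_eq : (Fintype.card F : ℤ) = q
  q_ge : 2048 ≤ q
  dimV : finrank F (⊤ : Submodule F V) = 5
  compl : ∀ N : Submodule F V, finrank F N = 1 → N ∉ K → ∃ l, l ∈ secS K N
  t_eq : t + kap K ⊤ = q ^ 3 + q ^ 2 + q + 2
  t_le : t ≤ 3 * q ^ 2 - 135 * q
  t_pos : 1 ≤ t

/-- deficiency of a plane seen from N -/
noncomputable def gg (q : ℤ) (K : Finset (Submodule F V)) (N W : Submodule F V) : ℤ :=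
  q + 2 - kap K W - tanN K N W

/-- deficiency of a solid seen from N -/
noncomputable def DD (q : ℤ) (K : Finset (Submodule F V)) (N W : Submodule F V) : ℤ :=
  q ^ 2 + q + 2 - kap K W - tanN K N W

lemma tan_line {N u : Submodule F V} (hd : finrank F N = 1) (hu : finrank F u = 2) (h : N ≤ u) :
    tanN K N u = if kap K u = 1 then 1 else 0 := by
  rw [tanN_eq hd, card_ext1 h (by omega), Finset.filter_singleton]
  split_ifs <;> simp

lemma sec_line {N u : Submodule F V} (hd : finrank F N = 1) (hu : finrank F u = 2) (h : N ≤ u) :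
    secN K N u = if kap K u = 2 then 1 else 0 := by
  rw [secN_eq hd, card_ext1 h (by omega), Finset.filter_singleton]
  split_ifs <;> simp

namespace Setup
variable {q t : ℤ} (S : Setup K q t)
include S

lemma ext2 {U W : Submodule F V} (h : U ≤ W) (hm : finrank F W = finrank F U + 2) :
    ((ext U W).card : ℤ) = q + 1 := by rw [card_ext2 h hm, S.q_eq]

lemma ext3 {U W : Submodule F V} (h : U ≤ W) (hm : finrank F W = finrank F U + 3) :
    ((ext U W).card : ℤ) = q ^ 2 + q + 1 := by rw [card_ext3 h hm, S.q_eq]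

lemma ext4 {U W : Submodule F V} (h : U ≤ W) (hm : finrank F W = finrank F U + 4) :
    ((ext U W).card : ℤ) = q ^ 3 + q ^ 2 + q + 1 := by rw [card_ext4 h hm, S.q_eq]

lemma pt {P : Submodule F V} (hP : P ∈ K) : finrank F P = 1 := S.cap.pt P hP

lemma kapP {P : Submodule F V} (hP : P ∈ K) : kap K P = 1 := by
  rw [kap_pt (p := P) S.cap (S.pt hP), if_pos hP]

lemma kapN {N : Submodule F V} (hd : finrank F N = 1) (hN : N ∉ K) : kap K N = 0 := by
  rw [kap_pt (p := N) S.cap hd, if_neg hN]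

lemma tan_plane {P W : Submodule F V} (hP : P ∈ K) (h : P ≤ W) (hW : finrank F W = 3) :
    (tanN K P W : ℤ) = q + 2 - kap K W := by
  have := tan_at S.cap hP h
  rw [S.ext2 h (by rw [S.pt hP, hW])] at this
  linarith

lemma tan_solid {P W : Submodule F V} (hP : P ∈ K) (h : P ≤ W) (hW : finrank F W = 4) :
    (tanN K P W : ℤ) = q ^ 2 + q + 2 - kap K W := by
  have := tan_at S.cap hP h
  rw [S.ext3 h (by rw [S.pt hP, hW])] at this
  linarith

lemma tan_top {P : Submodule F V} (hP : P ∈ K) : (tanN K P ⊤ : ℤ) = t := by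
  have := tan_at S.cap hP le_top
  rw [S.ext4 le_top (by rw [S.pt hP, S.dimV])] at this
  linarith [S.t_eq]

lemma line_sum {N u : Submodule F V} (hd : finrank F N = 1) (hNu : N ≤ u)
    (hu : finrank F u = 2) (hk : kap K u ≠ 0) : (kap K u : ℤ) + tanN K N u = 2 := by
  rw [tan_line hd hu hNu]
  have := S.cap.line u hu
  split_ifs with h
  · rw [h]; norm_num
  · have : kap K u = 2 := by omega
    rw [this]; norm_num

lemma line_sum0 {N u : Submodule F V} (hd : finrank F N = 1) (hNu : N ≤ u)
    (hu : finrank F u = 2) (hk : kap K u = 0) : (kap K u : ℤ) + tanN K N u = 0 := by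
  rw [tan_line hd hu hNu, hk]
  norm_num

lemma gsum_gen {N u W : Submodule F V} (hd : finrank F N = 1) (hNu : N ≤ u) (huW : u ≤ W) :
    ∑ X ∈ ext u W, gg q K N X = ((ext u W).card : ℤ) * (q + 2 - (kap K u + tanN K N u))
      - (kap K W + tanN K N W) + (kap K u + tanN K N u) := by
  have h1 := kap_part S.cap huW
  have h2 := tan_part (K := K) hd hNu huW
  have : ∑ X ∈ ext u W, gg q K N X = ∑ X ∈ ext u W, ((q + 2 - (kap K u + tanN K N u) : ℤ)
    - ((kap K X : ℤ) - kap K u) - ((tanN K N X : ℤ) - tanN K N u)) := by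
    apply Finset.sum_congr rfl
    intro X _
    unfold gg; ring
  rw [this, Finset.sum_sub_distrib, Finset.sum_sub_distrib, h1, h2, Finset.sum_const, nsmul_eq_mul]
  ring

lemma gsum_solid {N u W : Submodule F V} (hd : finrank F N = 1) (hNu : N ≤ u)
    (hu : finrank F u = 2) (hk : kap K u ≠ 0) (huW : u ≤ W) (hW : finrank F W = 4) :
    ∑ X ∈ ext u W, gg q K N X = DD q K N W := by
  rw [S.gsum_gen hd hNu huW, S.line_sum hd hNu hu hk, S.ext2 huW (by omega)]
  unfold DD; ring

lemma gsum_zero {N u W : Submodule F V} (hd : finrank F N = 1) (hNu : N ≤ u)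
    (hu : finrank F u = 2) (hk : kap K u = 0) (huW : u ≤ W) (hW : finrank F W = 4) :
    ∑ X ∈ ext u W, gg q K N X = 2 * q + DD q K N W := by
  rw [S.gsum_gen hd hNu huW, S.line_sum0 hd hNu hu hk, S.ext2 huW (by omega)]
  unfold DD; ring

lemma gsum_top {N u : Submodule F V} (hd : finrank F N = 1) (hNu : N ≤ u)
    (hu : finrank F u = 2) (hk : kap K u ≠ 0) :
    ∑ X ∈ ext u ⊤, gg q K N X = t - tanN K N ⊤ := by
  rw [S.gsum_gen hd hNu le_top, S.line_sum hd hNu hu hk, S.ext3 le_top (by rw [S.dimV, hu])]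
  linarith [S.t_eq]

lemma g_nonneg {N W : Submodule F V} (hd : finrank F N = 1) (hN : N ∉ K) (h : N ≤ W)
    (hW : finrank F W = 3) (hs : secN K N W ≠ 0) : 0 ≤ gg q K N W := by
  have := S.char
  have h1 := C1 S.cap hd hN h hW hs
  have h2 := S.q_eq
  unfold gg
  omega

lemma exists_sec {N W : Submodule F V} (hs : secN K N W ≠ 0) :
    ∃ u, N ≤ u ∧ finrank F u = 2 ∧ kap K u = 2 ∧ u ≤ W := by
  obtain ⟨u, hu⟩ := Finset.card_ne_zero.1 hs
  rw [Finset.mem_filter, mem_secS] at hu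
  exact ⟨u, hu.1.1, hu.1.2.1, hu.1.2.2, hu.2⟩

lemma sec_ne {N u W : Submodule F V} (hNu : N ≤ u) (hu : finrank F u = 2) (hk : kap K u = 2)
    (huW : u ≤ W) : secN K N W ≠ 0 :=
  Finset.card_ne_zero.2 ⟨u, Finset.mem_filter.2 ⟨mem_secS.2 ⟨hNu, hu, hk⟩, huW⟩⟩

lemma g_le_D {N W X : Submodule F V} (hd : finrank F N = 1) (hN : N ∉ K)
    (hW : finrank F W = 4) (hX : finrank F X = 3) (hXW : X ≤ W) (hs : secN K N X ≠ 0) :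
    gg q K N X ≤ DD q K N W := by
  obtain ⟨u, hNu, hu, hk, huX⟩ := S.exists_sec hs
  rw [← S.gsum_solid hd hNu hu (by omega) (huX.trans hXW) hW]
  apply Finset.single_le_sum (f := fun X => gg q K N X)
  · intro Y hY
    rw [mem_ext] at hY
    exact S.g_nonneg hd hN (hNu.trans hY.1) (by omega) (S.sec_ne hNu hu hk hY.1)
  · exact mem_ext.2 ⟨huX, hXW, by omega⟩

lemma D_nonneg {N W : Submodule F V} (hd : finrank F N = 1) (hN : N ∉ K)
    (hW : finrank F W = 4) (hs : secN K N W ≠ 0) :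
    0 ≤ DD q K N W := by
  obtain ⟨u, hNu, hu, hk, huX⟩ := S.exists_sec hs
  rw [← S.gsum_solid hd hNu hu (by omega) huX hW]
  apply Finset.sum_nonneg
  intro Y hY
  rw [mem_ext] at hY
  exact S.g_nonneg hd hN (hNu.trans hY.1) (by omega) (S.sec_ne hNu hu hk hY.1)

lemma tan_le {N : Submodule F V} (hd : finrank F N = 1) (hN : N ∉ K) :
    (tanN K N ⊤ : ℤ) ≤ t := by
  obtain ⟨u, hu'⟩ := S.compl N hd hN
  obtain ⟨hNu, hu, hk⟩ := mem_secS.1 hu'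
  have := S.gsum_top hd hNu hu (by omega)
  have h0 : 0 ≤ ∑ X ∈ ext u ⊤, gg q K N X := by
    apply Finset.sum_nonneg
    intro Y hY
    rw [mem_ext] at hY
    exact S.g_nonneg hd hN (hNu.trans hY.1) (by omega) (S.sec_ne hNu hu hk hY.1)
  linarith

lemma wsum {P z : Submodule F V} (hP : P ∈ K) (hz : z ∈ tanS K P) :
    ∑ X ∈ ext z ⊤, (q + 1 - kap K X) = t - 1 := by
  obtain ⟨hPz, hz2, hkz⟩ := mem_tanS.1 hz
  have h1 := tan_part (K := K) (S.pt hP) hPz (le_top : z ≤ ⊤)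
  rw [tan_line (S.pt hP) hz2 hPz, if_pos hkz, S.tan_top hP] at h1
  rw [Nat.cast_one] at h1
  rw [← h1]
  apply Finset.sum_congr rfl
  intro X hX
  rw [mem_ext] at hX
  rw [S.tan_plane hP (hPz.trans hX.1) (by omega)]
  ring

lemma w_nonneg {P z X : Submodule F V} (hP : P ∈ K) (hz : z ∈ tanS K P) (hX : X ∈ ext z ⊤) :
    0 ≤ q + 1 - kap K X := by
  obtain ⟨hPz, hz2, hkz⟩ := mem_tanS.1 hz
  rw [mem_ext] at hX
  have h1 := S.tan_plane hP (hPz.trans hX.1) (by omega)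
  have h2 : tanN K P z ≤ tanN K P X := tan_mono hX.1
  rw [tan_line (S.pt hP) hz2 hPz, if_pos hkz] at h2
  omega

lemma w_le {P z X : Submodule F V} (hP : P ∈ K) (hz : z ∈ tanS K P) (hX : X ∈ ext z ⊤) :
    q + 1 - kap K X ≤ q := by
  obtain ⟨hPz, hz2, hkz⟩ := mem_tanS.1 hz
  rw [mem_ext] at hX
  have h2 : kap K z ≤ kap K X := kap_mono hX.1
  omega

omit S in
lemma uniq_one {l P R : Submodule F V} (hk : kap K l = 1) (hP : P ∈ K) (hR : R ∈ K) (hPl : P ≤ l)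
    (hRl : R ≤ l) : P = R := by
  have := Finset.card_le_one.1 (le_of_eq hk)
  exact this P (Finset.mem_filter.2 ⟨hP, hPl⟩) R (Finset.mem_filter.2 ⟨hR, hRl⟩)

omit S in
lemma exists_pt {W : Submodule F V} (hk : kap K W ≠ 0) : ∃ P ∈ K, P ≤ W := by
  obtain ⟨u, hu⟩ := Finset.card_ne_zero.1 hk
  rw [Finset.mem_filter] at hu
  exact ⟨u, hu.1, hu.2⟩

omit S in
lemma line_eq {l l' N P : Submodule F V} (hl : finrank F l = 2) (hl' : finrank F l' = 2)
    (hN : finrank F N = 1) (hP : finrank F P = 1) (hNP : N ≠ P) (h1 : N ≤ l) (h2 : P ≤ l) 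
    (h3 : N ≤ l') (h4 : P ≤ l') : l = l' := by
  have e1 : N ⊔ P = l := eq_of_le_dim (sup_le h1 h2) (by rw [pt_sup_dim hN hP hNP, hl])
  have e2 : N ⊔ P = l' := eq_of_le_dim (sup_le h3 h4) (by rw [pt_sup_dim hN hP hNP, hl'])
  rw [← e1, e2]

omit S in
lemma line_inf {l l' N : Submodule F V} (hl : finrank F l = 2) (hl' : finrank F l' = 2)
    (hN : finrank F N = 1) (h1 : N ≤ l) (h3 : N ≤ l') (hne : l ≠ l') : l ⊓ l' = N := by
  symm
  apply eq_of_le_dim (le_inf h1 h3)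
  by_contra hc
  have a : l ⊓ l' = l := eq_of_le_dim inf_le_left (by omega)
  have b : l ⊓ l' = l' := eq_of_le_dim inf_le_right (by omega)
  exact hne (a.symm.trans b)

set_option maxHeartbeats 1000000 in
lemma C4 {P z : Submodule F V} (hP : P ∈ K) (hz : z ∈ tanS K P) :
    ∑ M ∈ (ext ⊥ z).erase P, (t - tanN K M ⊤) =
      ∑ X ∈ ext z ⊤, (q + 1 - kap K X) * (q + 2 - kap K X) - (q ^ 3 + q ^ 2 + q) := by
  obtain ⟨hPz, hz2, hkz⟩ := mem_tanS.1 hz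
  have hbot : finrank F (⊥ : Submodule F V) = 0 := finrank_bot F V
  set TT : Finset (Submodule F V) := Finset.univ.filter (fun l => finrank F l = 2 ∧ kap K l = 1 ∧
    ¬ P ≤ l ∧ finrank F ↥(l ⊓ z) = 1) with hTT
  have c1 : (TT.card : ℤ) = ∑ M ∈ (ext ⊥ z).erase P, ((tanN K M ⊤ : ℤ) - 1) := by
    rw [Finset.card_eq_sum_card_fiberwise (f := fun l => l ⊓ z) (t := (ext ⊥ z).erase P)]
    · rw [Nat.cast_sum]
      apply Finset.sum_congr rfl
      intro M hM
      rw [Finset.mem_erase, mem_ext, hbot] at hM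
      obtain ⟨hMP, -, hMz, hM1⟩ := hM
      have e : TT.filter (fun l => l ⊓ z = M) = (tanS K M).erase z := by
        ext l
        simp only [hTT, Finset.mem_filter, Finset.mem_univ, true_and, Finset.mem_erase, mem_tanS]
        constructor
        · rintro ⟨⟨h1, h2, h3, h4⟩, h5⟩
          refine ⟨?_, h5 ▸ inf_le_left, h1, h2⟩
          rintro rfl; exact h3 hPz
        · rintro ⟨h1, h2, h3, h4⟩
          have := line_inf h3 hz2 hM1 h2 hMz h1
          refine ⟨⟨h3, h4, ?_, by rw [this, hM1]⟩, this⟩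
          intro hPl
          exact h1 (line_eq h3 hz2 hM1 (S.pt hP) hMP h2 hPl hMz hPz)
      rw [e, Finset.card_erase_of_mem (mem_tanS.2 ⟨hMz, hz2, hkz⟩)]
      have e2 : (tanS K M).card = tanN K M ⊤ := by
        unfold tanN cnt; congr 1; ext; simp
      have e3 : 0 < (tanS K M).card := Finset.card_pos.2 ⟨z, mem_tanS.2 ⟨hMz, hz2, hkz⟩⟩
      rw [e2] at e3 ⊢
      omega
    · intro l hl
      have hl := Finset.mem_coe.1 hl
      simp only [hTT, Finset.mem_filter, Finset.mem_univ, true_and] at hl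
      refine Finset.mem_coe.2 (Finset.mem_erase.2 ⟨?_, mem_ext.2 ⟨bot_le, inf_le_right, by rw [hl.2.2.2, hbot]⟩⟩)
      intro h
      exact hl.2.2.1 (h ▸ inf_le_left)
  have c2 : (TT.card : ℤ) = ∑ X ∈ ext z ⊤, ((kap K X : ℤ) - 1) * (q + 2 - kap K X) := by
    rw [Finset.card_eq_sum_card_fiberwise (f := fun l => z ⊔ l) (t := ext z ⊤)]
    · rw [Nat.cast_sum]
      apply Finset.sum_congr rfl
      intro X hX
      rw [mem_ext] at hX
      obtain ⟨hzX, -, hX3⟩ := hX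
      rw [hz2] at hX3
      have hPX := hPz.trans hzX
      set KX := (K.filter (fun s => id s ≤ X)).erase P with hKX
      have hKXc : (KX.card : ℤ) = kap K X - 1 := by
        have h1 : P ∈ K.filter (fun s => id s ≤ X) := Finset.mem_filter.2 ⟨hP, hPX⟩
        rw [hKX, Finset.card_erase_of_mem h1]
        have : 0 < (K.filter (fun s => id s ≤ X)).card := Finset.card_pos.2 ⟨P, h1⟩
        unfold kap cnt
        omega
      have e : TT.filter (fun l => z ⊔ l = X) = KX.biUnion (fun R => (tanS K R).filter (fun l => id l ≤ X)) := by
        ext l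
        simp only [hTT, hKX, Finset.mem_filter, Finset.mem_univ, true_and, Finset.mem_biUnion, Finset.mem_erase,
          mem_tanS, id]
        constructor
        · rintro ⟨⟨h1, h2, h3, h4⟩, h5⟩
          obtain ⟨R, hR, hRl⟩ := exists_pt (K := K) (W := l) (by omega)
          have hlX : l ≤ X := h5 ▸ le_sup_right
          refine ⟨R, ⟨?_, hR, hRl.trans hlX⟩, ⟨hRl, h1, h2⟩, hlX⟩
          rintro rfl; exact h3 hRl
        · rintro ⟨R, ⟨h1, h2, h3⟩, ⟨h4, h5, h6⟩, h7⟩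
          have hPl : ¬ P ≤ l := fun h => h1 (uniq_one h6 h2 hP h4 h)
          have hlz : ¬ l ≤ z := fun h => hPl (by rwa [eq_of_le_dim h (by omega)])
          have d1 := dim_add z l
          have d2 : finrank F ↥(z ⊔ l) ≤ finrank F X := dim_mono (sup_le hzX h7)
          have d3 : finrank F ↥(z ⊓ l) < finrank F l := dim_lt inf_le_right (fun h => hlz (h.trans inf_le_left))
          refine ⟨⟨h5, h6, hPl, ?_⟩, ?_⟩
          · rw [inf_comm]; omega
          · exact eq_of_le_dim (sup_le hzX h7) (by omega)
      rw [e, Finset.card_biUnion, ← hKXc]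
      · rw [Nat.cast_sum, Finset.sum_congr rfl (g := fun _ => (q + 2 - kap K X : ℤ)), Finset.sum_const, nsmul_eq_mul]
        intro R hR
        simp only [hKX, Finset.mem_filter, Finset.mem_erase, id] at hR
        exact S.tan_plane hR.2.1 hR.2.2 hX3
      · intro R hR R' hR' hne
        refine Finset.disjoint_left.2 ?_
        intro l hl hl'
        have hR := Finset.mem_coe.1 hR
        have hR' := Finset.mem_coe.1 hR'
        simp only [hKX, Finset.mem_filter, Finset.mem_erase, id, mem_tanS] at hR hR' hl hl'
        exact hne (uniq_one hl.1.2.2 hR.2.1 hR'.2.1 hl.1.1 hl'.1.1)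
    · intro l hl
      have hl := Finset.mem_coe.1 hl
      simp only [hTT, Finset.mem_filter, Finset.mem_univ, true_and] at hl
      refine Finset.mem_coe.2 (mem_ext.2 ⟨le_sup_left, le_top, ?_⟩)
      have d1 := dim_add z l
      have d2 : finrank F ↥(z ⊓ l) = 1 := by rw [inf_comm]; exact hl.2.2.2
      show finrank F ↥(z ⊔ l) = finrank F z + 1
      omega
  have hPm : P ∈ ext ⊥ z := mem_ext.2 ⟨bot_le, hPz, by rw [S.pt hP, hbot]⟩
  have cM : ((((ext ⊥ z).erase P).card : ℕ) : ℤ) = q := by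
    have h1 := S.ext2 (bot_le : ⊥ ≤ z) (by omega)
    have h2 := Finset.card_erase_add_one hPm
    omega
  have hw := S.wsum hP hz
  have cX : ((ext z ⊤).card : ℤ) = q ^ 2 + q + 1 := S.ext3 le_top (by rw [S.dimV, hz2])
  have s1 : ∑ M ∈ (ext ⊥ z).erase P, (t - tanN K M ⊤) = q * (t - 1) - TT.card := by
    rw [c1, ← cM, ← nsmul_eq_mul, ← Finset.sum_const, ← Finset.sum_sub_distrib]
    apply Finset.sum_congr rfl
    intro M _; ring
  have s2 : ∑ X ∈ ext z ⊤, ((kap K X : ℤ) - 1) * (q + 2 - kap K X) =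
      ∑ X ∈ ext z ⊤, (q + q * (q + 1 - kap K X) - (q + 1 - kap K X) * (q + 2 - kap K X)) := by
    apply Finset.sum_congr rfl
    intro M _; ring
  rw [s1, c2, s2, Finset.sum_sub_distrib, Finset.sum_add_distrib, ← Finset.mul_sum, hw, Finset.sum_const,
    nsmul_eq_mul, cX]
  ring

lemma not_mem_of_tan {P z M : Submodule F V} (hP : P ∈ K) (hz : z ∈ tanS K P) (hM : M ≤ z) (hne : M ≠ P) :
    M ∉ K := by
  intro h
  obtain ⟨hPz, hz2, hkz⟩ := mem_tanS.1 hz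
  exact hne (uniq_one hkz h hP hM hPz)

lemma C4_ge {P z : Submodule F V} (hP : P ∈ K) (hz : z ∈ tanS K P) :
    q ^ 3 + q ^ 2 + q ≤ ∑ X ∈ ext z ⊤, (q + 1 - kap K X) * (q + 2 - kap K X) := by
  have h1 := S.C4 hP hz
  have h2 : 0 ≤ ∑ M ∈ (ext ⊥ z).erase P, (t - tanN K M ⊤) := by
    apply Finset.sum_nonneg
    intro M hM
    rw [Finset.mem_erase, mem_ext, finrank_bot] at hM
    have := S.tan_le hM.2.2.2 (S.not_mem_of_tan hP hz hM.2.2.1 hM.1)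
    linarith
  linarith

end Setup
end Geo
end CapAux

open Module

namespace CapAux
open Classical

section Geo
variable {F V : Type*} [Field F] [Fintype F] [AddCommGroup V] [Module F V] [Fintype V]
  [Fintype (Submodule F V)]
variable {K : Finset (Submodule F V)}

/-- solids containing U -/
noncomputable def sol (U : Submodule F V) : Finset (Submodule F V) :=
  Finset.univ.filter (fun H => U ≤ H ∧ finrank F H = 4)

lemma mem_sol {U H : Submodule F V} : H ∈ sol U ↔ U ≤ H ∧ finrank F H = 4 := by simp [sol]

lemma first_moment {A HH : Finset (Submodule F V)} (w : Submodule F V → ℤ) (α : ℤ)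
    (h : ∀ a ∈ A, ((HH.filter (fun H => a ≤ H)).card : ℤ) = α) :
    ∑ H ∈ HH, ∑ a ∈ A.filter (fun a => a ≤ H), w a = α * ∑ a ∈ A, w a := by
  simp_rw [Finset.sum_filter]
  rw [Finset.sum_comm, Finset.mul_sum]
  apply Finset.sum_congr rfl
  intro a ha
  rw [← Finset.sum_filter, Finset.sum_const, nsmul_eq_mul, h a ha]

lemma second_moment {A HH : Finset (Submodule F V)} (w : Submodule F V → ℤ) (α β : ℤ)
    (h : ∀ a ∈ A, ((HH.filter (fun H => a ≤ H)).card : ℤ) = α)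
    (h' : ∀ a ∈ A, ∀ b ∈ A, a ≠ b → ((HH.filter (fun H => a ≤ H ∧ b ≤ H)).card : ℤ) = β) :
    ∑ H ∈ HH, (∑ a ∈ A.filter (fun a => a ≤ H), w a) ^ 2 =
      (α - β) * ∑ a ∈ A, w a ^ 2 + β * (∑ a ∈ A, w a) ^ 2 := by
  have e1 : ∀ H ∈ HH, (∑ a ∈ A.filter (fun a => a ≤ H), w a) ^ 2 =
      ∑ a ∈ A, ∑ b ∈ A, if a ≤ H ∧ b ≤ H then w a * w b else 0 := by
    intro H _
    rw [sq, Finset.sum_mul_sum, Finset.sum_filter]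
    apply Finset.sum_congr rfl
    intro a _
    split_ifs with ha
    · rw [Finset.sum_filter]
      apply Finset.sum_congr rfl
      intro b _
      simp [ha]
    · simp [ha]
  rw [Finset.sum_congr rfl e1, Finset.sum_comm]
  have e2 : ∀ a ∈ A, ∑ H ∈ HH, ∑ b ∈ A, (if a ≤ H ∧ b ≤ H then w a * w b else 0) =
      (α - β) * w a ^ 2 + β * (w a * ∑ b ∈ A, w b) := by
    intro a ha
    rw [Finset.sum_comm]
    have e3 : ∀ b ∈ A, ∑ H ∈ HH, (if a ≤ H ∧ b ≤ H then w a * w b else 0) =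
        β * (w a * w b) + if a = b then (α - β) * w a ^ 2 else 0 := by
      intro b hb
      rw [← Finset.sum_filter, Finset.sum_const, nsmul_eq_mul]
      split_ifs with hab
      · subst hab
        simp only [and_self]
        rw [h a ha]; ring
      · rw [h' a ha b hb hab]; ring
    rw [Finset.sum_congr rfl e3, Finset.sum_add_distrib, Finset.sum_ite_eq, if_pos ha, ← Finset.mul_sum,
      ← Finset.mul_sum]
    ring
  rw [Finset.sum_congr rfl e2, Finset.sum_add_distrib, ← Finset.mul_sum, ← Finset.mul_sum, ← Finset.sum_mul, sq (∑ a ∈ A, w a)]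

lemma tanN_card_eq (N W : Submodule F V) : (tanN K N W : ℤ) = ∑ _a ∈ (tanS K N).filter (fun a => a ≤ W), 1 := by
  unfold tanN cnt
  simp

namespace Setup
variable {q t : ℤ} (S : Setup K q t)
include S

lemma dim_le5 (U : Submodule F V) : finrank F U ≤ 5 := by
  rw [← S.dimV]; exact dim_mono le_top

lemma dim_inf_solid {A U : Submodule F V} (hA : finrank F A = 4) (h : ¬ U ≤ A) :
    finrank F ↥(U ⊓ A) + 1 = finrank F U := by
  have h1 := dim_add U A
  have h2 := S.dim_le5 (U ⊔ A)
  have h3 : finrank F A < finrank F ↥(U ⊔ A) := dim_lt le_sup_right (fun h' => h (le_sup_left.trans h'))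
  omega

lemma solid_not_le {A B : Submodule F V} (hA : finrank F A = 4) (hB : finrank F B = 4) (h : A ≠ B) :
    ¬ A ≤ B := fun h' => h (eq_of_le_dim h' (by omega))

lemma sol3 {U : Submodule F V} (hU : finrank F U = 3) : ((sol U).card : ℤ) = q + 1 := by
  have : sol U = ext U ⊤ := by
    ext H; rw [mem_sol, mem_ext, hU]; simp
  rw [this, S.ext2 le_top (by rw [S.dimV, hU])]

lemma sol4 {U : Submodule F V} (hU : finrank F U = 4) : ((sol U).card : ℤ) = 1 := by
  have : sol U = {U} := by
    ext H; rw [mem_sol, Finset.mem_singleton]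
    constructor
    · rintro ⟨h1, h2⟩; exact (eq_of_le_dim h1 (by omega)).symm
    · rintro rfl; exact ⟨le_rfl, hU⟩
  rw [this]; simp

/-- flag count -/
lemma sol_flag {U : Submodule F V} {a b : ℤ} (h1 : ∀ X ∈ ext U ⊤, ((sol X).card : ℤ) = a)
    (h2 : ∀ H ∈ sol U, ((ext U H).card : ℤ) = b) :
    ((ext U ⊤).card : ℤ) * a = (sol U).card * b := by
  have h3 := first_moment (A := ext U ⊤) (HH := sol U) (fun _ => 1) a (by
    intro X hX
    rw [← h1 X hX]
    congr 2
    ext H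
    rw [Finset.mem_filter, mem_sol, mem_sol]
    rw [mem_ext] at hX
    constructor
    · rintro ⟨⟨h4, h5⟩, h6⟩; exact ⟨h6, h5⟩
    · rintro ⟨h4, h5⟩; exact ⟨⟨hX.1.trans h4, h5⟩, h4⟩)
  rw [Finset.sum_congr rfl (g := fun _ => b), Finset.sum_const, Finset.sum_const, nsmul_eq_mul,
    nsmul_eq_mul] at h3
  · linarith
  · intro H hH
    rw [Finset.sum_const, nsmul_eq_mul, mul_one, ← h2 H hH]
    congr 2
    ext X
    rw [Finset.mem_filter, mem_ext, mem_ext]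
    simp; tauto

lemma sol2 {U : Submodule F V} (hU : finrank F U = 2) : ((sol U).card : ℤ) = q ^ 2 + q + 1 := by
  have h := S.sol_flag (U := U) (a := q + 1) (b := q + 1) (by
    intro X hX; rw [mem_ext] at hX; exact S.sol3 (by omega)) (by
    intro H hH; rw [mem_sol] at hH; exact S.ext2 hH.1 (by omega))
  rw [S.ext3 le_top (by rw [S.dimV, hU])] at h
  have := S.q_ge
  exact (mul_right_cancel₀ (show q + 1 ≠ 0 by omega) h).symm

lemma sol1 {U : Submodule F V} (hU : finrank F U = 1) :
    ((sol U).card : ℤ) = q ^ 3 + q ^ 2 + q + 1 := by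
  have h := S.sol_flag (U := U) (a := q ^ 2 + q + 1) (b := q ^ 2 + q + 1) (by
    intro X hX; rw [mem_ext] at hX; exact S.sol2 (by omega)) (by
    intro H hH; rw [mem_sol] at hH; exact S.ext3 hH.1 (by omega))
  rw [S.ext4 le_top (by rw [S.dimV, hU])] at h
  have := S.q_ge
  exact (mul_right_cancel₀ (show q ^ 2 + q + 1 ≠ 0 by positivity) h).symm

omit S in
lemma sol_filter {U X : Submodule F V} (h : U ≤ X) :
    (sol U).filter (fun H => X ≤ H) = sol X := by
  ext H
  rw [Finset.mem_filter, mem_sol, mem_sol]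
  constructor
  · rintro ⟨⟨h4, h5⟩, h6⟩; exact ⟨h6, h5⟩
  · rintro ⟨h4, h5⟩; exact ⟨⟨h.trans h4, h5⟩, h4⟩

omit S in
lemma sol_filter2 {U X Y : Submodule F V} (h : U ≤ X) :
    (sol U).filter (fun H => X ≤ H ∧ Y ≤ H) = sol (X ⊔ Y) := by
  ext H
  rw [Finset.mem_filter, mem_sol, mem_sol, sup_le_iff]
  constructor
  · rintro ⟨⟨h4, h5⟩, h6⟩; exact ⟨h6, h5⟩
  · rintro ⟨h4, h5⟩; exact ⟨⟨h.trans h4.1, h5⟩, h4⟩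

omit S in
lemma two_lines {l l' N : Submodule F V} (hl : finrank F l = 2) (hl' : finrank F l' = 2)
    (hN : finrank F N = 1) (h1 : N ≤ l) (h3 : N ≤ l') (hne : l ≠ l') : finrank F ↥(l ⊔ l') = 3 := by
  have d := dim_add l l'
  rw [line_inf hl hl' hN h1 h3 hne] at d
  omega

omit S in
lemma two_planes {X Y z : Submodule F V} (hX : finrank F X = 3) (hY : finrank F Y = 3)
    (hz : finrank F z = 2) (h1 : z ≤ X) (h2 : z ≤ Y) (hne : X ≠ Y) : finrank F ↥(X ⊔ Y) = 4 := by
  have d := dim_add X Y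
  have d1 := dim_mono (le_inf h1 h2)
  have d2 : finrank F ↥(X ⊓ Y) < finrank F X :=
    dim_lt inf_le_left (fun h => hne (eq_of_le_dim (h.trans inf_le_right) (by omega)))
  omega

lemma tcard {P : Submodule F V} (hP : P ∈ K) : ((tanS K P).card : ℤ) = t := by
  rw [← S.tan_top hP, tanN_card_eq]
  simp

lemma momP1 {P : Submodule F V} (hP : P ∈ K) :
    ∑ H ∈ sol P, (tanN K P H : ℤ) = (q ^ 2 + q + 1) * t := by
  simp_rw [tanN_card_eq]
  rw [first_moment (A := tanS K P) (HH := sol P) (fun _ => 1) (q ^ 2 + q + 1)]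
  · rw [Finset.sum_const, nsmul_eq_mul, S.tcard hP]; ring
  · intro l hl
    rw [mem_tanS] at hl
    rw [sol_filter hl.1, S.sol2 hl.2.1]

lemma momP2 {P : Submodule F V} (hP : P ∈ K) :
    ∑ H ∈ sol P, (tanN K P H : ℤ) ^ 2 = q ^ 2 * t + (q + 1) * t ^ 2 := by
  simp_rw [tanN_card_eq]
  rw [second_moment (A := tanS K P) (HH := sol P) (fun _ => 1) (q ^ 2 + q + 1) (q + 1)]
  · simp only [one_pow]
    rw [Finset.sum_const, nsmul_eq_mul, S.tcard hP]; ring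
  · intro l hl
    rw [mem_tanS] at hl
    rw [sol_filter hl.1, S.sol2 hl.2.1]
  · intro l hl l' hl' hne
    rw [mem_tanS] at hl hl'
    rw [sol_filter2 hl.1, S.sol3 (two_lines hl.2.1 hl'.2.1 (S.pt hP) hl.1 hl'.1 hne)]

lemma n_sub {P z H : Submodule F V} (hP : P ∈ K) (hz : z ∈ tanS K P) (hH : H ∈ sol z) :
    (tanN K P H : ℤ) - 1 = ∑ X ∈ (ext z ⊤).filter (fun X => X ≤ H), (q + 1 - kap K X) := by
  obtain ⟨hPz, hz2, hkz⟩ := mem_tanS.1 hz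
  rw [mem_sol] at hH
  have h1 := tan_part (K := K) (S.pt hP) hPz hH.1
  rw [tan_line (S.pt hP) hz2 hPz, if_pos hkz] at h1
  rw [Nat.cast_one] at h1
  rw [← h1]
  have : (ext z ⊤).filter (fun X => X ≤ H) = ext z H := by
    ext X; rw [Finset.mem_filter, mem_ext, mem_ext]; simp; tauto
  rw [this]
  apply Finset.sum_congr rfl
  intro X hX
  rw [mem_ext] at hX
  rw [S.tan_plane hP (hPz.trans hX.1) (by omega)]
  ring

lemma momz1 {P z : Submodule F V} (hP : P ∈ K) (hz : z ∈ tanS K P) :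
    ∑ H ∈ sol z, ((tanN K P H : ℤ) - 1) = (q + 1) * (t - 1) := by
  obtain ⟨hPz, hz2, hkz⟩ := mem_tanS.1 hz
  rw [Finset.sum_congr rfl (fun H hH => S.n_sub hP hz hH), first_moment _ (q + 1), S.wsum hP hz]
  intro X hX
  rw [mem_ext] at hX
  rw [sol_filter hX.1, S.sol3 (by omega)]

lemma momz2 {P z : Submodule F V} (hP : P ∈ K) (hz : z ∈ tanS K P) :
    ∑ H ∈ sol z, ((tanN K P H : ℤ) - 1) ^ 2 =
      q * ∑ X ∈ ext z ⊤, (q + 1 - kap K X) ^ 2 + (t - 1) ^ 2 := by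
  obtain ⟨hPz, hz2, hkz⟩ := mem_tanS.1 hz
  rw [Finset.sum_congr rfl (fun H hH => by rw [S.n_sub hP hz hH]), second_moment _ (q + 1) 1, S.wsum hP hz]
  · ring
  · intro X hX
    rw [mem_ext] at hX
    rw [sol_filter hX.1, S.sol3 (by omega)]
  · intro X hX Y hY hne
    rw [mem_ext] at hX hY
    rw [sol_filter2 hX.1, S.sol4 (two_planes (by omega) (by omega) hz2 hX.1 hY.1 hne)]

/-- scaled deviation -/
noncomputable def _root_.CapAux.dev (q t : ℤ) (K : Finset (Submodule F V)) (P H : Submodule F V) : ℤ :=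
  q * tanN K P H - (t + q - 1)

lemma devz {P z : Submodule F V} (hP : P ∈ K) (hz : z ∈ tanS K P) :
    q ^ 6 + q ^ 5 + q ^ 4 - q ^ 3 * (t - 1) - (q - 1) * (t - 1) ^ 2 ≤ ∑ H ∈ sol z, dev q t K P H ^ 2 := by
  obtain ⟨hPz, hz2, hkz⟩ := mem_tanS.1 hz
  have e : ∀ H ∈ sol z, dev q t K P H ^ 2 = q ^ 2 * ((tanN K P H : ℤ) - 1) ^ 2
      - 2 * q * (t - 1) * ((tanN K P H : ℤ) - 1) + (t - 1) ^ 2 := by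
    intro H _; unfold dev; ring
  rw [Finset.sum_congr rfl e, Finset.sum_add_distrib, Finset.sum_sub_distrib, ← Finset.mul_sum,
    ← Finset.mul_sum, S.momz1 hP hz, S.momz2 hP hz, Finset.sum_const, nsmul_eq_mul, S.sol2 hz2]
  have h1 := S.C4_ge hP hz
  have h2 : ∑ X ∈ ext z ⊤, (q + 1 - kap K X) * (q + 2 - kap K X) =
      ∑ X ∈ ext z ⊤, (q + 1 - kap K X) ^ 2 + ∑ X ∈ ext z ⊤, (q + 1 - kap K X : ℤ) := by
    rw [← Finset.sum_add_distrib]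
    apply Finset.sum_congr rfl
    intro X _; ring
  rw [h2, S.wsum hP hz] at h1
  have hq := S.q_ge
  have h3 : 0 ≤ q ^ 3 := by positivity
  nlinarith [mul_le_mul_of_nonneg_left h1 h3]

lemma devP {P : Submodule F V} (hP : P ∈ K) :
    ∑ H ∈ sol P, dev q t K P H ^ 2 = q ^ 4 * t - (q - 1) * t ^ 2 + (2 * q - 2) * t + (q - 1) * (q ^ 4 - 1) := by
  have e : ∀ H ∈ sol P, dev q t K P H ^ 2 = q ^ 2 * (tanN K P H : ℤ) ^ 2
      - 2 * q * (t + q - 1) * (tanN K P H : ℤ) + (t + q - 1) ^ 2 := by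
    intro H _; unfold dev; ring
  rw [Finset.sum_congr rfl e, Finset.sum_add_distrib, Finset.sum_sub_distrib, ← Finset.mul_sum,
    ← Finset.mul_sum, S.momP1 hP, S.momP2 hP, Finset.sum_const, nsmul_eq_mul, S.sol1 (S.pt hP)]
  ring

lemma devW {P : Submodule F V} (hP : P ∈ K) :
    ∑ H ∈ sol P, (tanN K P H : ℤ) * dev q t K P H ^ 2 = ∑ z ∈ tanS K P, ∑ H ∈ sol z, dev q t K P H ^ 2 := by
  have e : ∀ z ∈ tanS K P, ∑ H ∈ sol z, dev q t K P H ^ 2 =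
      ∑ H ∈ sol P, if z ≤ H then dev q t K P H ^ 2 else 0 := by
    intro z hz
    rw [← Finset.sum_filter, sol_filter (mem_tanS.1 hz).1]
  rw [Finset.sum_congr rfl e, Finset.sum_comm]
  apply Finset.sum_congr rfl
  intro H _
  rw [← Finset.sum_filter, Finset.sum_const, nsmul_eq_mul, tanN_card_eq]
  simp

lemma n_le {P H : Submodule F V} (hP : P ∈ K) (hH : H ∈ sol P) : (tanN K P H : ℤ) ≤ q ^ 2 + q + 1 := by
  rw [mem_sol] at hH
  rw [S.tan_solid hP hH.1 hH.2]
  have : kap K P ≤ kap K H := kap_mono hH.1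
  rw [S.kapP hP] at this
  omega

lemma t_bd : t ≤ 3 * q ^ 2 := by
  have := S.t_le; have := S.q_ge; linarith

lemma devTot {P : Submodule F V} (hP : P ∈ K) :
    ∑ H ∈ sol P, (q ^ 2 + q + 1 - tanN K P H) * dev q t K P H ^ 2 ≤ 38 * q ^ 7 := by
  have e : ∑ H ∈ sol P, (q ^ 2 + q + 1 - tanN K P H) * dev q t K P H ^ 2 =
      (q ^ 2 + q + 1) * ∑ H ∈ sol P, dev q t K P H ^ 2 - ∑ H ∈ sol P, (tanN K P H : ℤ) * dev q t K P H ^ 2 := by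
    rw [Finset.mul_sum, ← Finset.sum_sub_distrib]
    apply Finset.sum_congr rfl
    intro H _; ring
  rw [e, S.devW hP, S.devP hP]
  have h1 := Finset.card_nsmul_le_sum (tanS K P) _ _ (fun z hz => S.devz hP hz)
  rw [nsmul_eq_mul, S.tcard hP] at h1
  have hq := S.q_ge
  have ht := S.t_bd
  have ht1 := S.t_pos
  have key : t ^ 2 + t * (q ^ 3 - 2) + (q ^ 3 - 1) * (q ^ 4 - 1) + (q - 1) * t * (t - 1) ^ 2 ≤ 38 * q ^ 7 := by
    have a1 : t ^ 2 ≤ 9 * q ^ 4 := by nlinarith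
    have a2 : t * (t - 1) ^ 2 ≤ 27 * q ^ 6 := by
      have : (t - 1) ^ 2 ≤ 9 * q ^ 4 := by nlinarith
      calc t * (t - 1) ^ 2 ≤ (3 * q ^ 2) * (9 * q ^ 4) := mul_le_mul ht this (by positivity) (by positivity)
        _ = 27 * q ^ 6 := by ring
    have a3 : (q - 1) * (t * (t - 1) ^ 2) ≤ (q - 1) * (27 * q ^ 6) := mul_le_mul_of_nonneg_left a2 (by linarith)
    have a4 : t * q ^ 3 ≤ 3 * q ^ 2 * q ^ 3 := mul_le_mul_of_nonneg_right ht (by positivity)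
    have b1 : q ^ 4 ≤ q ^ 7 := pow_le_pow_right₀ (by linarith) (by norm_num)
    have b2 : q ^ 5 ≤ q ^ 7 := pow_le_pow_right₀ (by linarith) (by norm_num)
    have b3 : 0 ≤ q ^ 6 := by positivity
    have b4 : 0 ≤ q ^ 3 := by positivity
    have b5 : 0 ≤ q ^ 4 := by positivity
    have b6 : 1 ≤ q ^ 7 := one_le_pow₀ (by linarith)
    nlinarith
  have id1 : (q ^ 2 + q + 1) * (q ^ 4 * t - (q - 1) * t ^ 2 + (2 * q - 2) * t + (q - 1) * (q ^ 4 - 1))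
     - t * (q ^ 6 + q ^ 5 + q ^ 4 - q ^ 3 * (t - 1) - (q - 1) * (t - 1) ^ 2) =
     t ^ 2 + t * (q ^ 3 - 2) + (q ^ 3 - 1) * (q ^ 4 - 1) + (q - 1) * t * (t - 1) ^ 2 := by ring
  linarith

/-- big solids at P -/
noncomputable def _root_.CapAux.bigS (q : ℤ) (K : Finset (Submodule F V)) (P : Submodule F V) :
    Finset (Submodule F V) :=
  (sol P).filter (fun H => q ^ 2 - 42 * q ≤ (tanN K P H : ℤ))

omit S in
lemma mem_big {P H : Submodule F V} : H ∈ bigS q K P ↔ P ≤ H ∧ finrank F H = 4 ∧ q ^ 2 - 42 * q ≤ (tanN K P H : ℤ) := by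
  unfold bigS; rw [Finset.mem_filter, mem_sol]; tauto

lemma big_cover {P z : Submodule F V} (hP : P ∈ K) (hz : z ∈ tanS K P) : ∃ H ∈ bigS q K P, z ≤ H := by
  by_contra hcon
  push Not at hcon
  obtain ⟨hPz, hz2, hkz⟩ := mem_tanS.1 hz
  have h1 := S.devTot hP
  have h2 := S.devz hP hz
  have hq := S.q_ge
  have h3 : (43 * q) * ∑ H ∈ sol z, dev q t K P H ^ 2 ≤
      ∑ H ∈ sol P, (q ^ 2 + q + 1 - tanN K P H) * dev q t K P H ^ 2 := by
    rw [Finset.mul_sum]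
    have e1 : ∑ H ∈ sol z, 43 * q * dev q t K P H ^ 2 ≤
      ∑ H ∈ sol z, (q ^ 2 + q + 1 - tanN K P H) * dev q t K P H ^ 2 := by
      apply Finset.sum_le_sum
      intro H hH
      apply mul_le_mul_of_nonneg_right _ (sq_nonneg _)
      by_contra hc
      rw [mem_sol] at hH
      refine hcon H (mem_big.2 ⟨hPz.trans hH.1, hH.2, ?_⟩) hH.1
      linarith
    refine e1.trans (Finset.sum_le_sum_of_subset_of_nonneg ?_ ?_)
    · intro H hH; rw [mem_sol] at hH ⊢; exact ⟨hPz.trans hH.1, hH.2⟩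
    · intro H hH _
      apply mul_nonneg _ (sq_nonneg _)
      have := S.n_le hP hH; linarith
  have ht := S.t_bd
  have ht1 := S.t_pos
  have a1 : (t - 1) ^ 2 ≤ 9 * q ^ 4 := by nlinarith
  have a2 : (q - 1) * (t - 1) ^ 2 ≤ q * (9 * q ^ 4) := mul_le_mul (by linarith) a1 (by positivity) (by linarith)
  have a3 : q ^ 3 * (t - 1) ≤ q ^ 3 * (3 * q ^ 2) := mul_le_mul_of_nonneg_left (by linarith) (by positivity)
  have a4 : q ^ 6 - 11 * q ^ 5 ≤ ∑ H ∈ sol z, dev q t K P H ^ 2 := by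
    have : 0 ≤ q ^ 4 := by positivity
    nlinarith
  have a5 : 43 * q * (q ^ 6 - 11 * q ^ 5) ≤ 38 * q ^ 7 :=
    (mul_le_mul_of_nonneg_left a4 (by linarith)).trans (h3.trans h1)
  have a6 : 0 < q ^ 6 := by positivity
  nlinarith

lemma tan_plane_le {P W : Submodule F V} (hP : P ∈ K) (h : P ≤ W) (hW : finrank F W = 3) :
    (tanN K P W : ℤ) ≤ q + 1 := by
  rw [S.tan_plane hP h hW]
  have : kap K P ≤ kap K W := kap_mono h
  rw [S.kapP hP] at this
  omega

lemma inf_filter (P A B : Submodule F V) : (tanS K P).filter (fun s => id s ≤ A) ∩ (tanS K P).filter (fun s => id s ≤ B)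
    = (tanS K P).filter (fun s => id s ≤ A ⊓ B) := by
  ext l; simp only [Finset.mem_inter, Finset.mem_filter, id, le_inf_iff]; tauto

lemma two_big {P A B : Submodule F V} (hP : P ∈ K) (hA : A ∈ bigS q K P) (hB : B ∈ bigS q K P) (hne : A ≠ B) :
    finrank F ↥(A ⊓ B) = 3 ∧ (tanN K P (A ⊓ B) : ℤ) ≤ q + 1 := by
  rw [mem_big] at hA hB
  have := S.dim_inf_solid hB.2.1 (S.solid_not_le hA.2.1 hB.2.1 hne)
  exact ⟨by omega, S.tan_plane_le hP (le_inf hA.1 hB.1) (by omega)⟩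

lemma big_le {P : Submodule F V} (hP : P ∈ K) : (bigS q K P).card ≤ 2 := by
  by_contra hcon
  obtain ⟨A, B, C, hA, hB, hC, hAB, hAC, hBC⟩ := Finset.two_lt_card_iff.1 (by omega : 2 < (bigS q K P).card)
  have h1 := (S.two_big hP hA hB hAB).2
  have h2 := (S.two_big hP hA hC hAC).2
  have h3 := (S.two_big hP hB hC hBC).2
  rw [mem_big] at hA hB hC
  have hq := S.q_ge
  have ht := S.t_le
  have hc := S.tcard hP
  set a := (tanS K P).filter (fun s => id s ≤ A) with ha
  set b := (tanS K P).filter (fun s => id s ≤ B) with hb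
  set c := (tanS K P).filter (fun s => id s ≤ C) with hcc
  have e1 : (a ∪ b ∪ c).card ≤ (tanS K P).card := by
    apply Finset.card_le_card
    intro l hl
    simp only [Finset.mem_union, ha, hb, hcc, Finset.mem_filter] at hl
    tauto
  have e2 := Finset.card_union_add_card_inter (a ∪ b) c
  have e3 := Finset.card_union_add_card_inter a b
  have e4 : ((a ∪ b) ∩ c).card ≤ (a ∩ c).card + (b ∩ c).card := by
    rw [Finset.union_inter_distrib_right]; exact Finset.card_union_le _ _
  have i1 : (a ∩ b).card = tanN K P (A ⊓ B) := by rw [ha, hb, S.inf_filter]; rfl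
  have i2 : (a ∩ c).card = tanN K P (A ⊓ C) := by rw [ha, hcc, S.inf_filter]; rfl
  have i3 : (b ∩ c).card = tanN K P (B ⊓ C) := by rw [hb, hcc, S.inf_filter]; rfl
  have j1 : a.card = tanN K P A := rfl
  have j2 : b.card = tanN K P B := rfl
  have j3 : c.card = tanN K P C := rfl
  have hA' := hA.2.2
  have hB' := hB.2.2
  have hC' := hC.2.2
  generalize q ^ 2 = qq at *
  omega

lemma big_pos {P : Submodule F V} (hP : P ∈ K) : 1 ≤ (bigS q K P).card := by
  have h := S.tcard hP
  have ht := S.t_pos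
  obtain ⟨z, hz⟩ := Finset.card_pos.1 (by omega : 0 < (tanS K P).card)
  obtain ⟨H, hH, _⟩ := S.big_cover hP hz
  exact Finset.card_pos.2 ⟨H, hH⟩

lemma big_kap {P A : Submodule F V} (hP : P ∈ K) (hA : A ∈ bigS q K P) : (kap K A : ℤ) ≤ 43 * q + 2 := by
  rw [mem_big] at hA
  have := S.tan_solid hP hA.1 hA.2.1
  linarith [hA.2.2]

lemma tan_line_le {P l : Submodule F V} (hP : P ∈ K) (h : P ≤ l) (hl : finrank F l = 2) : tanN K P l ≤ 1 := by
  rw [tan_line (S.pt hP) hl h]; split_ifs <;> omega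

lemma off_plane {P W : Submodule F V} (hP : P ∈ K) (h : P ≤ W) (hW : finrank F W = 3)
    (hoff : ∀ A ∈ bigS q K P, ¬ W ≤ A) : q + 2 - kap K W ≤ (bigS q K P).card := by
  rw [← S.tan_plane hP h hW]
  norm_cast
  have e : (tanS K P).filter (fun s => id s ≤ W) ⊆
      (bigS q K P).biUnion (fun A => (tanS K P).filter (fun s => id s ≤ W ⊓ A)) := by
    intro l hl
    rw [Finset.mem_filter] at hl
    obtain ⟨A, hA, hlA⟩ := S.big_cover hP hl.1
    exact Finset.mem_biUnion.2 ⟨A, hA, Finset.mem_filter.2 ⟨hl.1, le_inf hl.2 hlA⟩⟩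
  refine (Finset.card_le_card e).trans (Finset.card_biUnion_le.trans ?_)
  rw [Finset.card_eq_sum_ones]
  apply Finset.sum_le_sum
  intro A hA
  have hA' := mem_big.1 hA
  have := S.dim_inf_solid hA'.2.1 (hoff A hA)
  exact S.tan_line_le hP (le_inf h hA'.1) (by omega)

lemma big_one_iff {P : Submodule F V} (hP : P ∈ K) : (bigS q K P).card = 1 ↔ t ≤ q ^ 2 + q + 1 := by
  have hc := S.tcard hP
  have h1 := S.big_pos hP
  have h2 := S.big_le hP
  have hq := S.q_ge
  constructor
  · intro h
    obtain ⟨A, hA⟩ := Finset.card_eq_one.1 h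
    have hAm : A ∈ bigS q K P := by rw [hA]; simp
    have e : tanS K P ⊆ (tanS K P).filter (fun s => id s ≤ A) := by
      intro l hl
      obtain ⟨B, hB, hlB⟩ := S.big_cover hP hl
      rw [hA, Finset.mem_singleton] at hB
      subst hB
      exact Finset.mem_filter.2 ⟨hl, hlB⟩
    have e2 : (tanS K P).card ≤ tanN K P A := Finset.card_le_card e
    have e3 := S.n_le hP (Finset.mem_of_mem_filter A hAm)
    omega
  · intro ht
    by_contra hne
    obtain ⟨A, B, hAB, hAB'⟩ := Finset.card_eq_two.1 (by omega : (bigS q K P).card = 2)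
    have hA : A ∈ bigS q K P := by rw [hAB']; simp
    have hB : B ∈ bigS q K P := by rw [hAB']; simp
    have h3 := (S.two_big hP hA hB hAB).2
    rw [mem_big] at hA hB
    have hA' := hA.2.2
    have hB' := hB.2.2
    have e3 := Finset.card_union_add_card_inter ((tanS K P).filter (fun s => id s ≤ A)) ((tanS K P).filter (fun s => id s ≤ B))
    have e1 : ((tanS K P).filter (fun s => id s ≤ A) ∪ (tanS K P).filter (fun s => id s ≤ B)).card ≤ (tanS K P).card := by
      apply Finset.card_le_card
      intro l hl
      simp only [Finset.mem_union, Finset.mem_filter] at hl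
      tauto
    rw [S.inf_filter] at e3
    have i1 : ((tanS K P).filter (fun s => id s ≤ A ⊓ B)).card = tanN K P (A ⊓ B) := rfl
    have j1 : ((tanS K P).filter (fun s => id s ≤ A)).card = tanN K P A := rfl
    have j2 : ((tanS K P).filter (fun s => id s ≤ B)).card = tanN K P B := rfl
    have : 2048 * q ≤ q ^ 2 := by nlinarith
    generalize q ^ 2 = qq at *
    omega

end Setup
end Geo
end CapAux

open Module

namespace CapAux
open Classical

section Geo
variable {F V : Type*} [Field F] [Fintype F] [AddCommGroup V] [Module F V] [Fintype V]
  [Fintype (Submodule F V)]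
variable {K : Finset (Submodule F V)}

lemma ext_filter {U A : Submodule F V} : (ext U ⊤).filter (fun X => X ≤ A) = ext U A := by
  ext X
  simp only [Finset.mem_filter, mem_ext, le_top, true_and]
  tauto

lemma tanS_trans {P N z : Submodule F V} (hz : z ∈ tanS K P) (h : N ≤ z) : z ∈ tanS K N := by
  rw [mem_tanS] at *
  exact ⟨h, hz.2⟩

lemma tan_pos {N z X : Submodule F V} (hz : z ∈ tanS K N) (h : z ≤ X) : 1 ≤ tanN K N X := by
  apply Finset.card_pos.2
  exact ⟨z, Finset.mem_filter.2 ⟨hz, h⟩⟩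

lemma tan_two {N z y X : Submodule F V} (hz : z ∈ tanS K N) (hy : y ∈ tanS K N) (hne : z ≠ y)
    (h : z ≤ X) (h' : y ≤ X) : 2 ≤ tanN K N X := by
  have : 1 < tanN K N X := by
    apply Finset.one_lt_card.2
    exact ⟨z, Finset.mem_filter.2 ⟨hz, h⟩, y, Finset.mem_filter.2 ⟨hy, h'⟩, hne⟩
  omega

lemma exists_tan {N X : Submodule F V} (h : 1 ≤ tanN K N X) : ∃ z ∈ tanS K N, z ≤ X := by
  obtain ⟨z, hz⟩ := Finset.card_pos.1 h
  rw [Finset.mem_filter] at hz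
  exact ⟨z, hz.1, hz.2⟩

/-- a tangent not in any member of a list of two subspaces -/
lemma exists_tan_diff {N X Y : Submodule F V} (h : tanN K N (X ⊓ Y) < tanN K N X) :
    ∃ z ∈ tanS K N, z ≤ X ∧ ¬ z ≤ Y := by
  by_contra! hcon
  have : tanN K N X ≤ tanN K N (X ⊓ Y) := by
    apply Finset.card_le_card
    intro l hl
    simp only [Finset.mem_filter, id, le_inf_iff] at *
    exact ⟨hl.1, hl.2, hcon l hl.1 hl.2⟩
  omega

lemma exists_tan_diff2 {N X Y Z : Submodule F V}
    (h : tanN K N (X ⊓ Y) + tanN K N (X ⊓ Z) < tanN K N X) :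
    ∃ z ∈ tanS K N, z ≤ X ∧ ¬ z ≤ Y ∧ ¬ z ≤ Z := by
  by_contra! hcon
  have : tanN K N X ≤ tanN K N (X ⊓ Y) + tanN K N (X ⊓ Z) := by
    refine le_trans (Finset.card_le_card ?_) (Finset.card_union_le _ _)
    intro l hl
    simp only [Finset.mem_union, Finset.mem_filter, id, le_inf_iff] at *
    by_cases hY : l ≤ Y
    · exact Or.inl ⟨hl.1, hl.2, hY⟩
    · exact Or.inr ⟨hl.1, hl.2, hcon l hl.1 hl.2 hY⟩
  omega

namespace Setup
variable {q t : ℤ} (S : Setup K q t)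
include S

lemma q_even : Even q := by
  have := S.char
  rw [← S.q_eq]
  have h : ringChar F = 2 := ringChar.eq F 2
  have := FiniteField.even_card_of_char_two h
  exact_mod_cast Nat.even_iff.2 this

lemma g_even {N W : Submodule F V} (hd : finrank F N = 1) (hN : N ∉ K) (h : N ≤ W) :
    Even (gg q K N W) := by
  have h1 := kap_eq S.cap hd hN h
  obtain ⟨r, hr⟩ := S.q_even
  refine ⟨r + 1 - tanN K N W - secN K N W, ?_⟩
  unfold gg
  omega

lemma kap_free {N W : Submodule F V} (hd : finrank F N = 1) (hN : N ∉ K) (h : N ≤ W)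
    (hs : secN K N W = 0) : kap K W = tanN K N W := by
  have h1 := kap_eq S.cap hd hN h
  omega

lemma tan_le_kap {N W : Submodule F V} (hd : finrank F N = 1) (hN : N ∉ K) (h : N ≤ W) :
    tanN K N W ≤ kap K W := by
  have h1 := kap_eq S.cap hd hN h
  omega

lemma g_free {N W : Submodule F V} (hd : finrank F N = 1) (hN : N ∉ K) (h : N ≤ W)
    (hs : secN K N W = 0) : gg q K N W = q + 2 - 2 * kap K W := by
  have h1 := S.kap_free hd hN h hs
  unfold gg
  omega

lemma g_le_q {N z W : Submodule F V} (hd : finrank F N = 1) (hN : N ∉ K) (hz : z ∈ tanS K N)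
    (h : z ≤ W) : gg q K N W ≤ q := by
  have h1 := tan_pos hz h
  have h2 := S.tan_le_kap hd hN ((mem_tanS.1 hz).1.trans h)
  unfold gg
  omega

lemma off_g {N v R X : Submodule F V} (hd : finrank F N = 1) (hN : N ∉ K) (hv : v ∈ tanS K N)
    (hR : R ∈ K) (hRv : R ≤ v) (hvX : v ≤ X) (hX : finrank F X = 3)
    (hoff : ∀ A ∈ bigS q K R, ¬ X ≤ A) :
    ((kap K X : ℤ) = q ∨ (kap K X : ℤ) = q + 1) ∧ (secN K N X ≠ 0 → gg q K N X = 0) ∧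
    ((bigS q K R).card = 1 → (kap K X : ℤ) = q + 1) := by
  have h1 := S.off_plane hR (hRv.trans hvX) hX hoff
  have h2 := S.big_le hR
  have h3 := S.tan_plane hR (hRv.trans hvX) hX
  have h4 := tan_pos (tanS_trans hv hRv) hvX
  have h5 := tan_pos hv hvX
  refine ⟨by omega, fun hs => ?_, fun h => by omega⟩
  have h6 := S.g_nonneg hd hN ((mem_tanS.1 hv).1.trans hvX) hX hs
  obtain ⟨r, hr⟩ := S.g_even hd hN ((mem_tanS.1 hv).1.trans hvX)
  have h7 : gg q K N X = q + 2 - kap K X - tanN K N X := rfl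
  omega

lemma eq_inf {A b X : Submodule F V} (hA : finrank F A = 4) (hb : finrank F b = 4) (hne : A ≠ b)
    (h1 : X ≤ A) (h2 : X ≤ b) (hX : finrank F X = 3) : X = b ⊓ A := by
  have := S.dim_inf_solid hA (S.solid_not_le hb hA hne.symm)
  exact eq_of_le_dim (le_inf h2 h1) (by omega)

lemma big_D {R N A : Submodule F V} (hd : finrank F N = 1) (hN : N ∉ K) (hR : R ∈ K) (hA : A ∈ bigS q K R)
    (hNA : N ≤ A) : q ^ 2 - 85 * q - 2 ≤ DD q K N A := by
  have h1 := S.big_kap hR hA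
  have h2 := S.tan_le_kap hd hN hNA
  have h3 : DD q K N A = q ^ 2 + q + 2 - kap K A - tanN K N A := rfl
  omega

lemma tan_card_le {N W : Submodule F V} (hd : finrank F N = 1) (h : N ≤ W) (hW : finrank F W = 3) :
    (tanN K N W : ℤ) ≤ q + 1 := by
  rw [tanN_eq hd, ← S.ext2 h (by omega)]
  exact_mod_cast Finset.card_le_card (Finset.filter_subset _ _)

lemma K_ne : ∃ P, P ∈ K := by
  have h1 := S.t_eq
  have h2 := S.t_le
  have h3 := S.q_ge
  have : kap K (⊤ : Submodule F V) ≠ 0 := by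
    intro h
    rw [h] at h1
    push_cast at h1
    nlinarith [pow_pos (by omega : 0 < q) 2, pow_pos (by omega : 0 < q) 3]
  obtain ⟨P, hP, -⟩ := exists_pt this
  exact ⟨P, hP⟩

end Setup

/-- the basic configuration -/
structure Conf (K : Finset (Submodule F V)) (q t : ℤ) (P A z N : Submodule F V) : Prop where
  hP : P ∈ K
  hA : A ∈ bigS q K P
  hz : z ∈ tanS K P
  hzA : z ≤ A
  only : ∀ B ∈ bigS q K P, B ≠ A → ¬ z ≤ B
  hd : finrank F N = 1
  hNz : N ≤ z
  hN : N ∉ K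
  hD : t - tanN K N ⊤ ≤ 3 * q

namespace Setup
variable {q t : ℤ} (S : Setup K q t)
include S

lemma exists_z {P : Submodule F V} (hP : P ∈ K) : ∃ A z, A ∈ bigS q K P ∧ z ∈ tanS K P ∧ z ≤ A ∧
    ∀ B ∈ bigS q K P, B ≠ A → ¬ z ≤ B := by
  have h1 := S.big_le hP
  have h2 := S.big_pos hP
  have hq := S.q_ge
  obtain h | h : (bigS q K P).card = 1 ∨ (bigS q K P).card = 2 := by omega
  · obtain ⟨A, hA⟩ := Finset.card_eq_one.1 h
    have hA' : A ∈ bigS q K P := by rw [hA]; simp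
    have hA3 := (mem_big.1 hA').2.2
    obtain ⟨z, hz, hzA⟩ := exists_tan (K := K) (N := P) (X := A) (by
      have : (1:ℤ) ≤ tanN K P A := by nlinarith
      omega)
    refine ⟨A, z, hA', hz, hzA, fun B hB hne => ?_⟩
    rw [hA, Finset.mem_singleton] at hB
    exact absurd hB hne
  · obtain ⟨A, B, hAB, hAB'⟩ := Finset.card_eq_two.1 h
    have hA : A ∈ bigS q K P := by rw [hAB']; simp
    have hB : B ∈ bigS q K P := by rw [hAB']; simp
    have hA3 := (mem_big.1 hA).2.2
    obtain ⟨-, h3⟩ := S.two_big hP hA hB hAB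
    obtain ⟨z, hz, hzA, hzB⟩ := exists_tan_diff (K := K) (N := P) (X := A) (Y := B) (by
      have : (tanN K P (A ⊓ B) : ℤ) < tanN K P A := by nlinarith
      omega)
    refine ⟨A, z, hA, hz, hzA, fun C hC hne => ?_⟩
    rw [hAB'] at hC
    simp only [Finset.mem_insert, Finset.mem_singleton] at hC
    rcases hC with rfl | rfl
    · exact absurd rfl hne
    · exact hzB

lemma card_off {z A : Submodule F V} (hz : finrank F z = 2) (hA : finrank F A = 4) (h : z ≤ A) :
    (((ext z ⊤).filter (fun X => ¬ X ≤ A)).card : ℤ) = q ^ 2 := by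
  have h1 := Finset.card_filter_add_card_filter_not (s := ext z ⊤) (fun X => X ≤ A)
  rw [ext_filter] at h1
  have h2 := S.ext2 h (by omega)
  have h3 := S.ext3 (le_top : z ≤ ⊤) (by rw [S.dimV, hz])
  omega

lemma exists_conf : ∃ P A z N, Conf K q t P A z N := by
  obtain ⟨P, hP⟩ := S.K_ne
  obtain ⟨A, z, hA, hz, hzA, only⟩ := S.exists_z hP
  have hq := S.q_ge
  obtain ⟨hPz, hzd, hzk⟩ := mem_tanS.1 hz
  have hA4 := (mem_big.1 hA).2.1
  have hC4 := S.C4 hP hz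
  have hsum : ∑ X ∈ ext z ⊤, (q + 1 - kap K X) * (q + 2 - kap K X) ≤ q * (q + 1) * (q + 1) + 2 * q ^ 2 := by
    rw [← Finset.sum_filter_add_sum_filter_not (ext z ⊤) (fun X => X ≤ A)]
    apply add_le_add
    · calc _ ≤ ∑ X ∈ (ext z ⊤).filter (fun X => X ≤ A), q * (q + 1) := by
            apply Finset.sum_le_sum
            intro X hX
            have hX' := (Finset.mem_filter.1 hX).1
            have a1 := S.w_nonneg hP hz hX'
            have a2 := S.w_le hP hz hX'
            apply mul_le_mul a2 (by omega) (by omega) (by omega)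
        _ = q * (q + 1) * (q + 1) := by
            rw [Finset.sum_const, nsmul_eq_mul, ext_filter, S.ext2 hzA (by omega)]; ring
    · calc _ ≤ ∑ X ∈ (ext z ⊤).filter (fun X => ¬ X ≤ A), 2 := by
            apply Finset.sum_le_sum
            intro X hX
            obtain ⟨hX', hXA⟩ := Finset.mem_filter.1 hX
            have a1 := S.w_nonneg hP hz hX'
            rw [mem_ext] at hX'
            have a3 := S.off_plane hP (hPz.trans hX'.1) (by omega) (by
              intro B hB hXB
              by_cases hBA : B = A
              · subst hBA; exact hXA hXB
              · exact only B hB hBA (hX'.1.trans hXB))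
            have a4 := S.big_le hP
            obtain h | h : q + 1 - (kap K X : ℤ) = 0 ∨ q + 1 - (kap K X : ℤ) = 1 := by omega
            · rw [h]; simp
            · rw [show q + 2 - (kap K X : ℤ) = 2 by omega, h]; simp
        _ = 2 * q ^ 2 := by
            have e := S.card_off hzd hA4 hzA
            rw [Finset.sum_const, nsmul_eq_mul]
            simp only [mul_comm _ (2 : ℤ)]
            congr 1
  have hPm : P ∈ ext ⊥ z := mem_ext.2 ⟨bot_le, hPz, by rw [S.pt hP, finrank_bot]⟩
  have hcard : (((ext ⊥ z).erase P).card : ℤ) = q := by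
    have a1 := S.ext2 (bot_le : ⊥ ≤ z) (by rw [finrank_bot]; omega)
    have a2 := Finset.card_erase_add_one hPm
    omega
  obtain ⟨M, hM, hMle⟩ : ∃ M ∈ (ext ⊥ z).erase P, t - tanN K M ⊤ ≤ 3 * q := by
    apply Finset.exists_le_of_sum_le (Finset.card_pos.1 (by omega))
    rw [hC4, Finset.sum_const, nsmul_eq_mul, hcard]
    nlinarith
  rw [Finset.mem_erase, mem_ext, finrank_bot] at hM
  exact ⟨P, A, z, M, hP, hA, hz, hzA, only, by omega, hM.2.2.1, S.not_mem_of_tan hP hz hM.2.2.1 hM.1, hMle⟩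

end Setup

end Geo
end CapAux

open Module

namespace CapAux
open Classical

section Geo
variable {F V : Type*} [Field F] [Fintype F] [AddCommGroup V] [Module F V] [Fintype V]
  [Fintype (Submodule F V)]
variable {K : Finset (Submodule F V)}

namespace Conf
variable {q t : ℤ} {P A z N : Submodule F V}

lemma zN (c : Conf K q t P A z N) : z ∈ tanS K N := tanS_trans c.hz c.hNz
lemma Pz (c : Conf K q t P A z N) : P ≤ z := (mem_tanS.1 c.hz).1
lemma zd (c : Conf K q t P A z N) : finrank F z = 2 := (mem_tanS.1 c.hz).2.1
lemma zk (c : Conf K q t P A z N) : kap K z = 1 := (mem_tanS.1 c.hz).2.2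
lemma Ad (c : Conf K q t P A z N) : finrank F A = 4 := (Setup.mem_big.1 c.hA).2.1

lemma off (c : Conf K q t P A z N) {X : Submodule F V} (hzX : z ≤ X) (h : ¬ X ≤ A) :
    ∀ B ∈ bigS q K P, ¬ X ≤ B := by
  intro B hB hXB
  by_cases hBA : B = A
  · subst hBA; exact h hXB
  · exact c.only B hB hBA (hzX.trans hXB)

end Conf

namespace Setup
variable {q t : ℤ} (S : Setup K q t)
include S
variable {P A z N : Submodule F V} (c : Conf K q t P A z N)
include c

lemma coff {X : Submodule F V} (hzX : z ≤ X) (hX : finrank F X = 3) (h : ¬ X ≤ A) :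
    ((kap K X : ℤ) = q ∨ (kap K X : ℤ) = q + 1) ∧ (secN K N X ≠ 0 → gg q K N X = 0) ∧
    ((bigS q K P).card = 1 → (kap K X : ℤ) = q + 1) :=
  S.off_g c.hd c.hN c.zN c.hP c.Pz hzX hX (c.off hzX h)

/-- free off planes have very negative g -/
lemma coff_free {X : Submodule F V} (hzX : z ≤ X) (hX : finrank F X = 3) (h : ¬ X ≤ A)
    (hs : secN K N X = 0) : -q ≤ gg q K N X ∧ gg q K N X ≤ -(q - 2) := by
  have h1 := S.coff c hzX hX h
  rw [S.g_free c.hd c.hN (c.hNz.trans hzX) hs]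
  omega

lemma coff_le {X : Submodule F V} (hzX : z ≤ X) (hX : finrank F X = 3) (h : ¬ X ≤ A) :
    gg q K N X ≤ 0 := by
  have := S.q_ge
  by_cases hs : secN K N X = 0
  · have := S.coff_free c hzX hX h hs
    omega
  · rw [(S.coff c hzX hX h).2.1 hs]

lemma csum : ∑ X ∈ ext z ⊤, gg q K N X = t - tanN K N ⊤ :=
  S.gsum_top c.hd c.hNz c.zd (by rw [c.zk]; omega)

lemma csumA_ge : q ^ 2 - 85 * q - 2 ≤ ∑ X ∈ ext z A, gg q K N X := by
  rw [S.gsum_solid c.hd c.hNz c.zd (by rw [c.zk]; omega) c.hzA c.Ad]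
  exact S.big_D c.hd c.hN c.hP c.hA (c.hNz.trans c.hzA)

lemma csumA_le : ∑ X ∈ ext z A, gg q K N X ≤ q ^ 2 + q := by
  calc _ ≤ ∑ X ∈ ext z A, q := by
        apply Finset.sum_le_sum
        intro X hX
        exact S.g_le_q c.hd c.hN c.zN (mem_ext.1 hX).1
    _ = q ^ 2 + q := by
        rw [Finset.sum_const, nsmul_eq_mul, S.ext2 c.hzA (by rw [c.Ad, c.zd])]; ring

omit S c in
/-- free off planes -/
noncomputable def _root_.CapAux.fo (K : Finset (Submodule F V)) (A z N : Submodule F V) : Finset (Submodule F V) :=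
  (ext z ⊤).filter (fun X => ¬ X ≤ A ∧ secN K N X = 0)

lemma csum_split : ∑ X ∈ ext z ⊤, gg q K N X = ∑ X ∈ ext z A, gg q K N X + ∑ X ∈ fo K A z N, gg q K N X := by
  rw [← Finset.sum_filter_add_sum_filter_not (ext z ⊤) (fun X => X ≤ A), ext_filter]
  congr 1
  symm
  apply Finset.sum_subset
  · intro X hX
    rw [fo, Finset.mem_filter] at hX
    exact Finset.mem_filter.2 ⟨hX.1, hX.2.1⟩
  · intro X hX hX'
    rw [Finset.mem_filter] at hX
    rw [fo, Finset.mem_filter] at hX'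
    have h1 := mem_ext.1 hX.1
    have := c.zd
    exact (S.coff c h1.1 (by omega) hX.2).2.1 (fun h => hX' ⟨hX.1, hX.2, h⟩)

lemma fo_sum : -q * (fo K A z N).card ≤ ∑ X ∈ fo K A z N, gg q K N X ∧
    ∑ X ∈ fo K A z N, gg q K N X ≤ -(q - 2) * (fo K A z N).card := by
  have h : ∀ X ∈ fo K A z N, -q ≤ gg q K N X ∧ gg q K N X ≤ -(q - 2) := by
    intro X hX
    rw [fo, Finset.mem_filter] at hX
    have h1 := mem_ext.1 hX.1
    have := c.zd
    exact S.coff_free c h1.1 (by omega) hX.2.1 hX.2.2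
  constructor
  · calc _ = ∑ X ∈ fo K A z N, -q := by rw [Finset.sum_const, nsmul_eq_mul]; ring
      _ ≤ _ := Finset.sum_le_sum (fun X hX => (h X hX).1)
  · calc _ ≤ ∑ X ∈ fo K A z N, -(q - 2) := Finset.sum_le_sum (fun X hX => (h X hX).2)
      _ = _ := by rw [Finset.sum_const, nsmul_eq_mul]; ring

lemma fo_card : 2 ≤ (fo K A z N).card ∧ ((fo K A z N).card : ℤ) ≤ q + 3 := by
  have h1 := S.csum c
  rw [S.csum_split c] at h1
  have h2 := S.csumA_ge c
  have h3 := S.csumA_le c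
  have h4 := S.fo_sum c
  have h5 := c.hD
  have h6 := S.tan_le c.hd c.hN
  have hq := S.q_ge
  constructor
  · by_contra hcon
    have : ((fo K A z N).card : ℤ) ≤ 1 := by omega
    nlinarith
  · by_contra hcon
    have : q + 4 ≤ ((fo K A z N).card : ℤ) := by omega
    nlinarith

lemma sum_b {b X₁ X₂ : Submodule F V} (hb : finrank F b = 4) (hzb : z ≤ b) (hne : A ≠ b)
    (h1 : X₁ ∈ fo K A z N) (h2 : X₂ ∈ fo K A z N) (h12 : X₁ ≠ X₂) (hb1 : X₁ ≤ b) (hb2 : X₂ ≤ b) :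
    secN K N b = 0 := by
  by_contra hs
  have hD := S.D_nonneg c.hd c.hN hb hs
  rw [← S.gsum_solid c.hd c.hNz c.zd (by rw [c.zk]; omega) hzb hb] at hD
  have hzd := c.zd
  have hq := S.q_ge
  simp only [fo, Finset.mem_filter] at h1 h2
  have e1 := mem_ext.1 h1.1
  have e2 := mem_ext.1 h2.1
  have g1 := S.coff_free c e1.1 (by omega) h1.2.1 h1.2.2
  have g2 := S.coff_free c e2.1 (by omega) h2.2.1 h2.2.2
  have key : ∑ X ∈ ext z b, gg q K N X ≤ ∑ X ∈ ext z b, ((if X = b ⊓ A then q else 0) +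
      ((if X = X₁ then -(q-2) else 0) + (if X = X₂ then -(q-2) else 0))) := by
    apply Finset.sum_le_sum
    intro X hX
    have hX' := mem_ext.1 hX
    by_cases hXA : X ≤ A
    · have hXe := S.eq_inf c.Ad hb hne hXA hX'.2.1 (by omega)
      have n1 : X ≠ X₁ := by rintro rfl; exact h1.2.1 hXA
      have n2 : X ≠ X₂ := by rintro rfl; exact h2.2.1 hXA
      rw [if_pos hXe, if_neg n1, if_neg n2]
      have := S.g_le_q c.hd c.hN c.zN hX'.1
      omega
    · have n0 : X ≠ b ⊓ A := by rintro rfl; exact hXA inf_le_right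
      rw [if_neg n0]
      by_cases n1 : X = X₁
      · subst n1
        rw [if_pos rfl, if_neg h12]; omega
      · by_cases n2 : X = X₂
        · subst n2
          rw [if_neg n1, if_pos rfl]; omega
        · rw [if_neg n1, if_neg n2]
          have := S.coff_le c hX'.1 (by omega) hXA
          omega
  rw [Finset.sum_add_distrib, Finset.sum_add_distrib, Finset.sum_ite_eq', Finset.sum_ite_eq',
    Finset.sum_ite_eq', if_pos (mem_ext.2 ⟨e1.1, hb1, e1.2.2⟩), if_pos (mem_ext.2 ⟨e2.1, hb2, e2.2.2⟩)] at key
  split_ifs at key <;> omega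

/-- planes of ext z b off A -/
lemma card_Gb {b : Submodule F V} (hb : finrank F b = 4) (hzb : z ≤ b) (hne : A ≠ b) :
    q ≤ ((ext z b).filter (fun X => ¬ X ≤ A)).card := by
  have h1 := Finset.card_filter_add_card_filter_not (s := ext z b) (fun X => X ≤ A)
  have hzd := c.zd
  have h2 := S.ext2 hzb (by omega)
  have h3 : ((ext z b).filter (fun X => X ≤ A)).card ≤ 1 := by
    rw [Finset.card_le_one]
    intro X hX Y hY
    rw [Finset.mem_filter, mem_ext] at hX hY
    rw [S.eq_inf c.Ad hb hne hX.2 hX.1.2.1 (by omega), S.eq_inf c.Ad hb hne hY.2 hY.1.2.1 (by omega)]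
  have h4 : (ext z b).filter (fun X => ¬ X ≤ A) = Finset.filter (fun X => ¬ X ≤ A) (ext z b) := rfl
  omega

lemma exists_b : ∃ b : Submodule F V, finrank F b = 4 ∧ z ≤ b ∧ A ≠ b ∧ secN K N b = 0 ∧
    ∀ X, z ≤ X → finrank F X = 3 → ¬ X ≤ A → secN K N X = 0 → X ≤ b := by
  have hzd := c.zd
  have hq := S.q_ge
  obtain ⟨f1, f2⟩ := S.fo_card c
  obtain ⟨X₁, h1, X₂, h2, h12⟩ := Finset.one_lt_card.1 (by omega : 1 < (fo K A z N).card)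
  have e1 := h1
  have e2 := h2
  simp only [fo, Finset.mem_filter, mem_ext] at e1 e2
  have key : ∀ Y ∈ fo K A z N, X₁ ≠ Y → finrank F ↥(X₁ ⊔ Y) = 4 ∧ A ≠ X₁ ⊔ Y ∧ secN K N (X₁ ⊔ Y) = 0 := by
    intro Y hY hne
    have eY := hY
    simp only [fo, Finset.mem_filter, mem_ext] at eY
    have d := two_planes (X := X₁) (Y := Y) (z := z) (by omega) (by omega) hzd e1.1.1 eY.1.1 hne
    have hA : A ≠ X₁ ⊔ Y := by
      intro h; apply e1.2.1; rw [h]; exact le_sup_left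
    exact ⟨d, hA, S.sum_b c d (e1.1.1.trans le_sup_left) hA h1 hY hne le_sup_left le_sup_right⟩
  obtain ⟨k1, k2, k3⟩ := key X₂ h2 h12
  refine ⟨X₁ ⊔ X₂, k1, e1.1.1.trans le_sup_left, k2, k3, ?_⟩
  intro X hzX hX hXA hs
  by_contra hXb
  have hXf : X ∈ fo K A z N := by
    simp only [fo, Finset.mem_filter, mem_ext]
    exact ⟨⟨hzX, le_top, by omega⟩, hXA, hs⟩
  have hX1 : X₁ ≠ X := by rintro rfl; exact hXb le_sup_left
  obtain ⟨l1, l2, l3⟩ := key X hXf hX1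
  set b := X₁ ⊔ X₂ with hb
  set b' := X₁ ⊔ X with hb'
  have hbb : b' ≠ b := by
    intro h; apply hXb; rw [← h]; exact le_sup_right
  have hzb : z ≤ b := e1.1.1.trans le_sup_left
  have hzb' : z ≤ b' := e1.1.1.trans le_sup_left
  have c1 := S.card_Gb c k1 hzb k2
  have c2 := S.card_Gb c l1 hzb' l2
  have u := Finset.card_union_add_card_inter ((ext z b).filter (fun X => ¬ X ≤ A)) ((ext z b').filter (fun X => ¬ X ≤ A))
  have u1 : (((ext z b).filter (fun X => ¬ X ≤ A)) ∪ ((ext z b').filter (fun X => ¬ X ≤ A))).card ≤ (fo K A z N).card := by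
    apply Finset.card_le_card
    intro Y hY
    simp only [Finset.mem_union, Finset.mem_filter, mem_ext] at hY
    simp only [fo, Finset.mem_filter, mem_ext]
    rcases hY with h | h
    · have := sec_mono (K := K) (N := N) h.1.2.1
      exact ⟨⟨h.1.1, le_top, h.1.2.2⟩, h.2, by omega⟩
    · have := sec_mono (K := K) (N := N) h.1.2.1
      exact ⟨⟨h.1.1, le_top, h.1.2.2⟩, h.2, by omega⟩
  have u2 : (((ext z b).filter (fun X => ¬ X ≤ A)) ∩ ((ext z b').filter (fun X => ¬ X ≤ A))).card ≤ 1 := by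
    rw [Finset.card_le_one]
    intro Y hY Z hZ
    simp only [Finset.mem_inter, Finset.mem_filter, mem_ext] at hY hZ
    rw [S.eq_inf l1 k1 hbb hY.2.1.2.1 hY.1.1.2.1 (by omega), S.eq_inf l1 k1 hbb hZ.2.1.2.1 hZ.1.1.2.1 (by omega)]
  omega

end Setup

end Geo
end CapAux

open Module

namespace CapAux
open Classical

section Geo
variable {F V : Type*} [Field F] [Fintype F] [AddCommGroup V] [Module F V] [Fintype V]
  [Fintype (Submodule F V)]
variable {K : Finset (Submodule F V)}

/-- the free solid -/
structure ConfB (K : Finset (Submodule F V)) (A z N b : Submodule F V) : Prop where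
  hb : finrank F b = 4
  hzb : z ≤ b
  hne : A ≠ b
  free : secN K N b = 0
  all : ∀ X, z ≤ X → finrank F X = 3 → ¬ X ≤ A → secN K N X = 0 → X ≤ b

namespace Setup
variable {q t : ℤ} (S : Setup K q t)
include S
variable {P A z N b : Submodule F V} (c : Conf K q t P A z N) (d : ConfB K A z N b)

omit S in
lemma free_mono {X Y : Submodule F V} (h : X ≤ Y) (hY : secN K N Y = 0) : secN K N X = 0 := by
  have := sec_mono (K := K) (N := N) h
  omega

include d


include c

lemma cross {G : Submodule F V} (hd4 : finrank F G = 4) (hz : z ≤ G) (hA : A ≠ G) (hb : b ≠ G)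
    (h0 : ¬ b ⊓ A ≤ G) :
    finrank F ↥(G ⊓ A) = 3 ∧ finrank F ↥(G ⊓ b) = 3 ∧ G ⊓ A ≠ G ⊓ b ∧
    ((kap K (G ⊓ b) : ℤ) = q ∨ (kap K (G ⊓ b) : ℤ) = q + 1) ∧
    secN K N (G ⊓ b) = 0 ∧
    (∀ X ∈ ext z G, X ≠ G ⊓ A → X ≠ G ⊓ b → tanN K N X ≤ 2) ∧
    tanN K N (G ⊓ A) ≤ 2 ∧
    (DD q K N G = 0 ∨ (DD q K N G = 2 ∧ (kap K (G ⊓ b) : ℤ) = q)) := by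
  have hzd := c.zd
  have hb4 := d.hb
  have hA4 := c.Ad
  have hq := S.q_ge
  have d1 := S.dim_inf_solid c.Ad (S.solid_not_le hd4 c.Ad hA.symm)
  have d2 := S.dim_inf_solid d.hb (S.solid_not_le hd4 d.hb hb.symm)
  have hne : G ⊓ A ≠ G ⊓ b := by
    intro h
    apply h0
    have e : G ⊓ A ≤ b := by rw [h]; exact inf_le_right
    have e2 := S.eq_inf c.Ad d.hb d.hne (X := G ⊓ A) inf_le_right e (by omega)
    rw [← e2]; exact inf_le_left
  have hLA : ¬ G ⊓ b ≤ A := by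
    intro h
    exact hne (S.eq_inf c.Ad hd4 hA h inf_le_left (by omega)).symm
  have hzL : z ≤ G ⊓ b := le_inf hz d.hzb
  have hzh : z ≤ G ⊓ A := le_inf hz c.hzA
  have fL : secN K N (G ⊓ b) = 0 := free_mono inf_le_right d.free
  have kL := (S.coff c hzL (by omega) hLA).1
  have gL := S.g_free c.hd c.hN (c.hNz.trans hzL) fL
  have oth : ∀ X ∈ ext z G, X ≠ G ⊓ A → X ≠ G ⊓ b → gg q K N X = 0 ∧ secN K N X ≠ 0 ∧ tanN K N X ≤ 2 := by
    intro X hX n1 n2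
    rw [mem_ext] at hX
    have hXA : ¬ X ≤ A := fun h => n1 (S.eq_inf c.Ad hd4 hA h hX.2.1 (by omega))
    have hXb : ¬ X ≤ b := fun h => n2 (S.eq_inf d.hb hd4 hb h hX.2.1 (by omega))
    have hs : secN K N X ≠ 0 := fun h => hXb (d.all X hX.1 (by omega) hXA h)
    have a1 := S.coff c hX.1 (by omega) hXA
    have a2 := a1.2.1 hs
    refine ⟨a2, hs, ?_⟩
    unfold gg at a2
    omega
  have sD : DD q K N G = gg q K N (G ⊓ A) + gg q K N (G ⊓ b) := by
    rw [← S.gsum_solid c.hd c.hNz c.zd (by rw [c.zk]; omega) hz hd4]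
    rw [← Finset.sum_pair hne]
    symm
    apply Finset.sum_subset
    · intro X hX
      simp only [Finset.mem_insert, Finset.mem_singleton] at hX
      rcases hX with rfl | rfl
      · exact mem_ext.2 ⟨hzh, inf_le_left, by omega⟩
      · exact mem_ext.2 ⟨hzL, inf_le_left, by omega⟩
    · intro X hX hX'
      simp only [Finset.mem_insert, Finset.mem_singleton, not_or] at hX'
      exact (oth X hX hX'.1 hX'.2).1
  have hsG : secN K N G ≠ 0 := by
    obtain ⟨X, hX, n1⟩ : ∃ X ∈ ext z G, X ∉ ({G ⊓ A, G ⊓ b} : Finset (Submodule F V)) := by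
      apply Finset.exists_mem_notMem_of_card_lt_card
      have := S.ext2 hz (by omega)
      have h2 := Finset.card_le_two (a := G ⊓ A) (b := G ⊓ b)
      omega
    simp only [Finset.mem_insert, Finset.mem_singleton, not_or] at n1
    intro h
    exact (oth X hX n1.1 n1.2).2.1 (free_mono (mem_ext.1 hX).2.1 h)
  have hD0 := S.D_nonneg c.hd c.hN hd4 hsG
  have gh := S.g_le_q c.hd c.hN c.zN hzh
  obtain ⟨r, hr⟩ := S.g_even c.hd c.hN (c.hNz.trans hzh)
  obtain ⟨r', hr'⟩ := S.q_even
  have hTk := S.tan_le_kap c.hd c.hN (c.hNz.trans hzh)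
  have hgh : gg q K N (G ⊓ A) = q + 2 - kap K (G ⊓ A) - tanN K N (G ⊓ A) := rfl
  refine ⟨by omega, by omega, hne, kL, fL, fun X hX n1 n2 => (oth X hX n1 n2).2.2, by omega, by omega⟩

/-- case of one big solid -/
lemma C8a (h1 : (bigS q K P).card = 1) : False := by
  have hzd := c.zd
  have hb4 := d.hb
  have hA4 := c.Ad
  have hq := S.q_ge
  have hdim := S.dim_inf_solid c.Ad (S.solid_not_le d.hb c.Ad d.hne.symm)
  have hzh : z ≤ b ⊓ A := le_inf d.hzb c.hzA
  have fh := free_mono (K := K) (N := N) (inf_le_left : b ⊓ A ≤ b) d.free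
  have gh0 := S.g_free c.hd c.hN (c.hNz.trans hzh) fh
  have kL : ∀ X ∈ ext z b, X ≠ b ⊓ A → (kap K X : ℤ) = q + 1 := by
    intro X hX hne
    rw [mem_ext] at hX
    exact (S.coff c hX.1 (by omega) (fun h => hne (S.eq_inf c.Ad d.hb d.hne h hX.2.1 (by omega)))).2.2 h1
  have hmem : b ⊓ A ∈ ext z b := mem_ext.2 ⟨hzh, inf_le_left, by omega⟩
  have cardb : (((ext z b).erase (b ⊓ A)).card : ℤ) = q := by
    have a1 := S.ext2 d.hzb (by rw [d.hb, hzd])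
    have a2 := Finset.card_erase_add_one hmem
    omega
  have hmemA : b ⊓ A ∈ ext z A := mem_ext.2 ⟨hzh, inf_le_right, by omega⟩
  have cardA : (((ext z A).erase (b ⊓ A)).card : ℤ) = q := by
    have a1 := S.ext2 c.hzA (by rw [c.Ad, hzd])
    have a2 := Finset.card_erase_add_one hmemA
    omega
  have kb : (kap K b : ℤ) = kap K (b ⊓ A) + q ^ 2 := by
    have a := kap_part S.cap d.hzb
    rw [← Finset.add_sum_erase _ _ hmem, Finset.sum_congr rfl (g := fun _ => q), Finset.sum_const,
      nsmul_eq_mul, cardb] at a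
    · rw [c.zk] at a; linarith
    · intro X hX
      rw [Finset.mem_erase] at hX
      rw [kL X hX.2 hX.1, c.zk]; push_cast; ring
  have foe : fo K A z N = (ext z b).erase (b ⊓ A) := by
    ext X
    simp only [fo, Finset.mem_filter, Finset.mem_erase, mem_ext, le_top, true_and]
    constructor
    · rintro ⟨⟨a1, a2⟩, a3, a4⟩
      exact ⟨by rintro rfl; exact a3 inf_le_right, a1, d.all X a1 (by omega) a3 a4, a2⟩
    · rintro ⟨a1, a2, a3, a4⟩
      exact ⟨⟨a2, a4⟩, fun h => a1 (S.eq_inf c.Ad d.hb d.hne h a3 (by omega)), free_mono a3 d.free⟩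
  have hk0 : 2 * (kap K (b ⊓ A) : ℤ) ≤ q + 2 := by
    have a1 := S.csum c
    have a2 := S.tan_le c.hd c.hN
    rw [S.csum_split c, foe, ← Finset.add_sum_erase _ _ hmemA] at a1
    have a3 : ∑ X ∈ (ext z b).erase (b ⊓ A), gg q K N X = -q ^ 2 := by
      rw [Finset.sum_congr rfl (g := fun _ => -q), Finset.sum_const, nsmul_eq_mul, cardb]
      · ring
      · intro X hX
        rw [Finset.mem_erase] at hX
        have hX' := mem_ext.1 hX.2
        rw [S.g_free c.hd c.hN (c.hNz.trans hX'.1) (free_mono hX'.2.1 d.free), kL X hX.2 hX.1]; ring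
    have a4 : ∑ X ∈ (ext z A).erase (b ⊓ A), gg q K N X ≤ q ^ 2 := by
      calc _ ≤ ∑ X ∈ (ext z A).erase (b ⊓ A), q := by
            apply Finset.sum_le_sum
            intro X hX
            exact S.g_le_q c.hd c.hN c.zN (mem_ext.1 (Finset.mem_of_mem_erase hX)).1
        _ = q ^ 2 := by rw [Finset.sum_const, nsmul_eq_mul, cardA]; ring
    linarith
  have line2 : ∀ u, N ≤ u → finrank F u = 2 → u ≤ b → kap K u ≠ 2 := by
    intro u a1 a2 a3 a4
    exact S.sec_ne a1 a2 a4 a3 d.free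
  -- zero line
  obtain ⟨y, hNy, hyd, hyh, hyk⟩ : ∃ y, N ≤ y ∧ finrank F y = 2 ∧ y ≤ b ⊓ A ∧ kap K y = 0 := by
    have a1 := S.ext2 (c.hNz.trans hzh) (by rw [c.hd]; omega)
    have a2 := S.kap_free c.hd c.hN (c.hNz.trans hzh) fh
    rw [tanN_eq c.hd] at a2
    obtain ⟨y, hy, hy'⟩ := Finset.exists_mem_notMem_of_card_lt_card
      (s := (ext N (b ⊓ A)).filter (fun l => kap K l = 1)) (t := ext N (b ⊓ A)) (by omega)
    rw [Finset.mem_filter, not_and] at hy'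
    have e := mem_ext.1 hy
    have := c.hd
    have a5 := S.cap.line y (by omega)
    have a6 := line2 y e.1 (by omega) (e.2.1.trans inf_le_left)
    have a7 := hy' hy
    exact ⟨y, e.1, by omega, e.2.1, by omega⟩
  have hyb : y ≤ b := hyh.trans inf_le_left
  have key : ∀ X ∈ ext y b, 2 * (kap K X : ℤ) ≤ q + 2 := by
    intro X hX
    rw [mem_ext] at hX
    by_cases hX0 : kap K X = 0
    · rw [hX0]; push_cast; omega
    obtain ⟨R, hR, hRX⟩ := exists_pt hX0
    have hNR : N ≠ R := by rintro rfl; exact c.hN hR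
    have hvd := pt_sup_dim c.hd (S.pt hR) hNR
    set v := N ⊔ R with hv
    have hvX : v ≤ X := sup_le (hNy.trans hX.1) hRX
    have hvb : v ≤ b := hvX.trans hX.2.1
    have hRv : R ≤ v := le_sup_right
    have hNv : N ≤ v := le_sup_left
    have hvk : kap K v = 1 := by
      have b1 := kap_mono (K := K) hRv
      rw [S.kapP hR] at b1
      have b2 := S.cap.line v hvd
      have b3 := line2 v hNv hvd hvb
      omega
    have hvN : v ∈ tanS K N := mem_tanS.2 ⟨hNv, hvd, hvk⟩
    have hR1 : (bigS q K R).card = 1 := (S.big_one_iff hR).2 ((S.big_one_iff c.hP).1 h1)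
    obtain ⟨A', hA'⟩ := Finset.card_eq_one.1 hR1
    have hA'm : A' ∈ bigS q K R := by rw [hA']; simp
    have hA'd := (mem_big.1 hA'm).2.1
    have hbA' : A' ≠ b := by
      rintro rfl
      have := S.big_kap hR hA'm
      nlinarith
    have offk : ∀ Y, v ≤ Y → finrank F Y = 3 → ¬ Y ≤ A' → (kap K Y : ℤ) = q + 1 := by
      intro Y b1 b2 b3
      refine (S.off_g c.hd c.hN hvN hR hRv b1 b2 ?_).2.2 hR1
      intro B hB
      rw [hA', Finset.mem_singleton] at hB
      rw [hB]; exact b3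
    have hvA' : v ≤ A' := by
      obtain ⟨H, hH, hvH⟩ := S.big_cover hR (tanS_trans hvN hRv)
      rw [hA', Finset.mem_singleton] at hH
      rw [← hH]; exact hvH
    have hdimA' := S.dim_inf_solid hA'd (S.solid_not_le d.hb hA'd hbA'.symm)
    have hm' : b ⊓ A' ∈ ext v b := mem_ext.2 ⟨le_inf hvb hvA', inf_le_left, by rw [hvd]; have := d.hb; omega⟩
    have cardv : (((ext v b).erase (b ⊓ A')).card : ℤ) = q := by
      have a1 := S.ext2 hvb (by rw [d.hb, hvd])
      have a2 := Finset.card_erase_add_one hm'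
      omega
    have kA' : (kap K b : ℤ) = kap K (b ⊓ A') + q ^ 2 := by
      have a := kap_part S.cap hvb
      rw [← Finset.add_sum_erase _ _ hm', Finset.sum_congr rfl (g := fun _ => q), Finset.sum_const,
        nsmul_eq_mul, cardv] at a
      · rw [hvk] at a; linarith
      · intro Y hY
        rw [Finset.mem_erase, mem_ext] at hY
        rw [offk Y hY.2.1 (by omega) (fun h => hY.1 (S.eq_inf hA'd d.hb hbA' h hY.2.2.1 (by omega))), hvk]
        push_cast; ring
    have hX3 : finrank F X = 3 := by omega
    have hNX : N ≤ X := hNv.trans hvX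
    have hXk : (kap K X : ℤ) ≤ q := by
      rw [S.kap_free c.hd c.hN hNX (free_mono hX.2.1 d.free), tanN_eq c.hd]
      have a1 := S.ext2 hNX (by rw [c.hd]; omega)
      have a2 : ((ext N X).filter (fun l => kap K l = 1)).card < (ext N X).card := by
        apply Finset.card_lt_card
        refine Finset.filter_ssubset.2 ⟨y, mem_ext.2 ⟨hNy, hX.1, by rw [c.hd, hyd]⟩, by omega⟩
      omega
    have hXA' : X ≤ A' := by
      by_contra h
      have := offk X hvX hX3 h
      omega
    have := S.eq_inf hA'd d.hb hbA' hXA' hX.2.1 hX3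
    rw [← this] at kA'
    omega
  have hfin := kap_part S.cap hyb
  rw [hyk] at hfin
  have hle : ∑ X ∈ ext y b, 2 * ((kap K X : ℤ) - (0 : ℕ)) ≤ ∑ X ∈ ext y b, (q + 2) := by
    apply Finset.sum_le_sum
    intro X hX
    have := key X hX
    push_cast; omega
  rw [← Finset.mul_sum, hfin, Finset.sum_const, nsmul_eq_mul, S.ext2 hyb (by rw [d.hb, hyd])] at hle
  push_cast at hle
  nlinarith

end Setup

end Geo
end CapAux

open Module

namespace CapAux
open Classical

section Geo
variable {F V : Type*} [Field F] [Fintype F] [AddCommGroup V] [Module F V] [Fintype V]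
  [Fintype (Submodule F V)]
variable {K : Finset (Submodule F V)}

/-- the final configuration in a solid -/
structure FinC (K : Finset (Submodule F V)) (q : ℤ) (N G L L' : Submodule F V) : Prop where
  hd : finrank F N = 1
  hN : N ∉ K
  hG : finrank F G = 4
  hL : finrank F L = 3
  hL' : finrank F L' = 3
  NL : N ≤ L
  NL' : N ≤ L'
  LG : L ≤ G
  LG' : L' ≤ G
  ne : L ≠ L'
  fL : secN K N L = 0
  fL' : secN K N L' = 0
  kL : (kap K L : ℤ) = q ∨ (kap K L : ℤ) = q + 1
  kL' : (kap K L' : ℤ) = q ∨ (kap K L' : ℤ) = q + 1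
  small : ∀ X, N ≤ X → X ≤ G → finrank F X = 3 → X ≠ L → X ≠ L' → tanN K N X ≤ 4
  kG : 43 * q + 2 < (kap K G : ℤ)
  hD : DD q K N G = 0 ∨ (DD q K N G = 2 ∧ (kap K L : ℤ) = q)

lemma FinC.symm {q : ℤ} {N G L L' : Submodule F V} (f : FinC K q N G L L') (h : DD q K N G = 0) :
    FinC K q N G L' L :=
  ⟨f.hd, f.hN, f.hG, f.hL', f.hL, f.NL', f.NL, f.LG', f.LG, f.ne.symm, f.fL', f.fL, f.kL', f.kL,
    fun X a b c d e => f.small X a b c e d, f.kG, Or.inl h⟩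

/-- two distinct planes in a solid meet in a line -/
lemma planes_inf {X Y G : Submodule F V} (hG : finrank F G = 4) (hX : finrank F X = 3) (hY : finrank F Y = 3)
    (hXG : X ≤ G) (hYG : Y ≤ G) (hne : X ≠ Y) : finrank F ↥(X ⊓ Y) = 2 := by
  have h1 := dim_add X Y
  have h2 := dim_mono (sup_le hXG hYG)
  have h3 : finrank F ↥(X ⊔ Y) ≠ 3 := by
    intro h
    have a1 := eq_of_le_dim (le_sup_left : X ≤ X ⊔ Y) (by omega)
    have a2 := eq_of_le_dim (le_sup_right : Y ≤ X ⊔ Y) (by omega)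
    exact hne (a1.trans a2.symm)
  have h4 := dim_mono (le_sup_left : X ≤ X ⊔ Y)
  omega

/-- a plane through two distinct lines is their span -/
lemma plane_span {l l' N X : Submodule F V} (hl : finrank F l = 2) (hl' : finrank F l' = 2)
    (hN : finrank F N = 1) (h1 : N ≤ l) (h3 : N ≤ l') (hne : l ≠ l') (hX : finrank F X = 3)
    (hlX : l ≤ X) (hlX' : l' ≤ X) : l ⊔ l' = X := by
  have := Setup.two_lines hl hl' hN h1 h3 hne
  exact eq_of_le_dim (sup_le hlX hlX') (by omega)

namespace Setup
variable {q t : ℤ} (S : Setup K q t)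
include S
variable {N G L L' : Submodule F V} (f : FinC K q N G L L')
include f

lemma fg_ge {X : Submodule F V} (h1 : N ≤ X) (h2 : X ≤ G) (h3 : finrank F X = 3) (h4 : X ≠ L) (h5 : X ≠ L') :
    0 ≤ gg q K N X ∧ (secN K N X = 0 → q - 6 ≤ gg q K N X) := by
  have hq := S.q_ge
  have hs := f.small X h1 h2 h3 h4 h5
  have key : secN K N X = 0 → q - 6 ≤ gg q K N X := by
    intro h
    have a := S.kap_free f.hd f.hN h1 h
    rw [S.g_free f.hd f.hN h1 h]
    omega
  refine ⟨?_, key⟩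
  by_cases h : secN K N X = 0
  · have := key h; omega
  · exact S.g_nonneg f.hd f.hN h1 h3 h

lemma claimI (hI : DD q K N G - gg q K N L = q) {z X : Submodule F V} (hz : z ∈ tanS K N) (hzL : z ≤ L)
    (hzL' : ¬ z ≤ L') (hX : X ∈ ext z G) (hXL : X ≠ L) (hT : 2 ≤ tanN K N X) : gg q K N X = 0 := by
  have hq := S.q_ge
  by_contra hg
  obtain ⟨hNz, hzd, hzk⟩ := mem_tanS.1 hz
  have hLd := f.hL
  have hGd := f.hG
  have hLm : L ∈ ext z G := mem_ext.2 ⟨hzL, f.LG, by omega⟩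
  have hsum : ∑ Y ∈ (ext z G).erase L, gg q K N Y = q := by
    have a := S.gsum_solid f.hd hNz hzd (by omega) (hzL.trans f.LG) f.hG
    rw [← Finset.add_sum_erase _ _ hLm] at a
    linarith
  have hXm : X ∈ (ext z G).erase L := Finset.mem_erase.2 ⟨hXL, hX⟩
  have ge : ∀ Y ∈ (ext z G).erase L, 0 ≤ gg q K N Y ∧ (secN K N Y = 0 → q - 6 ≤ gg q K N Y) ∧ tanN K N Y ≤ 4 := by
    intro Y hY
    rw [Finset.mem_erase, mem_ext] at hY
    have n : Y ≠ L' := by rintro rfl; exact hzL' hY.2.1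
    have := S.fg_ge f (hNz.trans hY.2.1) hY.2.2.1 (by omega) hY.1 n
    exact ⟨this.1, this.2, f.small Y (hNz.trans hY.2.1) hY.2.2.1 (by omega) hY.1 n⟩
  have hX' := mem_ext.1 hX
  have hle : gg q K N X ≤ q - 2 := by
    have a := S.tan_le_kap f.hd f.hN (hNz.trans hX'.1)
    unfold gg; omega
  obtain ⟨X1, hX1m, hX1g⟩ : ∃ Y ∈ ((ext z G).erase L).erase X, gg q K N Y ≠ 0 := by
    apply Finset.exists_ne_zero_of_sum_ne_zero
    have := Finset.add_sum_erase _ (fun Y => gg q K N Y) hXm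
    omega
  have hsum2 : gg q K N X + gg q K N X1 ≤ q := by
    have a := Finset.add_sum_erase _ (fun Y => gg q K N Y) hXm
    have b := Finset.single_le_sum (f := fun Y => gg q K N Y) (fun Y hY => (ge Y (Finset.mem_of_mem_erase hY)).1) hX1m
    omega
  obtain ⟨hX1X, hX1m'⟩ := Finset.mem_erase.1 hX1m
  have hX1' := mem_ext.1 (Finset.mem_erase.1 hX1m').2
  have gX := ge X hXm
  have gX1 := ge X1 hX1m'
  rcases f.hD with hD | ⟨hD, hkL⟩
  · have fr : ∀ Y ∈ (ext z G).erase L, gg q K N Y ≠ 0 → q - 6 ≤ gg q K N Y := by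
      intro Y hY hne
      have gY := ge Y hY
      apply gY.2.1
      by_contra hs
      have hY' := mem_ext.1 (Finset.mem_of_mem_erase hY)
      have := S.g_le_D f.hd f.hN f.hG (by omega) hY'.2.1 hs
      omega
    have a := fr X hXm hg
    have b := fr X1 hX1m' hX1g
    omega
  · obtain ⟨R, hR, hRz⟩ := exists_pt (K := K) (W := z) (by omega)
    have on : ∀ Y ∈ (ext z G).erase L, gg q K N Y ≠ 0 → ∃ B ∈ bigS q K R, Y ≤ B := by
      intro Y hY hne
      by_contra! hoff
      have hY' := mem_ext.1 (Finset.mem_of_mem_erase hY)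
      have gY := ge Y hY
      have a := S.off_g f.hd f.hN hz hR hRz hY'.1 (by omega) hoff
      by_cases hs : secN K N Y = 0
      · have := S.kap_free f.hd f.hN (hNz.trans hY'.1) hs
        omega
      · exact hne (a.2.1 hs)
    have notL : ∀ Y ∈ (ext z G).erase L, ∀ B ∈ bigS q K R, Y ≤ B → Y = G ⊓ B ∧ ¬ L ≤ B := by
      intro Y hY B hB hYB
      have hY' := mem_ext.1 (Finset.mem_of_mem_erase hY)
      have hBd := (mem_big.1 hB).2.1
      have hBG : B ≠ G := by
        rintro rfl
        have := S.big_kap hR hB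
        have := f.kG
        omega
      have e := S.eq_inf hBd hGd hBG hYB hY'.2.1 (by omega)
      refine ⟨e, fun h => ?_⟩
      have e' := S.eq_inf hBd hGd hBG h f.LG hLd
      exact (Finset.mem_erase.1 hY).1 (e.trans e'.symm)
    obtain ⟨A1, hA1, hXA1⟩ := on X hXm hg
    obtain ⟨A2, hA2, hXA2⟩ := on X1 hX1m' hX1g
    obtain ⟨e1, n1⟩ := notL X hXm A1 hA1 hXA1
    obtain ⟨e2, n2⟩ := notL X1 hX1m' A2 hA2 hXA2
    have hA12 : A1 ≠ A2 := by
      rintro rfl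
      exact hX1X (e2.trans e1.symm)
    have hbig := S.big_le hR
    have hall : ∀ B ∈ bigS q K R, B = A1 ∨ B = A2 := by
      intro B hB
      by_contra! hn
      have : 2 < (bigS q K R).card :=
        Finset.two_lt_card_iff.2 ⟨A1, A2, B, hA1, hA2, hB, hA12, hn.1.symm, hn.2.symm⟩
      omega
    have hRL := hRz.trans hzL
    have hT2 := S.tan_plane hR hRL hLd
    have hzR := tanS_trans hz hRz
    obtain ⟨l, hl, hlz⟩ := Finset.exists_mem_ne (s := (tanS K R).filter (fun s => id s ≤ L)) (by
      have : tanN K R L = ((tanS K R).filter (fun s => id s ≤ L)).card := rfl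
      omega) z
    rw [Finset.mem_filter] at hl
    obtain ⟨H, hH, hlH⟩ := S.big_cover hR hl.1
    have hl' := mem_tanS.1 hl.1
    have hsp := plane_span hl'.2.1 hzd (S.pt hR) hl'.1 hRz hlz hLd hl.2 hzL
    rcases hall H hH with rfl | rfl
    · exact n1 (hsp ▸ sup_le hlH (hX'.1.trans hXA1))
    · exact n2 (hsp ▸ sup_le hlH (hX1'.1.trans hXA2))

lemma zero_uniq {y y' : Submodule F V} (h1 : N ≤ y) (h2 : finrank F y = 2) (h3 : y ≤ L) (h4 : kap K y = 0)
    (h1' : N ≤ y') (h2' : finrank F y' = 2) (h3' : y' ≤ L) (h4' : kap K y' = 0) : y = y' := by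
  by_contra hne
  have hd := f.hd
  have hL := f.hL
  have a1 := S.ext2 f.NL (by omega)
  have a2 := S.kap_free f.hd f.hN f.NL f.fL
  rw [tanN_eq f.hd] at a2
  have a3 := f.kL
  have sub : (ext N L).filter (fun l => kap K l = 1) ⊆ ((ext N L).erase y).erase y' := by
    intro l hl
    rw [Finset.mem_filter] at hl
    rw [Finset.mem_erase, Finset.mem_erase]
    refine ⟨?_, ?_, hl.1⟩
    · rintro rfl; omega
    · rintro rfl; omega
  have m1 : y ∈ ext N L := mem_ext.2 ⟨h1, h3, by omega⟩
  have m2 : y' ∈ (ext N L).erase y := Finset.mem_erase.2 ⟨fun h => hne h.symm, mem_ext.2 ⟨h1', h3', by omega⟩⟩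
  have b1 := Finset.card_le_card sub
  have b2 := Finset.card_erase_add_one m1
  have b3 := Finset.card_erase_add_one m2
  omega

lemma fL_line {u : Submodule F V} (h1 : N ≤ u) (h2 : finrank F u = 2) (h3 : u ≤ L) : kap K u = 0 ∨ kap K u = 1 := by
  have a := S.cap.line u h2
  have b : kap K u ≠ 2 := fun h => S.sec_ne h1 h2 h h3 f.fL
  omega

lemma tan_inf_le {X Y : Submodule F V} (hX : finrank F X = 3) (hY : finrank F Y = 3) (hXG : X ≤ G) (hYG : Y ≤ G)
    (hNX : N ≤ X) (hNY : N ≤ Y) (hne : X ≠ Y) : tanN K N (X ⊓ Y) ≤ 1 := by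
  rw [tan_line f.hd (planes_inf f.hG hX hY hXG hYG hne) (le_inf hNX hNY)]
  split_ifs <;> omega

lemma caseI_step (hI : DD q K N G - gg q K N L = q) {z : Submodule F V} (hz : z ∈ tanS K N) (hzL' : z ≤ L')
    (hzL : ¬ z ≤ L) : ∃ y, N ≤ y ∧ finrank F y = 2 ∧ y ≤ L ∧ kap K y = 0 ∧ ¬ y ≤ L' ∧ q - 2 ≤ gg q K N (z ⊔ y) := by
  have hq := S.q_ge
  obtain ⟨hNz, hzd, hzk⟩ := mem_tanS.1 hz
  have hLd := f.hL
  have hLd' := f.hL'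
  have hGd := f.hG
  have hLm : L' ∈ ext z G := mem_ext.2 ⟨hzL', f.LG', by omega⟩
  have hgL' : gg q K N L' ≤ -(q - 2) := by
    rw [S.g_free f.hd f.hN f.NL' f.fL']
    have := f.kL'
    omega
  have hsum : q - 2 ≤ ∑ Y ∈ (ext z G).erase L', gg q K N Y := by
    have a := S.gsum_solid f.hd hNz hzd (by omega) (hzL'.trans f.LG') f.hG
    rw [← Finset.add_sum_erase _ _ hLm] at a
    have := f.hD
    omega
  have key : ∀ X ∈ (ext z G).erase L', gg q K N X ≠ 0 → ∃ y, N ≤ y ∧ finrank F y = 2 ∧ y ≤ L ∧ kap K y = 0 ∧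
      ¬ y ≤ L' ∧ z ⊔ y = X := by
    intro X hX hg
    rw [Finset.mem_erase, mem_ext] at hX
    obtain ⟨hXL', hzX, hXG, hXd⟩ := hX
    have hXL : X ≠ L := by rintro rfl; exact hzL hzX
    have hud := planes_inf hGd (by omega) hLd hXG f.LG hXL
    have hNu : N ≤ X ⊓ L := le_inf (hNz.trans hzX) f.NL
    have huz : z ≠ X ⊓ L := by
      intro h; apply hzL; rw [h]; exact inf_le_right
    have hsp := plane_span hzd hud f.hd hNz hNu huz (by omega) hzX inf_le_left
    have huL' : ¬ X ⊓ L ≤ L' := by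
      intro h
      apply hXL'
      rw [← hsp]
      exact plane_span hzd hud f.hd hNz hNu huz (by omega) hzL' h
    refine ⟨X ⊓ L, hNu, hud, inf_le_right, ?_, huL', hsp⟩
    rcases S.fL_line f hNu hud inf_le_right with h | h
    · exact h
    · exfalso
      have hu : X ⊓ L ∈ tanS K N := mem_tanS.2 ⟨hNu, hud, h⟩
      exact hg (S.claimI f hI hu inf_le_right huL' (mem_ext.2 ⟨inf_le_left, hXG, by omega⟩) hXL
        (tan_two hz hu huz hzX inf_le_left))
  obtain ⟨X, hX, hXg⟩ := Finset.exists_ne_zero_of_sum_ne_zero (by omega : ∑ Y ∈ (ext z G).erase L', gg q K N Y ≠ 0)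
  obtain ⟨y, y1, y2, y3, y4, y5, y6⟩ := key X hX hXg
  refine ⟨y, y1, y2, y3, y4, y5, ?_⟩
  rw [Finset.sum_eq_single_of_mem X hX] at hsum
  · rw [y6]; exact hsum
  · intro X' hX' hne
    by_contra hg'
    obtain ⟨y', w1, w2, w3, w4, w5, w6⟩ := key X' hX' hg'
    have := S.zero_uniq f y1 y2 y3 y4 w1 w2 w3 w4
    subst this
    exact hne (w6.symm.trans y6)

lemma caseI (hI : DD q K N G - gg q K N L = q) : False := by
  have hq := S.q_ge
  have hLd := f.hL
  have hLd' := f.hL'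
  have hGd := f.hG
  set Z := (tanS K N).filter (fun l => l ≤ L' ∧ ¬ l ≤ L) with hZ
  have hZc : q - 1 ≤ (Z.card : ℤ) := by
    have a := cnt_split id (tanS K N) (inf_le_left : L' ⊓ L ≤ L')
    have b := S.tan_inf_le f hLd' hLd f.LG' f.LG f.NL' f.NL f.ne.symm
    have k := S.kap_free f.hd f.hN f.NL' f.fL'
    have k' := f.kL'
    have e : (tanS K N).filter (fun s => id s ≤ L' ∧ ¬ id s ≤ L' ⊓ L) = Z := by
      ext s
      simp only [hZ, Finset.mem_filter, id, le_inf_iff]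
      tauto
    rw [e] at a
    unfold tanN at *
    omega
  obtain ⟨z0, hz0⟩ := Finset.card_pos.1 (by omega : 0 < Z.card)
  rw [hZ, Finset.mem_filter] at hz0
  obtain ⟨y, y1, y2, y3, y4, y5, y6⟩ := S.caseI_step f hI hz0.1 hz0.2.1 hz0.2.2
  have hall : ∀ z ∈ Z, q - 2 ≤ gg q K N (z ⊔ y) := by
    intro z hz
    rw [hZ, Finset.mem_filter] at hz
    obtain ⟨y', w1, w2, w3, w4, w5, w6⟩ := S.caseI_step f hI hz.1 hz.2.1 hz.2.2
    have := S.zero_uniq f y1 y2 y3 y4 w1 w2 w3 w4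
    subst this
    exact w6
  have hzy : ∀ z ∈ Z, z ≠ y ∧ N ≤ z ∧ finrank F z = 2 ∧ finrank F ↥(z ⊔ y) = 3 ∧ z ≤ L' ∧ ¬ z ≤ L := by
    intro z hz
    rw [hZ, Finset.mem_filter, mem_tanS] at hz
    have hne : z ≠ y := by rintro rfl; exact hz.2.2 y3
    exact ⟨hne, hz.1.1, hz.1.2.1, two_lines hz.1.2.1 y2 f.hd hz.1.1 y1 hne, hz.2.1, hz.2.2⟩
  have hsum : ∑ X ∈ ext y G, gg q K N X = 2 * q + DD q K N G :=
    S.gsum_zero f.hd y1 y2 y4 (y3.trans f.LG) f.hG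
  have hLm : L ∈ ext y G := mem_ext.2 ⟨y3, f.LG, by omega⟩
  rw [← Finset.add_sum_erase _ _ hLm] at hsum
  have hsub : Z.image (fun z => z ⊔ y) ⊆ (ext y G).erase L := by
    intro X hX
    obtain ⟨z, hz, rfl⟩ := Finset.mem_image.1 hX
    obtain ⟨a1, a2, a3, a4, a5, a6⟩ := hzy z hz
    refine Finset.mem_erase.2 ⟨?_, mem_ext.2 ⟨le_sup_right, sup_le (a5.trans f.LG') (y3.trans f.LG), by omega⟩⟩
    intro h; apply a6; rw [← h]; exact le_sup_left
  have h1 : ∑ X ∈ Z.image (fun z => z ⊔ y), gg q K N X ≤ ∑ X ∈ (ext y G).erase L, gg q K N X := by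
    apply Finset.sum_le_sum_of_subset_of_nonneg hsub
    intro X hX _
    rw [Finset.mem_erase, mem_ext] at hX
    exact (S.fg_ge f (y1.trans hX.2.1) hX.2.2.1 (by omega) hX.1 (by rintro rfl; exact y5 hX.2.1)).1
  rw [Finset.sum_image] at h1
  · have h2 : ∑ z ∈ Z, (q - 2) ≤ ∑ z ∈ Z, gg q K N (z ⊔ y) := Finset.sum_le_sum hall
    rw [Finset.sum_const, nsmul_eq_mul] at h2
    have h3 := f.hD
    have h4 : DD q K N G ≤ 2 := by omega
    nlinarith
  · intro z hz z' hz' heq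
    obtain ⟨a1, a2, a3, a4, a5, a6⟩ := hzy z hz
    obtain ⟨b1, b2, b3, b4, b5, b6⟩ := hzy z' hz'
    by_contra hne
    simp only at heq
    have s1 := plane_span a3 b3 f.hd a2 b2 hne hLd' a5 b5
    have s2 := plane_span a3 b3 f.hd a2 b2 hne a4 le_sup_left (heq ▸ le_sup_left)
    apply y5
    rw [← s1, s2]; exact le_sup_right

lemma caseII (hD : DD q K N G = 0) (hk : (kap K L : ℤ) = q) (hk' : (kap K L' : ℤ) = q) : False := by
  have hq := S.q_ge
  have hLd := f.hL
  have hLd' := f.hL'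
  have hGd := f.hG
  have hyd := planes_inf hGd hLd hLd' f.LG f.LG' f.ne
  set y := L ⊓ L' with hy
  have hNy : N ≤ y := le_inf f.NL f.NL'
  have hyL : y ≤ L := inf_le_left
  have hyL' : y ≤ L' := inf_le_right
  have gL := S.g_free f.hd f.hN f.NL f.fL
  have gL' := S.g_free f.hd f.hN f.NL' f.fL'
  have hm : L ∈ ext y G := mem_ext.2 ⟨hyL, f.LG, by omega⟩
  have hm' : L' ∈ (ext y G).erase L := Finset.mem_erase.2 ⟨f.ne.symm, mem_ext.2 ⟨hyL', f.LG', by omega⟩⟩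
  have val : ∀ X ∈ ((ext y G).erase L).erase L', gg q K N X = if secN K N X = 0 then q + 2 - 2 * (tanN K N y : ℤ) else 0 := by
    intro X hX
    rw [Finset.mem_erase, Finset.mem_erase, mem_ext] at hX
    obtain ⟨n', n, hyX, hXG, hXd⟩ := hX
    have hNX := hNy.trans hyX
    have gX := S.fg_ge f hNX hXG (by omega) n n'
    split_ifs with hs
    · have gX2 := gX.2 hs
      rw [S.g_free f.hd f.hN hNX hs, S.kap_free f.hd f.hN hNX hs]
      have : tanN K N X = tanN K N y := by
        apply le_antisymm _ (tan_mono hyX)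
        apply Finset.card_le_card
        intro v hv
        rw [Finset.mem_filter] at hv ⊢
        refine ⟨hv.1, ?_⟩
        obtain ⟨hNv, hvd, hvk⟩ := mem_tanS.1 hv.1
        have hvX : v ≤ X := hv.2
        have e1 : X ⊓ L = y := by
          have := planes_inf hGd (by omega) hLd hXG f.LG n
          exact (eq_of_le_dim (le_inf hyX hyL) (by omega)).symm
        have e2 : X ⊓ L' = y := by
          have := planes_inf hGd (by omega) hLd' hXG f.LG' n'
          exact (eq_of_le_dim (le_inf hyX hyL') (by omega)).symm
        by_cases v1 : v ≤ L
        · exact (le_inf hvX v1).trans e1.le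
        by_cases v2 : v ≤ L'
        · exact (le_inf hvX v2).trans e2.le
        exfalso
        have a := S.gsum_solid f.hd hNv hvd (by omega) (hvX.trans hXG) f.hG
        have b : gg q K N X ≤ ∑ Y ∈ ext v G, gg q K N Y := by
          apply Finset.single_le_sum (f := fun Y => gg q K N Y)
          · intro Y hY
            rw [mem_ext] at hY
            exact (S.fg_ge f (hNv.trans hY.1) hY.2.1 (by omega) (by rintro rfl; exact v1 hY.1)
              (by rintro rfl; exact v2 hY.1)).1
          · exact mem_ext.2 ⟨hvX, hXG, by omega⟩
        omega
      rw [this]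
    · have := S.g_le_D f.hd f.hN f.hG (by omega) hXG hs
      omega
  have hsum : ∑ X ∈ ext y G, gg q K N X = gg q K N L + (gg q K N L' +
      (((((ext y G).erase L).erase L').filter (fun X => secN K N X = 0)).card : ℤ) * (q + 2 - 2 * (tanN K N y : ℤ))) := by
    rw [← Finset.add_sum_erase _ _ hm, ← Finset.add_sum_erase _ _ hm', Finset.sum_congr rfl val,
      ← Finset.sum_filter, Finset.sum_const, nsmul_eq_mul]
  generalize ((((ext y G).erase L).erase L').filter (fun X => secN K N X = 0)).card = m at hsum
  rw [tan_line f.hd hyd hNy] at hsum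
  rcases S.fL_line f hNy hyd hyL with h | h
  · rw [S.gsum_zero f.hd hNy hyd h (hyL.trans f.LG) f.hG, h] at hsum
    simp only [zero_ne_one, if_false] at hsum
    push_cast at hsum
    rw [gL, gL', hk, hk', hD] at hsum
    obtain hm3 | hm4 : (m : ℤ) ≤ 3 ∨ 4 ≤ (m : ℤ) := by omega
    · nlinarith
    · nlinarith
  · rw [S.gsum_solid f.hd hNy hyd (by omega) (hyL.trans f.LG) f.hG, h] at hsum
    simp only [if_true] at hsum
    push_cast at hsum
    rw [gL, gL', hk, hk', hD] at hsum
    obtain hm3 | hm4 : (m : ℤ) ≤ 1 ∨ 2 ≤ (m : ℤ) := by omega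
    · nlinarith
    · nlinarith

lemma fin_false : False := by
  have gL := S.g_free f.hd f.hN f.NL f.fL
  have gL' := S.g_free f.hd f.hN f.NL' f.fL'
  rcases f.hD with hD | ⟨hD, hk⟩
  · rcases f.kL with h | h
    · rcases f.kL' with h' | h'
      · exact S.caseII f hD h h'
      · exact S.caseI (f.symm hD) (by omega)
    · exact S.caseI f (by omega)
  · exact S.caseI f (by omega)

end Setup

end Geo
end CapAux

open Module

namespace CapAux
open Classical

section Geo
variable {F V : Type*} [Field F] [Fintype F] [AddCommGroup V] [Module F V] [Fintype V]
  [Fintype (Submodule F V)]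
variable {K : Finset (Submodule F V)}

namespace Setup
variable {q t : ℤ} (S : Setup K q t)
include S

lemma big_sum {N v R : Submodule F V} (hd : finrank F N = 1) (hN : N ∉ K) (hv : v ∈ tanS K N)
    (hR : R ∈ K) (hRv : R ≤ v) :
    q ^ 2 - 85 * q - 2 ≤ ∑ X ∈ (ext v ⊤).filter (fun X => ∃ B ∈ bigS q K R, X ≤ B), gg q K N X := by
  have hq := S.q_ge
  obtain ⟨hNv, hvd, hvk⟩ := mem_tanS.1 hv
  obtain ⟨A1, hA1, hvA1⟩ := S.big_cover hR (tanS_trans hv hRv)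
  have d1 := (mem_big.1 hA1).2.1
  have s1 := S.gsum_solid hd hNv hvd (by omega) hvA1 d1
  have D1 := S.big_D hd hN hR hA1 (hNv.trans hvA1)
  by_cases h2 : ∃ A2 ∈ bigS q K R, A2 ≠ A1 ∧ v ≤ A2
  · obtain ⟨A2, hA2, hne, hvA2⟩ := h2
    have d2 := (mem_big.1 hA2).2.1
    have s2 := S.gsum_solid hd hNv hvd (by omega) hvA2 d2
    have D2 := S.big_D hd hN hR hA2 (hNv.trans hvA2)
    have hbig := S.big_le hR
    have hall : ∀ B ∈ bigS q K R, B = A1 ∨ B = A2 := by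
      intro B hB
      by_contra! hn
      have : 2 < (bigS q K R).card :=
        Finset.two_lt_card_iff.2 ⟨A1, A2, B, hA1, hA2, hB, hne.symm, hn.1.symm, hn.2.symm⟩
      omega
    have e : (ext v ⊤).filter (fun X => ∃ B ∈ bigS q K R, X ≤ B) = ext v A1 ∪ ext v A2 := by
      ext X
      simp only [Finset.mem_filter, Finset.mem_union, mem_ext, le_top, true_and]
      constructor
      · rintro ⟨⟨a1, a2⟩, B, hB, hXB⟩
        rcases hall B hB with rfl | rfl
        · exact Or.inl ⟨a1, hXB, a2⟩
        · exact Or.inr ⟨a1, hXB, a2⟩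
      · rintro (⟨a1, a2, a3⟩ | ⟨a1, a2, a3⟩)
        · exact ⟨⟨a1, a3⟩, A1, hA1, a2⟩
        · exact ⟨⟨a1, a3⟩, A2, hA2, a2⟩
    have hi : ext v A1 ∩ ext v A2 ⊆ {A1 ⊓ A2} := by
      intro X hX
      simp only [Finset.mem_inter, mem_ext] at hX
      rw [Finset.mem_singleton]
      exact S.eq_inf d2 d1 hne hX.2.2.1 hX.1.2.1 (by omega)
    have hu := Finset.sum_union_inter (s₁ := ext v A1) (s₂ := ext v A2) (f := fun X => gg q K N X)
    have hs : ∑ X ∈ ext v A1 ∩ ext v A2, gg q K N X ≤ q := by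
      rcases Finset.subset_singleton_iff.1 hi with h | h
      · rw [h]; simp; omega
      · rw [h, Finset.sum_singleton]
        exact S.g_le_q hd hN hv (le_inf hvA1 hvA2)
    rw [e]
    have : 2048 * q ≤ q ^ 2 := by nlinarith
    linarith
  · push Not at h2
    have e : (ext v ⊤).filter (fun X => ∃ B ∈ bigS q K R, X ≤ B) = ext v A1 := by
      ext X
      simp only [Finset.mem_filter, mem_ext, le_top, true_and]
      constructor
      · rintro ⟨⟨a1, a2⟩, B, hB, hXB⟩
        by_cases hBA : B = A1
        · subst hBA; exact ⟨a1, hXB, a2⟩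
        · exact absurd (a1.trans hXB) (h2 B hB hBA)
      · rintro ⟨a1, a2, a3⟩
        exact ⟨⟨a1, a3⟩, A1, hA1, a2⟩
    rw [e]; omega

lemma three_free {N v R : Submodule F V} (hd : finrank F N = 1) (hN : N ∉ K) (hv : v ∈ tanS K N)
    (hR : R ∈ K) (hRv : R ≤ v) (hD : t - tanN K N ⊤ ≤ 3 * q) :
    ∃ Z : Finset (Submodule F V), 3 ≤ Z.card ∧ ∀ X ∈ Z, v ≤ X ∧ finrank F X = 3 ∧ secN K N X = 0 ∧
      ((kap K X : ℤ) = q ∨ (kap K X : ℤ) = q + 1) := by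
  have hq := S.q_ge
  obtain ⟨hNv, hvd, hvk⟩ := mem_tanS.1 hv
  have h1 := S.big_sum hd hN hv hR hRv
  have h2 := S.gsum_top hd hNv hvd (by omega)
  rw [← Finset.sum_filter_add_sum_filter_not (ext v ⊤) (fun X => ∃ B ∈ bigS q K R, X ≤ B)] at h2
  have prop : ∀ X ∈ (ext v ⊤).filter (fun X => ¬ ∃ B ∈ bigS q K R, X ≤ B),
      v ≤ X ∧ finrank F X = 3 ∧ ((kap K X : ℤ) = q ∨ (kap K X : ℤ) = q + 1) ∧ (secN K N X ≠ 0 → gg q K N X = 0) := by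
    intro X hX
    rw [Finset.mem_filter, mem_ext] at hX
    have hX3 : finrank F X = 3 := by omega
    have a := S.off_g hd hN hv hR hRv hX.1.1 hX3 (fun B hB hXB => hX.2 ⟨B, hB, hXB⟩)
    exact ⟨hX.1.1, hX3, a.1, a.2.1⟩
  generalize (ext v ⊤).filter (fun X => ¬ ∃ B ∈ bigS q K R, X ≤ B) = O at h2 prop
  refine ⟨O.filter (fun X => secN K N X = 0), ?_, ?_⟩
  · by_contra hcon
    have h3 : -q * (O.filter (fun X => secN K N X = 0)).card ≤ ∑ X ∈ O, gg q K N X := by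
      rw [← Finset.sum_filter_add_sum_filter_not O (fun X => secN K N X = 0)]
      rw [Finset.sum_eq_zero (s := O.filter (fun X => ¬ secN K N X = 0))]
      · rw [add_zero]
        calc _ = ∑ X ∈ O.filter (fun X => secN K N X = 0), -q := by rw [Finset.sum_const, nsmul_eq_mul]; ring
          _ ≤ _ := by
            apply Finset.sum_le_sum
            intro X hX
            rw [Finset.mem_filter] at hX
            have a := prop X hX.1
            rw [S.g_free hd hN (hNv.trans a.1) hX.2]
            omega
      · intro X hX
        rw [Finset.mem_filter] at hX
        exact (prop X hX.1).2.2.2 hX.2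
    have h4 : ((O.filter (fun X => secN K N X = 0)).card : ℤ) ≤ 2 := by omega
    nlinarith
  · intro X hX
    rw [Finset.mem_filter] at hX
    have a := prop X hX.1
    exact ⟨a.1, a.2.1, hX.2, a.2.2.1⟩

variable {P A z N b : Submodule F V} (c : Conf K q t P A z N) (d : ConfB K A z N b)
include c d

lemma exists_v (h2 : (bigS q K P).card = 2) : ∃ v, v ∈ tanS K N ∧ ¬ v ≤ A ∧ ¬ v ≤ b ∧ v ≠ z ∧ secN K N (z ⊔ v) ≠ 0 := by
  have hq := S.q_ge
  have hzd := c.zd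
  obtain ⟨B, hB, hBA⟩ := Finset.exists_mem_ne (by omega : 1 < (bigS q K P).card) A
  have hzB := c.only B hB hBA
  obtain ⟨hPB, hBd, hBt⟩ := mem_big.1 hB
  have hBb : B ≠ b := by rintro rfl; exact hzB d.hzb
  have t1 := (S.two_big c.hP hB c.hA hBA).2
  have d2 := S.dim_inf_solid d.hb (S.solid_not_le hBd d.hb hBb)
  have t2 := S.tan_plane_le c.hP (le_inf hPB (c.Pz.trans d.hzb)) (by omega : finrank F ↥(B ⊓ b) = 3)
  obtain ⟨l, hl, hlB, hlA, hlb⟩ := exists_tan_diff2 (K := K) (N := P) (X := B) (Y := A) (Z := b) (by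
    have : (tanN K P (B ⊓ A) : ℤ) + tanN K P (B ⊓ b) < tanN K P B := by nlinarith
    omega)
  have hl' := mem_tanS.1 hl
  have hzl : z ≠ l := by rintro rfl; exact hzB hlB
  have hld := two_lines hzd hl'.2.1 (S.pt c.hP) c.Pz hl'.1 hzl
  have hlA' : ¬ z ⊔ l ≤ A := fun h => hlA (le_sup_right.trans h)
  have hs : secN K N (z ⊔ l) ≠ 0 := fun h => hlb (le_sup_right.trans (d.all _ le_sup_left hld hlA' h))
  have a := S.coff c le_sup_left hld hlA'
  have a2 := a.2.1 hs
  have a3 := S.tan_plane c.hP (c.Pz.trans (le_sup_left : z ≤ z ⊔ l)) hld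
  have a4 := tan_two c.hz hl hzl (le_sup_left : z ≤ z ⊔ l) le_sup_right
  have a5 : gg q K N (z ⊔ l) = q + 2 - kap K (z ⊔ l) - tanN K N (z ⊔ l) := rfl
  obtain ⟨v, hv, hvz⟩ := Finset.exists_mem_ne (s := (tanS K N).filter (fun s => id s ≤ z ⊔ l)) (by
      have : tanN K N (z ⊔ l) = ((tanS K N).filter (fun s => id s ≤ z ⊔ l)).card := rfl
      omega) z
  rw [Finset.mem_filter] at hv
  have hv' := mem_tanS.1 hv.1
  have hsp := plane_span hzd hv'.2.1 c.hd c.hNz hv'.1 hvz.symm hld le_sup_left hv.2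
  refine ⟨v, hv.1, fun h => hlA' (hsp ▸ sup_le c.hzA h), fun h => hlb ?_, hvz, hsp ▸ hs⟩
  exact (le_sup_right.trans hsp.ge).trans (sup_le d.hzb h)

/-- tangents in the solid spanned by b ⊓ A and v -/
lemma T_zero {G : Submodule F V} (hG : finrank F G = 4) (hA : A ≠ G) (hb : b ≠ G) (h0 : b ⊓ A ≤ G) :
    (tanN K N G : ℤ) ≤ 2 * q + 1 := by
  have hq := S.q_ge
  have hzd := c.zd
  have hb4 := d.hb
  have hdim := S.dim_inf_solid c.Ad (S.solid_not_le d.hb c.Ad d.hne.symm)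
  have hzh : z ≤ b ⊓ A := le_inf d.hzb c.hzA
  have hzG := hzh.trans h0
  have hm : b ⊓ A ∈ ext z G := mem_ext.2 ⟨hzh, h0, by omega⟩
  have part := tan_part (K := K) c.hd c.hNz hzG
  rw [← Finset.add_sum_erase _ _ hm] at part
  have hT := S.tan_card_le c.hd (c.hNz.trans hzh) (by omega)
  have hz1 : tanN K N z = 1 := by rw [tan_line c.hd hzd c.hNz, if_pos c.zk]
  have hle : ∑ X ∈ (ext z G).erase (b ⊓ A), ((tanN K N X : ℤ) - tanN K N z) ≤ ∑ X ∈ (ext z G).erase (b ⊓ A), 1 := by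
    apply Finset.sum_le_sum
    intro X hX
    rw [Finset.mem_erase, mem_ext] at hX
    have hXA : ¬ X ≤ A := by
      intro h
      have e1 := S.eq_inf c.Ad hG hA h hX.2.2.1 (by omega)
      have e2 := S.eq_inf c.Ad hG hA inf_le_right h0 (by omega : finrank F ↥(b ⊓ A) = 3)
      exact hX.1 (e1.trans e2.symm)
    have hXb : ¬ X ≤ b := by
      intro h
      have e1 := S.eq_inf d.hb hG hb h hX.2.2.1 (by omega)
      have e2 := S.eq_inf d.hb hG hb inf_le_left h0 (by omega : finrank F ↥(b ⊓ A) = 3)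
      exact hX.1 (e1.trans e2.symm)
    have hs : secN K N X ≠ 0 := fun h => hXb (d.all X hX.2.1 (by omega) hXA h)
    have a := S.coff c hX.2.1 (by omega) hXA
    have a2 := a.2.1 hs
    unfold gg at a2
    omega
  have hc : (((ext z G).erase (b ⊓ A)).card : ℤ) = q := by
    have a1 := S.ext2 hzG (by rw [hG, hzd])
    have a2 := Finset.card_erase_add_one hm
    omega
  rw [Finset.sum_const, nsmul_eq_mul, hc] at hle
  have hz1' : (tanN K N z : ℤ) = 1 := by exact_mod_cast hz1
  linarith

lemma C8b (h2 : (bigS q K P).card = 2) : False := by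
  have hq := S.q_ge
  have hzd := c.zd
  have hb4 := d.hb
  have hA4 := c.Ad
  obtain ⟨v, hv, hvA, hvb, hvz, hvs⟩ := S.exists_v c d h2
  obtain ⟨hNv, hvd, hvk⟩ := mem_tanS.1 hv
  obtain ⟨R, hR, hRv⟩ := exists_pt (K := K) (W := v) (by omega)
  obtain ⟨Z, hZ3, hZ⟩ := S.three_free c.hd c.hN hv hR hRv c.hD
  have hdim := S.dim_inf_solid c.Ad (S.solid_not_le d.hb c.Ad d.hne.symm)
  have hzh : z ≤ b ⊓ A := le_inf d.hzb c.hzA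
  have hNh := c.hNz.trans hzh
  have hG0 := dim_sup_line (U := b ⊓ A) hvd c.hd hNh hNv (fun h => hvb (h.trans inf_le_left))
  have hz1 : tanN K N z = 1 := by rw [tan_line c.hd hzd c.hNz, if_pos c.zk]
  have hv1 : tanN K N v = 1 := by rw [tan_line c.hd hvd hNv, if_pos hvk]
  have hT0 := S.T_zero c d (G := (b ⊓ A) ⊔ v) (by omega) (by intro h; apply hvA; rw [h]; exact le_sup_right)
    (by
      intro h; apply hvb
      calc v ≤ (b ⊓ A) ⊔ v := le_sup_right
        _ = b := h.symm) le_sup_left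
  obtain ⟨L', hL'Z, hL'0⟩ : ∃ L' ∈ Z, ¬ L' ≤ (b ⊓ A) ⊔ v := by
    by_contra! hcon
    have part := tan_part (K := K) c.hd hNv (le_sup_right : v ≤ (b ⊓ A) ⊔ v)
    have hsub : Z ⊆ ext v ((b ⊓ A) ⊔ v) := by
      intro X hX
      have := hZ X hX
      exact mem_ext.2 ⟨this.1, hcon X hX, by omega⟩
    have hle : ∑ X ∈ Z, ((tanN K N X : ℤ) - tanN K N v) ≤ ∑ X ∈ ext v ((b ⊓ A) ⊔ v), ((tanN K N X : ℤ) - tanN K N v) := by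
      apply Finset.sum_le_sum_of_subset_of_nonneg hsub
      intro X hX _
      have := tan_mono (K := K) (N := N) (mem_ext.1 hX).1
      omega
    have hge : ∑ X ∈ Z, (q - 1) ≤ ∑ X ∈ Z, ((tanN K N X : ℤ) - tanN K N v) := by
      apply Finset.sum_le_sum
      intro X hX
      have a := hZ X hX
      have a2 := S.kap_free c.hd c.hN (hNv.trans a.1) a.2.2.1
      omega
    rw [Finset.sum_const, nsmul_eq_mul] at hge
    have : (3 : ℤ) ≤ Z.card := by exact_mod_cast hZ3
    rw [hv1] at *
    push_cast at *
    nlinarith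
  obtain ⟨hvL', hL'd, hL's, hL'k⟩ := hZ L' hL'Z
  have hNL' := hNv.trans hvL'
  have hzL' : ¬ z ≤ L' := fun h => hvs (free_mono (sup_le h hvL') hL's)
  have hGd := dim_sup_line (U := L') hzd c.hd hNL' c.hNz hzL'
  set G := L' ⊔ z with hG
  have hzG : z ≤ G := le_sup_right
  have hL'G : L' ≤ G := le_sup_left
  have hvG := hvL'.trans hL'G
  have hGA : A ≠ G := by intro h; apply hvA; rw [h]; exact hvG
  have hGb : b ≠ G := by intro h; apply hvb; rw [h]; exact hvG
  have hG0' : ¬ b ⊓ A ≤ G := by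
    intro h
    have := eq_of_le_dim (sup_le h hvG) (by omega)
    apply hL'0
    rw [this]; exact hL'G
  obtain ⟨dh, dL, hL_ne, kL, fL, Tsm, Th, hD⟩ := S.cross c d (by omega) hzG hGA hGb hG0'
  set L := G ⊓ b with hL
  set h := G ⊓ A with hh
  have hzL : z ≤ L := le_inf hzG d.hzb
  have hNL := c.hNz.trans hzL
  have hLL' : L ≠ L' := by intro e; exact hzL' (e ▸ hzL)
  have TL := S.kap_free c.hd c.hN hNL fL
  have TL' := S.kap_free c.hd c.hN hNL' hL's
  -- tangents in G
  have TG : (tanN K N G : ℤ) ≤ 2 * q + 1 := by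
    have part := tan_part (K := K) c.hd c.hNz hzG
    have hm : L ∈ ext z G := mem_ext.2 ⟨hzL, inf_le_left, by omega⟩
    rw [← Finset.add_sum_erase _ _ hm] at part
    have hle : ∑ X ∈ (ext z G).erase L, ((tanN K N X : ℤ) - tanN K N z) ≤ ∑ X ∈ (ext z G).erase L, 1 := by
      apply Finset.sum_le_sum
      intro X hX
      rw [Finset.mem_erase] at hX
      have : tanN K N X ≤ 2 := by
        by_cases e : X = h
        · rw [e]; exact Th
        · exact Tsm X hX.2 e hX.1
      omega
    have hc : (((ext z G).erase L).card : ℤ) = q := by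
      have a1 := S.ext2 hzG (by omega)
      have a2 := Finset.card_erase_add_one hm
      omega
    rw [Finset.sum_const, nsmul_eq_mul, hc] at hle
    rw [hz1] at *
    push_cast at *
    omega
  have tinf : ∀ X Y : Submodule F V, finrank F X = 3 → finrank F Y = 3 → X ≤ G → Y ≤ G → N ≤ X → N ≤ Y → X ≠ Y →
      tanN K N (X ⊓ Y) ≤ 1 := by
    intro X Y a1 a2 a3 a4 a5 a6 a7
    rw [tan_line c.hd (planes_inf (by omega) a1 a2 a3 a4 a7) (le_inf a5 a6)]
    split_ifs <;> omega
  have f : FinC K q N G L L' := by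
    refine ⟨c.hd, c.hN, by omega, dL, hL'd, hNL, hNL', inf_le_left, hL'G, hLL', fL, hL's, kL, hL'k, ?_, ?_, hD⟩
    · intro X hNX hXG hX3 n1 n2
      set a := (tanS K N).filter (fun s => id s ≤ L) with ha
      set a' := (tanS K N).filter (fun s => id s ≤ L') with ha'
      set x := (tanS K N).filter (fun s => id s ≤ X) with hx
      have e1 : (x ∪ (a ∪ a')).card ≤ tanN K N G := by
        apply Finset.card_le_card
        intro l hl
        simp only [Finset.mem_union, ha, ha', hx, Finset.mem_filter, id] at hl
        simp only [Finset.mem_filter, id]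
        rcases hl with hl | hl | hl
        · exact ⟨hl.1, hl.2.trans hXG⟩
        · exact ⟨hl.1, hl.2.trans inf_le_left⟩
        · exact ⟨hl.1, hl.2.trans hL'G⟩
      have e2 := Finset.card_union_add_card_inter x (a ∪ a')
      have e3 := Finset.card_union_add_card_inter a a'
      have e4 : (x ∩ (a ∪ a')).card ≤ (x ∩ a).card + (x ∩ a').card := by
        rw [Finset.inter_union_distrib_left]; exact Finset.card_union_le _ _
      have i1 : (x ∩ a).card = tanN K N (X ⊓ L) := by rw [hx, ha, S.inf_filter]; rfl
      have i2 : (x ∩ a').card = tanN K N (X ⊓ L') := by rw [hx, ha', S.inf_filter]; rfl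
      have i3 : (a ∩ a').card = tanN K N (L ⊓ L') := by rw [ha, ha', S.inf_filter]; rfl
      have j1 : a.card = tanN K N L := rfl
      have j2 : a'.card = tanN K N L' := rfl
      have j3 : x.card = tanN K N X := rfl
      have t1 := tinf X L hX3 dL hXG inf_le_left hNX hNL n1
      have t2 := tinf X L' hX3 hL'd hXG hL'G hNX hNL' n2
      have t3 := tinf L L' dL hL'd inf_le_left hL'G hNL hNL' hLL'
      omega
    · have hDD : DD q K N G = q ^ 2 + q + 2 - kap K G - tanN K N G := rfl
      have : DD q K N G ≤ 2 := by omega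
      nlinarith
  exact S.fin_false f

omit c d in
theorem main : False := by
  obtain ⟨P, A, z, N, c⟩ := S.exists_conf
  obtain ⟨b, h1, h2, h3, h4, h5⟩ := S.exists_b c
  have d : ConfB K A z N b := ⟨h1, h2, h3, h4, h5⟩
  have a1 := S.big_le c.hP
  have a2 := S.big_pos c.hP
  obtain h | h : (bigS q K P).card = 1 ∨ (bigS q K P).card = 2 := by omega
  · exact S.C8a c d h
  · exact S.C8b c d h

end Setup

end Geo
end CapAux

open CapAux in
open Classical in
theorem cap_final (F : Type*) [Field F] [Fintype F] (q : ℕ) (hcard : Fintype.card F = q)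
    (hqeven : Even q) (hq : 2048 ≤ q)
    (K : Set (PGPoint F 4)) (hK : IsCompleteCap K)
    (hk : (q : ℝ) ^ 3 - 2 * (q : ℝ) ^ 2 + 3 * (q : ℝ) * Real.sqrt q + 8 * (q : ℝ) - 9 * Real.sqrt q - 6 ≤ (K.ncard : ℝ))
    (W : Submodule F (Fin 5 → F)) (hW : IsTangent K W) : False := by
  letI : Fintype (Submodule F (Fin 5 → F)) := Fintype.ofFinite _
  haveI : Finite (PGPoint F 4) := Finite.of_injective _ (Projectivization.submodule_injective (K := F) (V := Fin 5 → F))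
  have hinj : Function.Injective (fun P : PGPoint F 4 => P.submodule) :=
    Projectivization.submodule_injective
  obtain ⟨Kf, hKf⟩ : ∃ Kf : Finset (Submodule F (Fin 5 → F)), ∀ p, p ∈ Kf ↔ ∃ P ∈ K, P.submodule = p :=
    ⟨((Set.toFinite K).image (fun P => P.submodule)).toFinset, by intro p; simp⟩
  have hmem : ∀ P : PGPoint F 4, P.submodule ∈ Kf ↔ P ∈ K := by
    intro P
    rw [hKf]
    constructor
    · rintro ⟨Q, hQ, h⟩
      rwa [← hinj h]
    · intro h; exact ⟨P, h, rfl⟩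
  have hkap : ∀ U : Submodule F (Fin 5 → F), kap Kf U = (ptsIn U ∩ K).ncard := by
    intro U
    have h1 : (((Kf.filter (fun s => id s ≤ U)) : Finset _) : Set (Submodule F (Fin 5 → F))) =
        Set.image (fun P : PGPoint F 4 => P.submodule) (ptsIn U ∩ K) := by
      ext p
      simp only [Finset.coe_filter, Set.mem_setOf_eq, id, Set.mem_image, Set.mem_inter_iff, hKf, ptsIn]
      constructor
      · rintro ⟨⟨P, hP, rfl⟩, h⟩
        exact ⟨P, ⟨h, hP⟩, rfl⟩
      · rintro ⟨P, ⟨h, hP⟩, rfl⟩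
        exact ⟨⟨P, hP, rfl⟩, h⟩
    have h2 : kap Kf U = (Kf.filter (fun s => id s ≤ U)).card := rfl
    rw [h2, ← Set.ncard_coe_finset, h1, Set.ncard_image_of_injective _ hinj]
  have hpt1 : ∀ P : PGPoint F 4, finrank F P.submodule = 1 := fun P => P.finrank_submodule
  have hcap : Cap Kf := by
    refine ⟨?_, ?_⟩
    · intro p hp
      obtain ⟨P, -, rfl⟩ := (hKf p).1 hp
      exact hpt1 P
    · intro l hl
      rw [hkap]
      by_contra hc
      obtain ⟨a, b, c, ha, hb, hc, hab, hac, hbc⟩ := (Set.two_lt_ncard_iff (Set.toFinite _)).1 (not_le.1 hc)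
      apply hK.1 a ha.2 b hb.2 c hc.2 hab hac hbc
      exact (dim_mono (sup_le (sup_le ha.1 hb.1) hc.1)).trans hl.le
  have hdim : finrank F (⊤ : Submodule F (Fin 5 → F)) = 5 := by simp
  have htop : kap Kf ⊤ = K.ncard := by
    rw [hkap]; congr 1; ext P; simp [ptsIn]
  -- two points of K collinear with a third one give a secant
  have hsec : ∀ P A B : PGPoint F 4, A ∈ K → B ∈ K → A ≠ B → P.submodule ≤ A.submodule ⊔ B.submodule →
      ∃ l, l ∈ secS Kf P.submodule := by
    intro P A B hA hB hAB h
    have hd : finrank F ↥(A.submodule ⊔ B.submodule) = 2 :=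
      pt_sup_dim (hpt1 A) (hpt1 B) (fun h => hAB (hinj h))
    refine ⟨A.submodule ⊔ B.submodule, mem_secS.2 ⟨h, hd, ?_⟩⟩
    apply le_antisymm (hcap.line _ hd)
    rw [hkap]
    exact (Set.one_lt_ncard_iff (Set.toFinite _)).2
      ⟨A, B, ⟨(le_sup_left : A.submodule ≤ A.submodule ⊔ B.submodule), hA⟩, ⟨(le_sup_right : B.submodule ≤ A.submodule ⊔ B.submodule), hB⟩, hAB⟩
  have hcoll : ∀ P A B : PGPoint F 4, A ≠ B →
      finrank F ↥(P.submodule ⊔ (A.submodule ⊔ B.submodule)) ≤ 2 → P.submodule ≤ A.submodule ⊔ B.submodule := by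
    intro P A B hAB h
    have hd : finrank F ↥(A.submodule ⊔ B.submodule) = 2 :=
      pt_sup_dim (hpt1 A) (hpt1 B) (fun h => hAB (hinj h))
    have := eq_of_le_dim (le_sup_right : A.submodule ⊔ B.submodule ≤ P.submodule ⊔ (A.submodule ⊔ B.submodule))
      (by omega)
    rw [this]; exact le_sup_left
  have hcompl : ∀ N : Submodule F (Fin 5 → F), finrank F N = 1 → N ∉ Kf → ∃ l, l ∈ secS Kf N := by
    intro N hN hNK
    obtain ⟨P, rfl⟩ : ∃ P : PGPoint F 4, P.submodule = N := by
      exact ⟨Projectivization.mk'' N hN, Projectivization.submodule_mk'' N hN⟩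
    rw [hmem] at hNK
    have hno := hK.2 P hNK
    unfold IsCap at hno
    push Not at hno
    obtain ⟨A, hA, B, hB, C, hC, hAB, hAC, hBC, hcol⟩ := hno
    unfold Coll3 at hcol
    rcases hA with rfl | hA
    · have hB := hB.resolve_left (Ne.symm hAB)
      have hC := hC.resolve_left (Ne.symm hAC)
      exact hsec _ B C hB hC hBC (hcoll _ _ _ hBC (by rwa [← sup_assoc]))
    · rcases hB with rfl | hB
      · have hC := hC.resolve_left (Ne.symm hBC)
        exact hsec _ A C hA hC hAC (hcoll _ _ _ hAC (by rwa [← sup_assoc, sup_comm B.submodule]))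
      · rcases hC with rfl | hC
        · exact hsec _ A B hA hB hAB (hcoll _ _ _ hAB (by rwa [sup_comm]))
        · exact absurd hcol (hK.1 A hA B hB C hC hAB hAC hBC)
  have hchar : CharP F 2 := by
    have h : ringChar F = 2 := by
      rw [FiniteField.even_card_iff_char_two, hcard]
      exact Nat.even_iff.1 hqeven
    exact ringChar.of_eq h
  have hbound : (q : ℤ) ^ 3 + q ^ 2 + q + 2 - kap Kf ⊤ ≤ 3 * (q : ℤ) ^ 2 - 135 * q := by
    have hqR : (2048 : ℝ) ≤ q := by exact_mod_cast hq
    have hs : (45 : ℝ) ≤ Real.sqrt q := Real.le_sqrt_of_sq_le (by linarith)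
    have h : (q : ℝ) ^ 3 + q ^ 2 + q + 2 - (K.ncard : ℝ) ≤ 3 * (q : ℝ) ^ 2 - 135 * q := by
      nlinarith [mul_nonneg (sub_nonneg.2 hs) (by linarith : (0 : ℝ) ≤ 3 * q - 9)]
    rw [htop]
    exact_mod_cast h
  have hpos : (1 : ℤ) ≤ (q : ℤ) ^ 3 + q ^ 2 + q + 2 - kap Kf ⊤ := by
    obtain ⟨hW2, hW1⟩ := hW
    obtain ⟨P, hP⟩ := (Set.ncard_pos (Set.toFinite _)).1 (by omega : 0 < (ptsIn W ∩ K).ncard)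
    have hPK := (hmem P).2 hP.2
    have e := tan_at hcap hPK (le_top : P.submodule ≤ ⊤)
    rw [card_ext4 le_top (by rw [hdim, hpt1]), hcard] at e
    have hz : W ∈ tanS Kf P.submodule := mem_tanS.2 ⟨hP.1, hW2, by rw [hkap, hW1]⟩
    have := tan_pos hz le_top
    omega
  exact Setup.main (K := Kf) (q := q) (t := (q : ℤ) ^ 3 + q ^ 2 + q + 2 - kap Kf ⊤)
    ⟨hcap, hchar, by rw [hcard], by exact_mod_cast hq, hdim, hcompl, by ring, hbound, hpos⟩

theorem stmt6 (F : Type*) [Field F] [Fintype F] (q : ℕ) (hcard : Fintype.card F = q)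
    (hqeven : Even q) (hq : 2048 ≤ q)
    (K : Set (PGPoint F 4)) (hK : IsCompleteCap K)
    (hk : (q : ℝ) ^ 3 - 2 * (q : ℝ) ^ 2 + 3 * (q : ℝ) * Real.sqrt q + 8 * (q : ℝ) - 9 * Real.sqrt q - 6 ≤ (K.ncard : ℝ)) :
    ∀ N : PGPoint F 4, N ∉ K →
      {ℓ : Submodule F (Fin 5 → F) | IsTangent K ℓ ∧ N.submodule ≤ ℓ}.ncard ≤ q ^ 2 := by
  intro N hN
  have h : {ℓ : Submodule F (Fin 5 → F) | IsTangent K ℓ ∧ N.submodule ≤ ℓ} = ∅ := by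
    ext W
    simp only [Set.mem_setOf_eq, Set.mem_empty_iff_false, iff_false]
    rintro ⟨hW, -⟩
    exact cap_final F q hcard hqeven hq K hK hk W hW
  rw [h]
  simp
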